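/- Let n and k be positive integers with n − k ≥ 1. If there exists a symplectic embedding of B̄²(1) × ℂ^{n−1} into B^{2k}(r) × ℂ^{n−k} for some real r > 0, then r > k. -/

import Mathlib

open scoped Real

noncomputable section

/-- The standard symplectic form on `ℂⁿ`: `ω_std(v,w) = ∑ i, Im(conj(v i) * w i)`. -/
def omegaStd (n : ℕ) (v w : Fin n → ℂ) : ℝ :=
  ∑ i, ((starRingEnd ℂ) (v i) * w i).im

/-- `Φ` is a symplectic embedding of `U ⊆ ℂⁿ` into `V ⊆ ℂⁿ`. -/
def IsSymplecticEmbedding (n : ℕ) (U V : Set (Fin n → ℂ))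
    (Φ : (Fin n → ℂ) → (Fin n → ℂ)) : Prop :=
  Set.InjOn Φ U ∧ Set.MapsTo Φ U V ∧
  ∃ O : Set (Fin n → ℂ), IsOpen O ∧ U ⊆ O ∧ ContDiffOn ℝ (⊤ : ℕ∞) Φ O ∧
    ∀ z ∈ U, ∀ v w : Fin n → ℂ,
      omegaStd n (fderiv ℝ Φ z v) (fderiv ℝ Φ z w) = omegaStd n v w

/-- `B^{2k}(r) × ℂ^{n-k} = {z ∈ ℂⁿ : π ∑_{i<k} |zᵢ|² < r}`. -/
def ballCyl (n k : ℕ) (r : ℝ) : Set (Fin n → ℂ) :=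
  {z | Real.pi * ∑ i : Fin n, (if (i : ℕ) < k then ‖z i‖ ^ 2 else 0) < r}

section Helpers

set_option linter.unusedSectionVars false

open MeasureTheory Set

section NullLagrangian

variable {V : Type*} [NormedAddCommGroup V] [NormedSpace ℝ V] [FiniteDimensional ℝ V]

lemma det_eq_sum_det_smul_id_add (v : ℕ → ℝ) (hv : Function.Injective v) :
    ∃ w : ℕ → ℝ, ∀ T : V →ₗ[ℝ] V, LinearMap.det T =
      ∑ i ∈ Finset.range (Module.finrank ℝ V + 1),
        w i * LinearMap.det (v i • LinearMap.id + T) := by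
  set s := Finset.range (Module.finrank ℝ V + 1)
  refine ⟨fun i => (Lagrange.basis s v i).eval 0, fun T => ?_⟩
  have hdeg : ((-T).charpoly).degree < s.card := by
    rw [Polynomial.degree_eq_natDegree (LinearMap.charpoly_monic _).ne_zero,
      LinearMap.charpoly_natDegree]
    simp [s]
    exact_mod_cast Nat.lt_succ_self _
  have h := Lagrange.eq_interpolate (s := s) (v := v) hv.injOn hdeg
  have h0 := congrArg (Polynomial.eval 0) h
  have he : ∀ t : ℝ, ((-T).charpoly).eval t = LinearMap.det (t • LinearMap.id + T) := by
    intro t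
    rw [LinearMap.eval_charpoly, sub_neg_eq_add]
    rfl
  rw [he, Lagrange.interpolate_apply, Polynomial.eval_finsetSum] at h0
  simp only [zero_smul, zero_add, Polynomial.eval_mul, Polynomial.eval_C, he] at h0
  rw [h0]
  exact Finset.sum_congr rfl fun i _ => mul_comm _ _

lemma det_smul_id_add_pos {T : V →L[ℝ] V} {c : ℝ} (hT : ‖T‖ < c) :
    0 < (c • ContinuousLinearMap.id ℝ V + T).det := by
  have hc : 0 < c := (norm_nonneg _).trans_lt hT
  let F : ℝ → ℝ := fun s => (c • ContinuousLinearMap.id ℝ V + s • T).det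
  have hF : Continuous F := by
    have : Continuous fun s : ℝ => (c • ContinuousLinearMap.id ℝ V + s • T) := by fun_prop
    exact ContinuousLinearMap.continuous_det.comp this
  have hne : ∀ s ∈ Icc (0:ℝ) 1, F s ≠ 0 := by
    intro s hs h0
    obtain ⟨x, hx, hx0⟩ := (Submodule.ne_bot_iff _).1
      (LinearMap.bot_lt_ker_of_det_eq_zero h0).ne'
    have h1 : c • x + s • T x = 0 := by simpa using hx
    have h2 : c * ‖x‖ = s * ‖T x‖ := by
      have := congrArg norm (eq_neg_of_add_eq_zero_left h1)
      rwa [norm_neg, norm_smul, norm_smul, Real.norm_of_nonneg hc.le,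
        Real.norm_of_nonneg hs.1] at this
    have hxpos := norm_pos_iff.2 hx0
    have h3 : s * ‖T x‖ ≤ ‖T‖ * ‖x‖ :=
      (mul_le_of_le_one_left (norm_nonneg _) hs.2).trans (T.le_opNorm x)
    nlinarith
  have h0 : 0 < F 0 := by
    simp only [F, zero_smul, add_zero, ContinuousLinearMap.det]
    rw [ContinuousLinearMap.toLinearMap_smul, LinearMap.det_smul]
    have : LinearMap.det ((ContinuousLinearMap.id ℝ V : V →L[ℝ] V) : V →ₗ[ℝ] V) = 1 := by
      simp
    rw [this]
    positivity
  by_contra! h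
  have h1 : F 1 ≤ 0 := by simpa [F] using h
  obtain ⟨s, hs, hs0⟩ := intermediate_value_Icc' zero_le_one hF.continuousOn
    (⟨h1, h0.le⟩ : (0:ℝ) ∈ Icc (F 1) (F 0))
  exact hne s hs hs0

variable [MeasurableSpace V] [BorelSpace V] (μ : Measure V) [μ.IsAddHaarMeasure]

lemma continuous_det_fderiv {f : V → V} (hf : ContDiff ℝ 1 f) :
    Continuous fun x => (fderiv ℝ f x).det :=
  ContinuousLinearMap.continuous_det.comp (hf.continuous_fderiv one_ne_zero)

lemma bijective_smul_add_of_lipschitzWith {f : V → V} {K : NNReal} (hf : LipschitzWith K f)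
    {c : ℝ} (hc : K < c) : Function.Bijective fun x => c • x + f x := by
  have hc0 : 0 < c := K.2.trans_lt hc
  have key : ∀ y : V, ∃! x, c • x + f x = y := by
    intro y
    have hL : ContractingWith (K / c.toNNReal) fun x => c⁻¹ • (y - f x) := by
      refine ⟨?_, LipschitzWith.of_dist_le_mul fun a b => ?_⟩
      · rw [div_lt_one (by simpa using hc0)]
        exact Real.lt_toNNReal_iff_coe_lt.2 hc
      · rw [dist_smul₀, dist_sub_left, NNReal.coe_div, Real.coe_toNNReal _ hc0.le,
          Real.norm_of_nonneg (by positivity), div_mul_eq_mul_div, inv_mul_eq_div]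
        gcongr
        exact hf.dist_le_mul a b
    have hiff : ∀ x, c • x + f x = y ↔ c⁻¹ • (y - f x) = x := by
      intro x
      rw [inv_smul_eq_iff₀ hc0.ne', sub_eq_iff_eq_add, eq_comm]
    refine ⟨hL.fixedPoint, (hiff _).2 hL.fixedPoint_isFixedPt, fun z hz => ?_⟩
    exact hL.fixedPoint_unique ((hiff z).1 hz)
  exact Function.bijective_iff_existsUnique _ |>.2 key

lemma setIntegral_det_smul_id_add_fderiv {f : V → V} {K : NNReal} (hf : ContDiff ℝ 1 f)
    (hK : LipschitzWith K f) {c : ℝ} (hc : K < c) {s : Set V} (hs : MeasurableSet s) :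
    ∫ x in s, (c • ContinuousLinearMap.id ℝ V + fderiv ℝ f x).det ∂μ =
      μ.real ((fun x => c • x + f x) '' s) := by
  have hd : ∀ x, HasFDerivAt (fun x => c • x + f x)
      (c • ContinuousLinearMap.id ℝ V + fderiv ℝ f x) x := fun x =>
    ((hasFDerivAt_id x).const_smul c).add
      ((hf.differentiable one_ne_zero).differentiableAt.hasFDerivAt)
  have h := integral_image_eq_integral_abs_det_fderiv_smul μ hs
    (fun x _ => (hd x).hasFDerivWithinAt)
    (bijective_smul_add_of_lipschitzWith hK hc).1.injOn (fun _ => (1:ℝ))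
  simp only [integral_const, smul_eq_mul, mul_one, measureReal_restrict_apply_univ] at h
  rw [h]
  congr 1 with x
  exact (abs_of_pos (det_smul_id_add_pos
    ((norm_fderiv_le_of_lipschitz ℝ hK).trans_lt hc))).symm

lemma setIntegral_det_fderiv_congr {f g : V → V} (hf : ContDiff ℝ 1 f) (hg : ContDiff ℝ 1 g)
    {R ρ : ℝ} (hRρ : R < ρ) (hρ : 0 < ρ) (hfg : ∀ x, R ≤ ‖x‖ → f x = g x) :
    ∫ x in Metric.ball 0 ρ, (fderiv ℝ f x).det ∂μ =
      ∫ x in Metric.ball 0 ρ, (fderiv ℝ g x).det ∂μ := by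
  let χ : ContDiffBump (0 : V) := ⟨ρ, ρ + 1, hρ, by linarith⟩
  have red : ∀ f : V → V, ContDiff ℝ 1 f → ∃ f' : V → V, (f' = fun x => χ x • f x) ∧
      ContDiff ℝ 1 f' ∧
      HasCompactSupport f' ∧ ∀ x ∈ Metric.ball (0:V) ρ, fderiv ℝ f' x = fderiv ℝ f x := by
    intro f hf
    refine ⟨_, rfl, χ.contDiff.smul hf, χ.hasCompactSupport.smul_right, fun x hx => ?_⟩
    apply Filter.EventuallyEq.fderiv_eq
    filter_upwards [χ.eventuallyEq_one_of_mem_ball hx] with y hy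
    simp [hy]
  obtain ⟨f', hf'e, hf', hf's, hf'd⟩ := red f hf
  obtain ⟨g', hg'e, hg', hg's, hg'd⟩ := red g hg
  have hfg' : ∀ x, R ≤ ‖x‖ → f' x = g' x := by
    intro x hx
    simp [hf'e, hg'e, hfg x hx]
  obtain ⟨K₁, hK₁⟩ := hf'.lipschitzWith_of_hasCompactSupport hf's one_ne_zero
  obtain ⟨K₂, hK₂⟩ := hg'.lipschitzWith_of_hasCompactSupport hg's one_ne_zero
  set K := max K₁ K₂
  replace hK₁ := hK₁.weaken (le_max_left K₁ K₂)
  replace hK₂ := hK₂.weaken (le_max_right K₁ K₂)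
  have hm : MeasurableSet (Metric.ball (0:V) ρ) := Metric.isOpen_ball.measurableSet
  have him : ∀ c : ℝ, K < c → (fun x => c • x + f' x) '' Metric.ball 0 ρ =
      (fun x => c • x + g' x) '' Metric.ball 0 ρ := by
    intro c hc
    have hF := bijective_smul_add_of_lipschitzWith hK₁ hc
    have hG := bijective_smul_add_of_lipschitzWith hK₂ hc
    rw [← compl_inj_iff, ← image_compl_eq hF, ← image_compl_eq hG]
    refine image_congr fun x hx => ?_
    have : ρ ≤ ‖x‖ := by simpa using hx
    rw [hfg' x (by linarith)]
  obtain ⟨w, hw⟩ := det_eq_sum_det_smul_id_add (V := V) (fun i => (K:ℝ) + 1 + i)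
    (fun i j h => by simpa using h)
  have main : ∀ f' : V → V, ContDiff ℝ 1 f' → LipschitzWith K f' →
      ∫ x in Metric.ball 0 ρ, (fderiv ℝ f' x).det ∂μ =
      ∑ i ∈ Finset.range (Module.finrank ℝ V + 1), w i *
        μ.real ((fun x => ((K:ℝ) + 1 + i) • x + f' x) '' Metric.ball 0 ρ) := by
    intro f' hf' hK
    have h1 : ∀ x, (fderiv ℝ f' x).det = ∑ i ∈ Finset.range (Module.finrank ℝ V + 1),
        w i * (((K:ℝ) + 1 + i) • ContinuousLinearMap.id ℝ V + fderiv ℝ f' x).det :=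
      fun x => hw _
    simp only [h1]
    rw [integral_finsetSum]
    · refine Finset.sum_congr rfl fun i _ => ?_
      rw [integral_const_mul, setIntegral_det_smul_id_add_fderiv μ hf' hK (by linarith) hm]
    · intro i _
      refine Integrable.const_mul ?_ _
      have hcont : Continuous fun x =>
          (((K:ℝ) + 1 + i) • ContinuousLinearMap.id ℝ V + fderiv ℝ f' x).det :=
        ContinuousLinearMap.continuous_det.comp
          (continuous_const.add (hf'.continuous_fderiv one_ne_zero))
      exact (hcont.continuousOn.integrableOn_compact (isCompact_closedBall 0 ρ)).mono_set
        Metric.ball_subset_closedBall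
  calc _ = ∫ x in Metric.ball 0 ρ, (fderiv ℝ f' x).det ∂μ :=
        setIntegral_congr_fun hm fun x hx => by simp only [hf'd x hx]
    _ = ∫ x in Metric.ball 0 ρ, (fderiv ℝ g' x).det ∂μ := by
        rw [main f' hf' hK₁, main g' hg' hK₂]
        refine Finset.sum_congr rfl fun i _ => ?_
        rw [him _ (by linarith)]
    _ = _ := setIntegral_congr_fun hm fun x hx => by simp only [hg'd x hx]

end NullLagrangian

section Degree

lemma exists_hasDerivAt_tent (δ : ℝ) :
    ∃ γ : ℝ → ℝ, ∀ t, HasDerivAt γ (max 0 (δ - |t|)) t := by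
  have hc : Continuous fun t : ℝ => max 0 (δ - |t|) := by fun_prop
  exact ⟨fun t => ∫ x in (0:ℝ)..t, max 0 (δ - |x|), fun t =>
    intervalIntegral.integral_hasDerivAt_right (hc.intervalIntegrable _ _)
      hc.aestronglyMeasurable.stronglyMeasurableAtFilter hc.continuousAt⟩

/-- The real linear map `v ↦ a Re v + i b Im v`. -/
def reImScale (a b : ℝ) : ℂ →L[ℝ] ℂ :=
  (a • Complex.reCLM).smulRight (1 : ℂ) + (b • Complex.imCLM).smulRight Complex.I

lemma det_reImScale (a b : ℝ) : (reImScale a b).det = a * b := by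
  rw [ContinuousLinearMap.det, ← LinearMap.det_toMatrix Complex.basisOneI, Matrix.det_fin_two]
  simp [LinearMap.toMatrix_apply, reImScale]

lemma det_smul_one_complex (c : ℂ) :
    (c • (1 : ℂ →L[ℝ] ℂ)).det = ‖c‖ ^ 2 := by
  rw [ContinuousLinearMap.det, ← LinearMap.det_toMatrix Complex.basisOneI, Matrix.det_fin_two,
    ← Complex.normSq_eq_norm_sq]
  simp [LinearMap.toMatrix_apply, Complex.normSq_apply]

lemma contDiff_one_of_hasFDerivAt {E F : Type*} [NormedAddCommGroup E] [NormedSpace ℝ E]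
    [NormedAddCommGroup F] [NormedSpace ℝ F] {f : E → F} {f' : E → E →L[ℝ] F}
    (h : ∀ x, HasFDerivAt f (f' x) x) (hf' : Continuous f') : ContDiff ℝ 1 f := by
  rw [contDiff_one_iff_fderiv]
  exact ⟨fun x => (h x).differentiableAt, by
    rwa [show fderiv ℝ f = f' from funext fun x => (h x).fderiv]⟩

variable {A B : Type*} [Fintype A] [Fintype B]

/-- The map acting separately on the coordinates of `(A → ℂ) × (B → ℂ) × ℝ`. -/
def coordMap (f g : ℂ → ℂ) (h : ℝ → ℝ) (x : (A → ℂ) × (B → ℂ) × ℝ) :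
    (A → ℂ) × (B → ℂ) × ℝ :=
  (fun i => f (x.1 i), fun i => g (x.2.1 i), h x.2.2)

lemma hasFDerivAt_pi_coord {ι : Type*} [Fintype ι] {f : ℂ → ℂ} {f' : ℂ → ℂ →L[ℝ] ℂ}
    (hf : ∀ z, HasFDerivAt f (f' z) z) (x : ι → ℂ) :
    HasFDerivAt (fun x : ι → ℂ => fun i => f (x i))
      (ContinuousLinearMap.pi fun i => (f' (x i)).comp (ContinuousLinearMap.proj i)) x := by
  rw [hasFDerivAt_pi]
  exact fun i => (hf (x i)).comp x
    (ContinuousLinearMap.proj (R := ℝ) (φ := fun _ : ι => ℂ) i).hasFDerivAt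

lemma contDiff_coordMap {f g : ℂ → ℂ} {h : ℝ → ℝ} (hf : ContDiff ℝ 1 f) (hg : ContDiff ℝ 1 g)
    (hh : ContDiff ℝ 1 h) : ContDiff ℝ 1 (coordMap (A := A) (B := B) f g h) := by
  unfold coordMap
  fun_prop

lemma det_fderiv_coordMap {f g : ℂ → ℂ} {h : ℝ → ℝ} (hf : ContDiff ℝ 1 f)
    (hg : ContDiff ℝ 1 g) (hh : ContDiff ℝ 1 h) (x : (A → ℂ) × (B → ℂ) × ℝ) :
    (fderiv ℝ (coordMap f g h) x).det = (∏ i, (fderiv ℝ f (x.1 i)).det) *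
      ((∏ i, (fderiv ℝ g (x.2.1 i)).det) * (fderiv ℝ h x.2.2).det) := by
  have h1 := hasFDerivAt_pi_coord (fun z => (hf.differentiable one_ne_zero z).hasFDerivAt) x.1
  have h2 := hasFDerivAt_pi_coord (fun z => (hg.differentiable one_ne_zero z).hasFDerivAt) x.2.1
  have h3 := (hh.differentiable one_ne_zero x.2.2).hasFDerivAt
  have h4 : HasFDerivAt (coordMap f g h) _ x := h1.prodMap x (h2.prodMap x.2 h3)
  rw [h4.fderiv]
  simp only [ContinuousLinearMap.det, ContinuousLinearMap.coe_prodMap]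
  rw [LinearMap.det_prodMap, LinearMap.det_prodMap, ← LinearMap.det_pi, ← LinearMap.det_pi]
  rfl

variable {γ : ℝ → ℝ} {δ : ℝ}

lemma hasFDerivAt_reIm (hγ : ∀ t, HasDerivAt γ (max 0 (δ - |t|)) t) (z : ℂ) :
    HasFDerivAt (fun z : ℂ => (γ z.re : ℂ) + γ z.im * Complex.I)
      (reImScale (max 0 (δ - |z.re|)) (max 0 (δ - |z.im|))) z := by
  have h1 := ((hγ z.re).comp_hasFDerivAt z Complex.reCLM.hasFDerivAt)
  have h2 := ((hγ z.im).comp_hasFDerivAt z Complex.imCLM.hasFDerivAt)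
  have h := (h1.smul_const (1:ℂ)).add (h2.smul_const Complex.I)
  refine h.congr_of_eventuallyEq (.of_forall fun w => ?_)
  simp

lemma continuous_reImScale {X : Type*} [TopologicalSpace X] {a b : X → ℝ} (ha : Continuous a)
    (hb : Continuous b) : Continuous fun x => reImScale (a x) (b x) := by
  unfold reImScale
  have : ∀ (L : ℂ →L[ℝ] ℝ) (c : ℂ) (a : ℝ), (a • L).smulRight c = a • L.smulRight c := by
    intro L c a
    ext x
    simp [mul_assoc]
  simp only [this]
  fun_prop

lemma contDiff_reIm (hγ : ∀ t, HasDerivAt γ (max 0 (δ - |t|)) t) :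
    ContDiff ℝ 1 (fun z : ℂ => (γ z.re : ℂ) + γ z.im * Complex.I) :=
  contDiff_one_of_hasFDerivAt (hasFDerivAt_reIm hγ)
    (continuous_reImScale (by fun_prop) (by fun_prop))

lemma contDiff_of_tent (hγ : ∀ t, HasDerivAt γ (max 0 (δ - |t|)) t) : ContDiff ℝ 1 γ := by
  rw [contDiff_one_iff_deriv]
  refine ⟨fun t => (hγ t).differentiableAt, ?_⟩
  rw [show deriv γ = _ from funext fun t => (hγ t).deriv]
  fun_prop

/-- The coordinatewise power map with a shift in the last coordinate. -/
def powShift (L : ℕ) (ρ : ℝ) : (A → ℂ) × (B → ℂ) × ℝ → (A → ℂ) × (B → ℂ) × ℝ :=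
  coordMap id (· ^ L) (· - ρ)

lemma contDiff_powShift (L : ℕ) (ρ : ℝ) (n : WithTop ℕ∞) :
    ContDiff ℝ n (powShift (A := A) (B := B) L ρ) := by
  unfold powShift coordMap
  simp only [id]
  fun_prop

variable (A B) in
/-- The coordinatewise smoothed step map. -/
def stepMap (γ : ℝ → ℝ) : (A → ℂ) × (B → ℂ) × ℝ → (A → ℂ) × (B → ℂ) × ℝ :=
  coordMap (fun z : ℂ => (γ z.re : ℂ) + γ z.im * Complex.I)
    (fun z : ℂ => (γ z.re : ℂ) + γ z.im * Complex.I) γ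

lemma det_fderiv_stepMap (hγ : ∀ t, HasDerivAt γ (max 0 (δ - |t|)) t)
    (x : (A → ℂ) × (B → ℂ) × ℝ) :
    (fderiv ℝ (stepMap A B γ) x).det =
      (∏ i, (max 0 (δ - |(x.1 i).re|) * max 0 (δ - |(x.1 i).im|))) *
      ((∏ i, (max 0 (δ - |(x.2.1 i).re|) * max 0 (δ - |(x.2.1 i).im|))) *
        max 0 (δ - |x.2.2|)) := by
  rw [stepMap, det_fderiv_coordMap (contDiff_reIm hγ) (contDiff_reIm hγ) (contDiff_of_tent hγ)]
  simp only [(hasFDerivAt_reIm hγ _).fderiv, det_reImScale, (hγ _).hasFDerivAt.fderiv]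
  congr 2
  simp [ContinuousLinearMap.det]

lemma det_fderiv_stepMap_eq_zero (hδ : 0 < δ) (hγ : ∀ t, HasDerivAt γ (max 0 (δ - |t|)) t)
    {x : (A → ℂ) × (B → ℂ) × ℝ} (hx : 2 * δ ≤ ‖x‖) :
    (fderiv ℝ (stepMap A B γ) x).det = 0 := by
  rw [det_fderiv_stepMap hγ]
  by_contra h
  simp only [mul_ne_zero_iff, Finset.prod_ne_zero_iff, Finset.mem_univ, true_imp_iff] at h
  have key : ∀ t : ℝ, max 0 (δ - |t|) ≠ 0 → |t| < δ := by
    intro t ht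
    by_contra! h'
    exact ht (max_eq_left (by linarith))
  have keyc : ∀ z : ℂ, max 0 (δ - |z.re|) ≠ 0 ∧ max 0 (δ - |z.im|) ≠ 0 → ‖z‖ < 2 * δ := by
    intro z hz
    have := Complex.norm_le_abs_re_add_abs_im z
    linarith [key _ hz.1, key _ hz.2]
  obtain ⟨h1, h2, h3⟩ := h
  refine absurd hx (not_le.2 ?_)
  rw [Prod.norm_def, Prod.norm_def]
  refine max_lt ?_ (max_lt ?_ ?_)
  · exact (pi_norm_lt_iff (by positivity)).2 fun i => keyc _ (h1 i)
  · exact (pi_norm_lt_iff (by positivity)).2 fun i => keyc _ (h2 i)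
  · rw [Real.norm_eq_abs]; linarith [key _ h3]

lemma det_fderiv_powShift (L : ℕ) (ρ : ℝ) (x : (A → ℂ) × (B → ℂ) × ℝ) :
    (fderiv ℝ (powShift (A := A) (B := B) L ρ) x).det =
      ∏ i, ‖(L : ℂ) * (x.2.1 i) ^ (L - 1)‖ ^ 2 := by
  rw [powShift, det_fderiv_coordMap contDiff_id (by fun_prop) (by fun_prop)]
  have h1 : ∀ z : ℂ, fderiv ℝ (fun z : ℂ => z ^ L) z = ((L:ℂ) * z ^ (L-1)) • 1 := fun z =>
    (hasDerivAt_pow L z).complexToReal_fderiv.fderiv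
  have h2 : fderiv ℝ (fun t : ℝ => t - ρ) x.2.2 = ContinuousLinearMap.id ℝ ℝ :=
    ((hasFDerivAt_id x.2.2).sub_const ρ).fderiv
  simp only [h1, det_smul_one_complex, h2, fderiv_id]
  simp [ContinuousLinearMap.det]

/-- A map which agrees with a coordinatewise power map near infinity has a zero. -/
lemma exists_zero_of_eq_powShift {L : ℕ} (hL : 0 < L) (ρ : ℝ)
    {G : (A → ℂ) × (B → ℂ) × ℝ → (A → ℂ) × (B → ℂ) × ℝ} (hG : Continuous G) (R : ℝ)
    (hGR : ∀ x, R ≤ ‖x‖ → G x = powShift L ρ x) : ∃ x, G x = 0 := by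
  by_contra! hne
  let V := (A → ℂ) × (B → ℂ) × ℝ
  obtain ⟨g, hg, hgd, hgR, -⟩ := hG.exists_contDiff_approx_and_eqOn 1
    (ε := fun x => ‖G x‖ / 2) (by fun_prop) (fun x => by simpa using hne x)
    (S := {x | R + 1 ≤ ‖x‖}) (U := {x | R < ‖x‖})
    (isClosed_le continuous_const continuous_norm)
    ((isOpen_lt continuous_const continuous_norm).mem_nhdsSet.2 fun x hx => by
      simp only [mem_ofPred_eq] at hx ⊢; linarith)
    (((contDiff_powShift L ρ _).contDiffOn).congr fun x hx => hGR x (le_of_lt hx))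
  have hgne : ∀ x, g x ≠ 0 := by
    intro x hx
    have := hgd x
    rw [hx, dist_zero_left] at this
    linarith [norm_nonneg (G x)]
  set r : ℝ := max (R + 2) (|ρ| + 2)
  have hr0 : 0 < r := lt_of_lt_of_le (by positivity) (le_max_right _ _)
  obtain ⟨x₀, -, hx₀⟩ := (isCompact_closedBall (0:V) r).exists_isMinOn
    ⟨0, by simpa using hr0.le⟩ (hg.continuous.norm.continuousOn)
  set δ := ‖g x₀‖ / 2
  have hδ : 0 < δ := by have := norm_pos_iff.2 (hgne x₀); positivity
  obtain ⟨γ, hγ⟩ := exists_hasDerivAt_tent δ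
  have hκ : ContDiff ℝ 1 (stepMap A B γ) :=
    contDiff_coordMap (contDiff_reIm hγ) (contDiff_reIm hγ) (contDiff_of_tent hγ)
  have hP : ContDiff ℝ 1 (powShift (A := A) (B := B) L ρ) := contDiff_powShift L ρ 1
  have hcomp : ∀ f : V → V, ContDiff ℝ 1 f → ∀ x, (fderiv ℝ (stepMap A B γ ∘ f) x).det =
      (fderiv ℝ (stepMap A B γ) (f x)).det * (fderiv ℝ f x).det := by
    intro f hf x
    rw [fderiv_comp _ (hκ.differentiable one_ne_zero _) (hf.differentiable one_ne_zero _)]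
    exact LinearMap.det_comp _ _
  let μ : Measure V := Measure.addHaar
  have heq := setIntegral_det_fderiv_congr μ (hκ.comp hg) (hκ.comp hP)
    (R := R + 1) (ρ := r) (lt_of_lt_of_le (by linarith) (le_max_left _ _)) hr0
    (fun x hx => by
      simp only [Function.comp]
      rw [hgR hx, hGR x (by linarith)])
  rw [setIntegral_congr_fun (g := fun _ => (0:ℝ)) measurableSet_ball] at heq
  swap
  · intro x hx
    simp only [hcomp g hg]
    rw [det_fderiv_stepMap_eq_zero hδ hγ, zero_mul]
    have := hx₀ (Metric.ball_subset_closedBall hx)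
    simp only [δ]
    simp only [mem_ofPred_eq] at this
    linarith
  simp only [integral_zero] at heq
  have hnn : ∀ x, 0 ≤ (fderiv ℝ (stepMap A B γ ∘ powShift L ρ) x).det := by
    intro x
    rw [hcomp _ hP, det_fderiv_powShift, det_fderiv_stepMap hγ]
    positivity
  have hcont := continuous_det_fderiv (hκ.comp hP)
  set η : ℝ := min (1/2) (δ/2)
  have hη : 0 < η := by positivity
  have hη1 : η ≤ 1/2 := min_le_left _ _
  have hη2 : η ≤ δ/2 := min_le_right _ _
  let p : V := (fun _ => 0, fun _ => (η : ℂ), ρ)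
  have hpr : p ∈ Metric.ball (0:V) r := by
    rw [mem_ball_zero_iff, Prod.norm_def, Prod.norm_def]
    have : |ρ| < r := lt_of_lt_of_le (by linarith) (le_max_right _ _)
    refine max_lt ?_ (max_lt ?_ ?_)
    · exact (pi_norm_lt_iff hr0).2 fun i => by simpa [p] using hr0
    · refine (pi_norm_lt_iff hr0).2 fun i => ?_
      simp only [p, Complex.norm_real, Real.norm_of_nonneg hη.le]
      exact lt_of_lt_of_le (by linarith [abs_nonneg ρ]) (le_max_right _ _)
    · simpa [p] using this
  have hpos : 0 < (fderiv ℝ (stepMap A B γ ∘ powShift L ρ) p).det := by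
    rw [hcomp _ hP, det_fderiv_powShift, det_fderiv_stepMap hγ]
    have h1 : |η ^ L| < δ := by
      rw [abs_of_pos (by positivity)]
      calc η ^ L ≤ η ^ 1 := pow_le_pow_of_le_one hη.le (by linarith) hL
        _ < δ := by rw [pow_one]; linarith
    have h2 : 0 < δ - |η ^ L| := by linarith
    have h3 : ∀ i, (powShift L ρ p).1 i = 0 := fun i => rfl
    have h4 : ∀ i, (powShift L ρ p).2.1 i = ((η ^ L : ℝ) : ℂ) := fun i => by
      simp [powShift, coordMap, p]
    have h5 : (powShift L ρ p).2.2 = 0 := by simp [powShift, coordMap, p]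
    have h6 : ∀ i, p.2.1 i = (η : ℂ) := fun i => rfl
    have hL' : (L : ℂ) ≠ 0 := by exact_mod_cast hL.ne'
    have hη' : (η : ℂ) ≠ 0 := by exact_mod_cast hη.ne'
    simp only [h3, h4, h5, h6, Complex.zero_re, Complex.zero_im, Complex.ofReal_re,
      Complex.ofReal_im, abs_zero, sub_zero]
    have hm1 : 0 < max 0 δ := lt_max_of_lt_right hδ
    have hm2 : 0 < max 0 (δ - |η ^ L|) := lt_max_of_lt_right h2
    have hm3 : 0 < ‖(L : ℂ) * (η : ℂ) ^ (L - 1)‖ :=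
      norm_pos_iff.2 (mul_ne_zero hL' (pow_ne_zero _ hη'))
    refine mul_pos (mul_pos ?_ (mul_pos ?_ hm1)) ?_ <;>
      exact Finset.prod_pos fun i _ => by positivity
  have hgt : 0 < ∫ x in Metric.ball 0 r,
      (fderiv ℝ (stepMap A B γ ∘ powShift L ρ) x).det ∂μ := by
    rw [setIntegral_pos_iff_support_of_nonneg_ae (.of_forall hnn)
      ((hcont.continuousOn.integrableOn_compact (isCompact_closedBall 0 r)).mono_set
        Metric.ball_subset_closedBall)]
    exact ((hcont.isOpen_support).inter Metric.isOpen_ball).measure_pos μ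
      ⟨p, hpos.ne', hpr⟩
  exact hgt.ne heq

end Degree

section Generic

lemma locallyLipschitz_of_contDiff_comp {X E F : Type*} [PseudoEMetricSpace X]
    [NormedAddCommGroup E] [NormedSpace ℝ E] [NormedAddCommGroup F] [NormedSpace ℝ F]
    {g : E → F} {f : X → E} (hg : ContDiff ℝ 1 g) (hf : LocallyLipschitz f) :
    LocallyLipschitz fun x => g (f x) := hg.locallyLipschitz.comp hf

lemma LocallyLipschitz.smul_real {X F : Type*} [PseudoEMetricSpace X]
    [NormedAddCommGroup F] [NormedSpace ℝ F]
    {f : X → ℝ} {g : X → F} (hf : LocallyLipschitz f) (hg : LocallyLipschitz g) :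
    LocallyLipschitz fun x => f x • g x :=
  locallyLipschitz_of_contDiff_comp (g := fun p : ℝ × F => p.1 • p.2) (by fun_prop)
    (hf.prodMk hg)

lemma LocallyLipschitz.add_vec {X F : Type*} [PseudoEMetricSpace X]
    [NormedAddCommGroup F] [NormedSpace ℝ F]
    {f g : X → F} (hf : LocallyLipschitz f) (hg : LocallyLipschitz g) :
    LocallyLipschitz fun x => f x + g x :=
  locallyLipschitz_of_contDiff_comp (g := fun p : F × F => p.1 + p.2) (by fun_prop)
    (hf.prodMk hg)

variable {A B : Type*} [Fintype A] [Fintype B] [DecidableEq B]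

variable (A B) in
/-- Parameters of a loop of configurations whose `j`-th free coordinate is real. -/
abbrev SliceParam (j : B) : Type _ :=
  (ℝ × ℝ) × (A → ℂ) × ({i // i ≠ j} → ℂ) × (B → {i // i ≠ j} → ℂ)

/-- Insert a real number in the `j`-th place. -/
def insertReal (j : B) (r : ℝ) (y : {i // i ≠ j} → ℂ) (i : B) : ℂ :=
  if h : i = j then (r : ℂ) else y ⟨i, h⟩

lemma insertReal_self (j : B) (r : ℝ) (y : {i // i ≠ j} → ℂ) : insertReal j r y j = r := by
  simp [insertReal]

lemma insertReal_ne {i j : B} (h : i ≠ j) (r : ℝ) (y : {i // i ≠ j} → ℂ) :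
    insertReal j r y i = y ⟨i, h⟩ := by
  simp [insertReal, h]

/-- The configuration attached to slice parameters. -/
def slicePoint (j : B) (p : SliceParam A B j) : ℝ × (A → ℂ) × (B → ℂ) :=
  (p.1.1, p.2.1, insertReal j p.1.2 p.2.2.1)

lemma contDiff_slicePoint (j : B) : ContDiff ℝ 1 (slicePoint (A := A) j) := by
  unfold slicePoint
  refine contDiff_fst.fst.prodMk (contDiff_snd.fst.prodMk (contDiff_pi.2 fun i => ?_))
  by_cases h : i = j
  · subst h
    simp only [insertReal_self]
    exact Complex.ofRealCLM.contDiff.comp contDiff_fst.snd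
  · simp only [insertReal_ne h]
    fun_prop

/-- The perturbation parameters solving the zero equation at a slice point. -/
def solveParam (L : ℕ) (j : B)
    (p : SliceParam A B j × ℝ × ((A → ℂ) × (B → ℂ) × ℝ)) :
    ((A → ℂ) × ℝ) × (B → B → ℂ) :=
  ((fun a => (p.2.1)⁻¹ • -p.2.2.1 a, (p.2.1)⁻¹ • -p.2.2.2.2),
    fun i i' => if h : i' = j then
      (p.1.1.2 ^ L)⁻¹ • ((p.2.1)⁻¹ • -p.2.2.2.1 i -
        ∑ l : {l // l ≠ j}, p.1.2.2.2 i l * p.1.2.2.1 l ^ L)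
      else p.1.2.2.2 i ⟨i', h⟩)

lemma contDiffAt_solveParam (L : ℕ) (j : B)
    (p : SliceParam A B j × ℝ × ((A → ℂ) × (B → ℂ) × ℝ)) (h1 : p.2.1 ≠ 0)
    (h2 : p.1.1.2 ≠ 0) : ContDiffAt ℝ 1 (solveParam L j) p := by
  unfold solveParam
  have hi : ContDiffAt ℝ 1 (fun p : SliceParam A B j × ℝ × ((A → ℂ) × (B → ℂ) × ℝ) =>
      (p.2.1)⁻¹) p := by
    have : ContDiffAt ℝ 1 (fun p : SliceParam A B j × ℝ × ((A → ℂ) × (B → ℂ) × ℝ) =>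
      p.2.1) p := by fun_prop
    exact this.inv h1
  have hr : ContDiffAt ℝ 1 (fun p : SliceParam A B j × ℝ × ((A → ℂ) × (B → ℂ) × ℝ) =>
      (p.1.1.2 ^ L)⁻¹) p := by
    have : ContDiffAt ℝ 1 (fun p : SliceParam A B j × ℝ × ((A → ℂ) × (B → ℂ) × ℝ) =>
      p.1.1.2 ^ L) p := by fun_prop
    exact this.inv (pow_ne_zero _ h2)
  refine ContDiffAt.prodMk (ContDiffAt.prodMk ?_ ?_) ?_
  · refine contDiffAt_pi.2 fun a => hi.smul (by fun_prop)
  · exact hi.smul (by fun_prop)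
  · refine contDiffAt_pi.2 fun i => contDiffAt_pi.2 fun i' => ?_
    by_cases h : i' = j
    · simp only [h, dite_true]
      exact hr.smul ((hi.smul (by fun_prop)).sub (by fun_prop))
    · simp only [h, dite_false]
      fun_prop

lemma finrank_sliceParam (j : B) :
    Module.finrank ℝ (SliceParam A B j) < Module.finrank ℝ (((A → ℂ) × ℝ) × (B → B → ℂ)) := by
  have hB : 0 < Fintype.card B := Fintype.card_pos_iff.2 ⟨j⟩
  obtain ⟨m, hm⟩ := Nat.exists_eq_succ_of_ne_zero hB.ne'
  simp [Module.finrank_prod, Module.finrank_pi_fintype, Complex.finrank_real_complex,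
    Fintype.card_subtype_compl, hm]
  ring_nf
  omega

/-- An equivariant family can be perturbed off zero. -/
lemma exists_equivariant_perturbation (L : ℕ) {b : ℝ × (A → ℂ) × (B → ℂ) → (A → ℂ) × (B → ℂ) × ℝ}
    {w : ℝ × (A → ℂ) × (B → ℂ) → ℝ} (hb : LocallyLipschitz b) (hw : LocallyLipschitz w)
    (hbe : ∀ (s : ℝ) x u (ζ : ℂ), ‖ζ‖ = 1 → b (s, x, fun i => ζ * u i) =
      ((b (s, x, u)).1, fun i => ζ ^ L * (b (s, x, u)).2.1 i, (b (s, x, u)).2.2))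
    (hwe : ∀ (s : ℝ) x u (ζ : ℂ), ‖ζ‖ = 1 → w (s, x, fun i => ζ * u i) = w (s, x, u))
    (hw0 : ∀ s x, w (s, x, 0) = 0)
    (hbw : ∀ s ∈ Icc (0:ℝ) 1, ∀ x u, w (s, x, u) = 0 → b (s, x, u) ≠ 0) :
    ∃ (c : A → ℂ) (d : ℝ) (M : B → B → ℂ), ∀ s ∈ Icc (0:ℝ) 1, ∀ x u,
      b (s, x, u) + w (s, x, u) • (c, fun i => ∑ l, M i l * u l ^ L, d) ≠ 0 := by
  let U : ∀ j : B, Set (SliceParam A B j) := fun j => {p | w (slicePoint j p) ≠ 0 ∧ p.1.2 ≠ 0}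
  let Θ : ∀ j : B, SliceParam A B j → ((A → ℂ) × ℝ) × (B → B → ℂ) := fun j p =>
    solveParam L j (p, w (slicePoint j p), b (slicePoint j p))
  have hdim : dimH (⋃ j, Θ j '' U j) < Module.finrank ℝ (((A → ℂ) × ℝ) × (B → B → ℂ)) := by
    rcases isEmpty_or_nonempty B with hB | ⟨⟨j₀⟩⟩
    · simp [Module.finrank_prod]
    rw [dimH_iUnion]
    have hle : ∀ j, dimH (Θ j '' U j) ≤ (Module.finrank ℝ (SliceParam A B j) : ENNReal) := by
      intro j
      refine (dimH_image_le_of_locally_lipschitzOn fun p hp => ?_).trans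
        ((dimH_mono (subset_univ _)).trans (Real.dimH_univ_eq_finrank _).le)
      obtain ⟨C₁, t₁, ht₁, hC₁⟩ := ((contDiffAt_solveParam L j
        (p, w (slicePoint j p), b (slicePoint j p)) hp.1 hp.2).exists_lipschitzOnWith)
      have hll : LocallyLipschitz fun p : SliceParam A B j =>
          (p, w (slicePoint j p), b (slicePoint j p)) :=
        LocallyLipschitz.id.prodMk ((hw.comp (contDiff_slicePoint j).locallyLipschitz).prodMk
          (hb.comp (contDiff_slicePoint j).locallyLipschitz))
      obtain ⟨C₂, t₂, ht₂, hC₂⟩ := hll p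
      refine ⟨C₁ * C₂, t₂ ∩ (fun p : SliceParam A B j =>
          (p, w (slicePoint j p), b (slicePoint j p))) ⁻¹' t₁, ?_, ?_⟩
      · exact mem_nhdsWithin_of_mem_nhds
          (Filter.inter_mem ht₂ (hll.continuous.continuousAt.preimage_mem_nhds ht₁))
      · exact hC₁.comp (hC₂.mono inter_subset_left) fun x hx => hx.2
    obtain ⟨m, hm⟩ : ∃ m : ℕ, ∀ j, Module.finrank ℝ (SliceParam A B j) = m :=
      ⟨Module.finrank ℝ (SliceParam A B j₀), fun j => by
        simp [Module.finrank_prod, Module.finrank_pi_fintype, Fintype.card_subtype_compl]⟩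
    calc (⨆ j, dimH (Θ j '' U j)) ≤ (m : ENNReal) := iSup_le fun j => by
          simpa [hm j] using hle j
      _ < _ := by
          have := finrank_sliceParam (A := A) j₀
          rw [hm] at this
          exact_mod_cast this
  obtain ⟨⟨⟨c, d⟩, M⟩, hP⟩ := (dense_compl_of_dimH_lt_finrank hdim).nonempty
  refine ⟨c, d, M, fun s hs x u h0 => hP ?_⟩
  have hwne : w (s, x, u) ≠ 0 := by
    intro hw'
    rw [hw', zero_smul, add_zero] at h0
    exact hbw s hs x u hw' h0
  obtain ⟨j, hj⟩ : ∃ j, u j ≠ 0 := by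
    by_contra! h
    exact hwne (by rw [show u = 0 from funext h]; exact hw0 s x)
  set ζ : ℂ := (‖u j‖ : ℂ) / u j
  have hζ : ‖ζ‖ = 1 := by simp [ζ, hj]
  have hζj : ζ * u j = (‖u j‖ : ℂ) := div_mul_cancel₀ _ hj
  let p : SliceParam A B j := ((s, ‖u j‖), x, fun l => ζ * u l, fun i l => M i l)
  have hsp : slicePoint j p = (s, x, fun i => ζ * u i) := by
    simp only [slicePoint, p, Prod.mk.injEq, true_and]
    funext i
    by_cases h : i = j
    · subst h; rw [insertReal_self, hζj]
    · rw [insertReal_ne h]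
  have hr : (‖u j‖ : ℝ) ≠ 0 := norm_ne_zero_iff.2 hj
  refine mem_iUnion.2 ⟨j, p, ⟨by rw [hsp, hwe _ _ _ _ hζ]; exact hwne, hr⟩, ?_⟩
  simp only [Θ, hsp, hwe _ _ _ _ hζ, hbe _ _ _ _ hζ]
  rw [Prod.ext_iff, Prod.ext_iff] at h0
  obtain ⟨h1, h2, h3⟩ := h0
  simp only [Prod.fst_add, Prod.smul_fst, Prod.fst_zero, Prod.snd_add, Prod.smul_snd,
    Prod.snd_zero, smul_eq_mul] at h1 h2 h3
  simp only [solveParam, p]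
  refine Prod.ext (Prod.ext ?_ ?_) ?_
  · funext a
    have := congrFun h1 a
    simp only [Pi.add_apply, Pi.smul_apply, Pi.zero_apply] at this
    simp only [neg_eq_of_add_eq_zero_right this]
    exact inv_smul_smul₀ hwne _
  · simp only [smul_eq_mul]
    rw [neg_eq_of_add_eq_zero_right h3, inv_mul_cancel_left₀ hwne]
  · funext i i'
    by_cases h : i' = j
    · subst h
      simp only [dite_true]
      have := congrFun h2 i
      simp only [Pi.add_apply, Pi.smul_apply, Pi.zero_apply] at this
      rw [← mul_neg, neg_eq_of_add_eq_zero_right this, mul_smul_comm, inv_smul_smul₀ hwne,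
        inv_smul_eq_iff₀ (pow_ne_zero _ hr), sub_eq_iff_eq_add,
        ← Fintype.sum_subtype_add_sum_subtype (fun l => l ≠ i') (fun l => M i l * u l ^ L)]
      rw [mul_add, Finset.mul_sum, add_comm]
      congr 1
      · have : ∀ l : {l // ¬ l ≠ i'}, M i l * u l ^ L = M i i' * u i' ^ L := fun l => by
          rw [not_not.1 l.2]
        rw [Finset.sum_congr rfl fun l _ => this l, Finset.sum_const]
        have hc : Fintype.card {l // ¬ l ≠ i'} = 1 := by
          simp
        rw [Finset.card_univ, hc, one_smul, mul_left_comm, ← mul_pow, hζj]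
        rw [Complex.real_smul, mul_comm]
        simp
      · refine Finset.sum_congr rfl fun l _ => ?_
        ring
    · simp [h]

end Generic

section EquivariantZero

/-- Truncation of a real number to the unit interval. -/
def clampUnit (t : ℝ) : ℝ := max 0 (min 1 t)

lemma clampUnit_mem (t : ℝ) : clampUnit t ∈ Icc (0:ℝ) 1 :=
  ⟨le_max_left _ _, max_le zero_le_one (min_le_left _ _)⟩

lemma clampUnit_of_nonpos {t : ℝ} (h : t ≤ 0) : clampUnit t = 0 :=
  max_eq_left ((min_le_right _ _).trans h)

lemma clampUnit_of_one_le {t : ℝ} (h : 1 ≤ t) : clampUnit t = 1 := by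
  simp [clampUnit, h]

lemma lipschitzWith_clampUnit : LipschitzWith 1 clampUnit :=
  (LipschitzWith.id.const_min 1).const_max 0

lemma continuous_clampUnit : Continuous clampUnit := lipschitzWith_clampUnit.continuous

lemma exists_nowhere_zero_eq {V W : Type*} [NormedAddCommGroup V] [NormedSpace ℝ V]
    [NormedAddCommGroup W] [NormedSpace ℝ W] {f g : V → W} (hf : Continuous f)
    (hg : Continuous g) (hne : ∀ x, f x ≠ 0) {R : ℝ}
    (h : ∀ x, R ≤ ‖x‖ → ∀ s ∈ Icc (0:ℝ) 1, (1 - s) • f x + s • g x ≠ 0) :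
    ∃ f' : V → W, Continuous f' ∧ (∀ x, f' x ≠ 0) ∧ ∀ x, R + 1 ≤ ‖x‖ → f' x = g x := by
  have hc := continuous_clampUnit
  refine ⟨fun x => (1 - clampUnit (‖x‖ - R)) • f x + clampUnit (‖x‖ - R) • g x, by fun_prop,
    fun x => ?_, fun x hx => ?_⟩
  · rcases le_total R ‖x‖ with hR | hR
    · exact h x hR _ (clampUnit_mem _)
    · simpa [clampUnit_of_nonpos (sub_nonpos.2 hR)] using hne x
  · simp [clampUnit_of_one_le (show 1 ≤ ‖x‖ - R by linarith)]

variable {A B : Type*} [Fintype A] [Fintype B]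

/-- A Borsuk–Ulam type theorem for circle actions. -/
theorem exists_zero_of_circle_equivariant {L : ℕ} (hL : 0 < L) {ρ : ℝ} (hρ : 0 < ρ)
    {F : (A → ℂ) × (B → ℂ) × ℂ → (A → ℂ) × (B → ℂ) × ℝ} (hF : LocallyLipschitz F)
    (hFe : ∀ x u z (ζ : ℂ), ‖ζ‖ = 1 → F (x, fun i => ζ * u i, ζ * z) =
      ((F (x, u, z)).1, fun i => ζ ^ L * (F (x, u, z)).2.1 i, (F (x, u, z)).2.2))
    (hF0 : ∀ x, (F (x, 0, 0)).2.2 < 0) {R : ℝ}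
    (hR : ∀ x u z, R ≤ ‖(x, u, z)‖ → ∀ s ∈ Icc (0:ℝ) 1,
      (1 - s) • F (x, u, z) + s • (x, fun i => u i ^ L, ‖z‖ - ρ) ≠ 0) :
    ∃ x, F x = 0 := by
  classical
  by_contra! hne
  let f₁ : (A → ℂ) × (B → ℂ) → (A → ℂ) × (B → ℂ) × ℝ := fun q => (q.1, fun i => q.2 i ^ L, -ρ)
  let b : ℝ × (A → ℂ) × (B → ℂ) → (A → ℂ) × (B → ℂ) × ℝ := fun p =>
    (1 - p.1) • F (p.2.1, p.2.2, 0) + p.1 • f₁ p.2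
  let w : ℝ × (A → ℂ) × (B → ℂ) → ℝ := fun p =>
    (p.1 * (1 - p.1)) * (max 0 (R - ‖p.2‖) * ‖p.2.2‖)
  have hf₁ : ContDiff ℝ 1 f₁ := by fun_prop
  have hb : LocallyLipschitz b := by
    refine LocallyLipschitz.add_vec (LocallyLipschitz.smul_real ?_ (hF.comp ?_))
      (LocallyLipschitz.smul_real ?_ ?_)
    · exact ContDiff.locallyLipschitz (𝕂 := ℝ) (by fun_prop)
    · exact ContDiff.locallyLipschitz (𝕂 := ℝ) (f := fun p : ℝ × (A → ℂ) × (B → ℂ) =>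
        (p.2.1, p.2.2, (0:ℂ))) (by fun_prop)
    · exact ContDiff.locallyLipschitz (𝕂 := ℝ) (by fun_prop)
    · exact ContDiff.locallyLipschitz (𝕂 := ℝ) (by fun_prop)
  have hw : LocallyLipschitz w := by
    refine LocallyLipschitz.smul_real (ContDiff.locallyLipschitz (𝕂 := ℝ) (by fun_prop))
      (LocallyLipschitz.smul_real ?_ ?_)
    · refine LocallyLipschitz.const_max (f := fun p : ℝ × (A → ℂ) × (B → ℂ) => R - ‖p.2‖) ?_ 0
      exact (ContDiff.locallyLipschitz (𝕂 := ℝ) (f := fun t : ℝ => R - t) (by fun_prop)).comp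
        ((lipschitzWith_one_norm.comp LipschitzWith.prod_snd).locallyLipschitz)
    · exact (lipschitzWith_one_norm.comp (LipschitzWith.prod_snd.comp
        LipschitzWith.prod_snd)).locallyLipschitz
  have hnorm : ∀ (u : B → ℂ) (ζ : ℂ), ‖ζ‖ = 1 → ‖fun i => ζ * u i‖ = ‖u‖ := by
    intro u ζ hζ
    rw [show (fun i => ζ * u i) = ζ • u from rfl, norm_smul, hζ, one_mul]
  have hwR : ∀ s x u, R ≤ ‖(x, u)‖ → w (s, x, u) = 0 := by
    intro s x u h
    simp only [w, max_eq_left (sub_nonpos.2 h), zero_mul, mul_zero]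
  have hnz : ∀ (x : A → ℂ) (u : B → ℂ), ‖(x, u, (0:ℂ))‖ = ‖(x, u)‖ := by
    intro x u
    simp [Prod.norm_def]
  have hbR : ∀ x u, R ≤ ‖(x, u)‖ → ∀ s ∈ Icc (0:ℝ) 1, b (s, x, u) ≠ 0 := by
    intro x u h s hs
    have := hR x u 0 (by rwa [hnz]) s hs
    simpa [b, f₁] using this
  obtain ⟨c, d, M, hpert⟩ := exists_equivariant_perturbation L hb hw
    (by
      intro s x u ζ hζ
      have := hFe x u 0 ζ hζ
      rw [mul_zero] at this
      simp only [b, f₁, this]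
      refine Prod.ext ?_ (Prod.ext ?_ ?_)
      · simp
      · funext i
        simp only [Prod.snd_add, Prod.smul_snd, Prod.fst_add, Prod.smul_fst, Pi.add_apply,
          Pi.smul_apply, Complex.real_smul]
        ring
      · simp)
    (by
      intro s x u ζ hζ
      simp only [w, Prod.norm_def, hnorm u ζ hζ])
    (by intro s x; simp [w])
    (by
      intro s hs x u h0
      simp only [w, mul_eq_zero] at h0
      rcases h0 with (h | h) | (h | h)
      · subst h; simpa [b] using hne (x, u, 0)
      · intro hb0
        have h1 : s = 1 := by linarith
        have := congrArg (fun y => y.2.2) hb0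
        simp [b, f₁, h1] at this
        exact hρ.ne' this
      · exact hbR x u (by have := le_max_right 0 (R - ‖(x, u)‖); linarith) s hs
      · rw [norm_eq_zero] at h
        subst h
        intro hb0
        have := congrArg (fun y => y.2.2) hb0
        simp only [Prod.snd_add, Prod.smul_snd, smul_eq_mul, Prod.snd_zero, b, f₁] at this
        have h1 := hF0 x
        rcases hs.1.eq_or_lt with h | h
        · rw [← h] at this; linarith
        · nlinarith [hs.2])
  let G : (A → ℂ) × (B → ℂ) × ℝ → (A → ℂ) × (B → ℂ) × ℝ := fun p =>
    ((1 - clampUnit (-p.2.2)) • F (p.1, p.2.1, ((max p.2.2 0 : ℝ) : ℂ)) +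
      clampUnit (-p.2.2) • (p.1, (fun i => p.2.1 i ^ L), max p.2.2 0 - ρ)) +
    (w (clampUnit (-p.2.2), p.1, p.2.1) • (c, (fun i => ∑ l, M i l * p.2.1 l ^ L), d) +
      (0, 0, min 0 (p.2.2 + 1)))
  let G₀ : (A → ℂ) × (B → ℂ) × ℝ → (A → ℂ) × (B → ℂ) × ℝ := fun p =>
    (p.1, fun i => p.2.1 i ^ L, max p.2.2 0 + min 0 (p.2.2 + 1) - ρ)
  have hGc : Continuous G := by
    have := continuous_clampUnit
    have := hF.continuous
    have := hw.continuous
    fun_prop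
  have hG₀c : Continuous G₀ := by fun_prop
  have hGpos : ∀ x u t, 0 ≤ t → G (x, u, t) = F (x, u, (t : ℂ)) := by
    intro x u t ht
    have h1 : clampUnit (-t) = 0 := clampUnit_of_nonpos (by linarith)
    have h2 : min 0 (t + 1) = 0 := min_eq_left (by linarith)
    simp only [G, h1, h2, max_eq_left ht, w, sub_zero, one_smul, zero_smul, add_zero, zero_mul]
    rw [zero_add]
    exact add_zero _
  have hGmid : ∀ x u t, -1 ≤ t → t ≤ 0 → G (x, u, t) = b (clampUnit (-t), x, u) +
      w (clampUnit (-t), x, u) • (c, (fun i => ∑ l, M i l * u l ^ L), d) := by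
    intro x u t ht ht'
    have h2 : min 0 (t + 1) = 0 := min_eq_left (by linarith)
    simp only [G, h2, max_eq_right ht', b, f₁, zero_sub, Complex.ofReal_zero]
    rw [← add_assoc]
    exact add_zero _
  have hGneg : ∀ x u t, t ≤ -1 → G (x, u, t) = G₀ (x, u, t) := by
    intro x u t ht
    have h1 : clampUnit (-t) = 1 := clampUnit_of_one_le (by linarith)
    have h2 : min 0 (t + 1) = t + 1 := min_eq_right (by linarith)
    have h3 : max t 0 = 0 := max_eq_right (by linarith)
    simp only [G, G₀, h1, h2, h3, w, sub_self, zero_smul, mul_zero, zero_mul, one_smul, zero_add]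
    refine Prod.ext ?_ (Prod.ext ?_ ?_)
    · simp
    · simp
    · simp only [Prod.snd_add]; ring
  have hG₀neg : ∀ x u t, t ≤ -1 → (G₀ (x, u, t)).2.2 < 0 := by
    intro x u t ht
    have h2 : min 0 (t + 1) = t + 1 := min_eq_right (by linarith)
    have h3 : max t 0 = 0 := max_eq_right (by linarith)
    simp only [G₀, h2, h3]; linarith
  have hGne : ∀ p, G p ≠ 0 := by
    rintro ⟨x, u, t⟩
    rcases le_total 0 t with ht | ht
    · rw [hGpos x u t ht]; exact hne _
    rcases le_total (-1) t with ht' | ht'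
    · rw [hGmid x u t ht' ht]
      exact hpert _ (clampUnit_mem _) x u
    · rw [hGneg x u t ht']
      intro h
      have := hG₀neg x u t ht'
      rw [h] at this
      exact lt_irrefl _ this
  obtain ⟨G', hG'c, hG'ne, hG'⟩ := exists_nowhere_zero_eq hGc hG₀c hGne (R := max R 2) (by
    rintro ⟨x, u, t⟩ hp σ hσ
    have hpR := (le_max_left R 2).trans hp
    have hp2 := (le_max_right R 2).trans hp
    rcases le_total 0 t with ht | ht
    · rw [hGpos x u t ht]
      have h2 : min 0 (t + 1) = 0 := min_eq_left (by linarith)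
      have := hR x u t (by simpa [Prod.norm_def] using hpR) σ hσ
      simpa [G₀, h2, max_eq_left ht, abs_of_nonneg ht] using this
    rcases le_total (-1) t with ht' | ht'
    · have hnt : ‖t‖ < 2 := by
        rw [Real.norm_eq_abs, abs_lt]; constructor <;> linarith
      have hq : ‖(x, u, t)‖ = ‖(x, u)‖ := by
        have h1 : ‖(x, u, t)‖ = max ‖(x, u)‖ ‖t‖ := by simp [Prod.norm_def, max_assoc]
        rw [h1] at hp2 ⊢
        rcases le_max_iff.1 hp2 with h | h
        · exact max_eq_left (by linarith)
        · linarith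
      rw [hq] at hpR
      set s := clampUnit (-t)
      have hs : s ∈ Icc (0:ℝ) 1 := clampUnit_mem _
      rw [hGmid x u t ht' ht, hwR _ _ _ hpR, zero_smul, add_zero]
      have h2 : min 0 (t + 1) = 0 := min_eq_left (by linarith)
      have hG₀e : G₀ (x, u, t) = f₁ (x, u) := by simp [G₀, f₁, h2, ht]
      rw [hG₀e]
      have hcomb : (1 - σ) • b (s, x, u) + σ • f₁ (x, u) = b (1 - (1 - σ) * (1 - s), x, u) := by
        simp only [b]
        module
      rw [hcomb]
      refine hbR x u hpR _ ⟨?_, ?_⟩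
      · nlinarith [hs.1, hs.2, hσ.1, hσ.2]
      · nlinarith [hs.1, hs.2, hσ.1, hσ.2]
    · rw [hGneg x u t ht', ← add_smul, sub_add_cancel, one_smul]
      intro h
      have := hG₀neg x u t ht'
      rw [h] at this
      exact lt_irrefl _ this)
  obtain ⟨G'', hG''c, hG''ne, hG''⟩ := exists_nowhere_zero_eq hG'c
    (contDiff_powShift (A := A) (B := B) L ρ 1).continuous hG'ne (R := max (max R 2 + 1) (ρ + 1))
    (by
      rintro ⟨x, u, t⟩ hp σ hσ h0
      rw [hG' _ ((le_max_left _ _).trans hp)] at h0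
      have hpρ := (le_max_right _ _).trans hp
      have h1 := congrArg (fun y => y.1) h0
      have h2 := congrArg (fun y => y.2.1) h0
      have h3 := congrArg (fun y => y.2.2) h0
      simp only [G₀, powShift, coordMap, Prod.fst_add, Prod.smul_fst, Prod.fst_zero,
        Prod.snd_add, Prod.smul_snd, Prod.snd_zero, id, smul_eq_mul] at h1 h2 h3
      rw [← add_smul, sub_add_cancel, one_smul] at h1 h2
      have hu : u = 0 := funext fun i => by
        have := congrFun h2 i
        simpa [hL.ne'] using this
      have hx : x = 0 := h1
      subst hu hx
      have ht : ‖((0 : A → ℂ), (0 : B → ℂ), t)‖ = |t| := by simp [Prod.norm_def]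
      rw [ht] at hpρ
      rcases le_total 0 t with h | h
      · rw [abs_of_nonneg h] at hpρ
        rw [max_eq_left h, min_eq_left (by linarith)] at h3
        nlinarith
      · rw [max_eq_right h] at h3
        have := min_le_left 0 (t + 1)
        nlinarith [hσ.1, hσ.2])
  obtain ⟨x, hx⟩ := exists_zero_of_eq_powShift hL ρ hG''c _ hG''
  exact hG''ne x hx

end EquivariantZero

section Descent

variable {E : Type*} [NormedAddCommGroup E] [InnerProductSpace ℝ E] [FiniteDimensional ℝ E]

/-- One truncated gradient descent step. -/
def descentStep (a : E → ℝ) (g : E → E) (τ β : ℝ) (x : E) : E :=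
  x - (τ * clampUnit (a x / β)) • g x

/-- `g` is a gradient of `a`, with a quadratic remainder estimate. -/
def IsQuadGradient (a : E → ℝ) (g : E → E) (C : ℝ) : Prop :=
  ∀ x y, |a y - a x - inner ℝ (g x) (y - x)| ≤ C * ‖y - x‖ ^ 2

variable {a : E → ℝ} {g : E → E} {C τ β : ℝ}

lemma IsQuadGradient.hasFDerivAt (h : IsQuadGradient a g C) (x : E) :
    HasFDerivAt a (innerSL ℝ (g x)) x := by
  rw [hasFDerivAt_iff_isLittleO_nhds_zero]
  have h1 : (fun v : E => a (x + v) - a x - (innerSL ℝ (g x)) v) =O[nhds 0]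
      fun v => ‖v‖ ^ 2 := by
    refine Asymptotics.IsBigO.of_bound C (.of_forall fun v => ?_)
    have := h x (x + v)
    simpa using this
  refine h1.trans_isLittleO ?_
  exact (Asymptotics.isLittleO_norm_pow_id one_lt_two)

lemma IsQuadGradient.contDiff (h : IsQuadGradient a g C) (hg : Continuous g) :
    ContDiff ℝ 1 a :=
  contDiff_one_of_hasFDerivAt h.hasFDerivAt ((innerSL ℝ (E := E)).continuous.comp hg)

lemma locallyLipschitz_descentStep (h : IsQuadGradient a g C) (hg : LocallyLipschitz g) :
    LocallyLipschitz (descentStep a g τ β) := by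
  have h1 : LocallyLipschitz fun x => (τ * clampUnit (a x / β)) := by
    refine LocallyLipschitz.smul_real (LocallyLipschitz.const τ)
      (lipschitzWith_clampUnit.locallyLipschitz.comp ?_)
    exact ((h.contDiff hg.continuous).div_const β).locallyLipschitz
  have h2 := (LocallyLipschitz.id (α := E)).add_vec
    (LocallyLipschitz.smul_real ((LocallyLipschitz.const (-1:ℝ)).smul_real h1) hg)
  refine (congrArg LocallyLipschitz (funext fun x => ?_)).mp h2
  simp [descentStep, sub_eq_add_neg]

lemma le_descentStep (h : IsQuadGradient a g C) (hτ : 0 ≤ τ) (hC : C * τ ≤ 1 / 2) (x : E) :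
    a (descentStep a g τ β x) ≤ a x - τ / 2 * clampUnit (a x / β) * ‖g x‖ ^ 2 := by
  have h1 := (abs_le.1 (h x (descentStep a g τ β x))).2
  obtain ⟨h2, h3⟩ := clampUnit_mem (a x / β)
  set χ := clampUnit (a x / β)
  have h4 : descentStep a g τ β x - x = -((τ * χ) • g x) := by
    simp only [descentStep, χ]; abel
  rw [h4, norm_neg, norm_smul, inner_neg_right, inner_smul_right, real_inner_self_eq_norm_sq,
    mul_pow, Real.norm_eq_abs, sq_abs] at h1
  have h5 : C * ((τ * χ) ^ 2 * ‖g x‖ ^ 2) ≤ τ / 2 * χ * ‖g x‖ ^ 2 := by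
    have : C * τ * (τ * χ * χ) ≤ 1 / 2 * (τ * χ * 1) := by
      gcongr
    nlinarith [sq_nonneg ‖g x‖]
  linarith

lemma descentStep_of_nonpos (hβ : 0 < β) {x : E} (hx : a x ≤ 0) : descentStep a g τ β x = x := by
  simp [descentStep, clampUnit_of_nonpos (div_nonpos_of_nonpos_of_nonneg hx hβ.le)]

lemma iterate_descentStep_of_nonpos (hβ : 0 < β) {x : E} (hx : a x ≤ 0) (N : ℕ) :
    (descentStep a g τ β)^[N] x = x :=
  Function.iterate_fixed (descentStep_of_nonpos hβ hx) N

lemma iterate_descentStep_le (h : IsQuadGradient a g C) (hτ : 0 ≤ τ) (hC : C * τ ≤ 1 / 2)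
    (x : E) (N : ℕ) : a ((descentStep a g τ β)^[N] x) ≤ a x := by
  induction N with
  | zero => simp
  | succ N ih =>
    rw [Function.iterate_succ_apply']
    have := le_descentStep (β := β) h hτ hC ((descentStep a g τ β)^[N] x)
    have h2 := (clampUnit_mem (a ((descentStep a g τ β)^[N] x) / β)).1
    have : 0 ≤ τ / 2 * clampUnit (a ((descentStep a g τ β)^[N] x) / β) *
      ‖g ((descentStep a g τ β)^[N] x)‖ ^ 2 := by positivity
    linarith

lemma exists_le_norm_of_isClosed (hg : Continuous g) {c D : ℝ} (hc : 0 < c)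
    (hgrow : ∀ x, c * ‖x‖ - D ≤ ‖g x‖) {W : Set E} (hW : IsClosed W)
    (hne : ∀ x ∈ W, g x ≠ 0) : ∃ δ > 0, ∀ x ∈ W, δ ≤ ‖g x‖ := by
  set K := W ∩ Metric.closedBall 0 ((D + 1) / c)
  have hK : IsCompact K := (isCompact_closedBall 0 _).inter_left hW
  have hout : ∀ x, x ∉ Metric.closedBall (0:E) ((D + 1) / c) → 1 ≤ ‖g x‖ := by
    intro x hx
    rw [mem_closedBall_zero_iff, not_le, div_lt_iff₀ hc] at hx
    linarith [hgrow x]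
  rcases K.eq_empty_or_nonempty with hE | hN
  · refine ⟨1, one_pos, fun x hx => hout x fun h => ?_⟩
    have : x ∈ K := ⟨hx, h⟩
    rw [hE] at this
    exact this
  · obtain ⟨x₀, hx₀, hmin⟩ := hK.exists_isMinOn hN hg.norm.continuousOn
    refine ⟨min 1 ‖g x₀‖, lt_min one_pos (norm_pos_iff.2 (hne _ hx₀.1)), fun x hx => ?_⟩
    by_cases h : x ∈ Metric.closedBall (0:E) ((D + 1) / c)
    · exact (min_le_right _ _).trans (hmin ⟨hx, h⟩)
    · exact (min_le_left _ _).trans (hout x h)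

/-- Away from critical points the descent lowers the level in finitely many steps. -/
lemma exists_iterate_le_of_regular (h : IsQuadGradient a g C) (hg : Continuous g) {c D : ℝ}
    (hc : 0 < c) (hgrow : ∀ x, c * ‖x‖ - D ≤ ‖g x‖) (hτ : 0 < τ) (hC : C * τ ≤ 1 / 2)
    (hβ : 0 < β) {b b' : ℝ} (hb : β ≤ b) (hreg : ∀ x, b ≤ a x → a x ≤ b' → g x ≠ 0) :
    ∃ N, ∀ x, a x ≤ b' → a ((descentStep a g τ β)^[N] x) < b := by
  have ha := (h.contDiff hg).continuous
  obtain ⟨δ, hδ, hW⟩ := exists_le_norm_of_isClosed hg hc hgrow (W := {x | b ≤ a x ∧ a x ≤ b'})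
    ((isClosed_le continuous_const ha).inter (isClosed_le ha continuous_const))
    (fun x hx => hreg x hx.1 hx.2)
  set η := τ / 2 * δ ^ 2
  have hη : 0 < η := by positivity
  have hstep : ∀ N : ℕ, ∀ x, a x ≤ b' → a ((descentStep a g τ β)^[N] x) < b ∨
      a ((descentStep a g τ β)^[N] x) ≤ b' - N * η := by
    intro N
    induction N with
    | zero => intro x hx; right; simpa using hx
    | succ N ih =>
      intro x hx
      rw [Function.iterate_succ_apply']
      have hle := le_descentStep (β := β) h hτ.le hC ((descentStep a g τ β)^[N] x)
      have hmono := iterate_descentStep_le (β := β) h hτ.le hC ((descentStep a g τ β)^[N] x) 1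
      rw [Function.iterate_one] at hmono
      by_cases hlt : a ((descentStep a g τ β)^[N] x) < b
      · left; exact hmono.trans_lt hlt
      · right
        have hih := (ih x hx).resolve_left hlt
        rw [not_lt] at hlt
        rw [clampUnit_of_one_le ((one_le_div hβ).2 (hb.trans hlt)), mul_one] at hle
        have hδ' := hW _ ⟨hlt, hih.trans (by nlinarith [hη, (Nat.cast_nonneg N : (0:ℝ) ≤ N)])⟩
        have : η ≤ τ / 2 * ‖g ((descentStep a g τ β)^[N] x)‖ ^ 2 := by
          simp only [η]; gcongr
        push_cast
        linarith
  obtain ⟨N, hN⟩ := exists_nat_gt ((b' - b) / η)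
  refine ⟨N, fun x hx => (hstep N x hx).elim id fun hle => ?_⟩
  rw [div_lt_iff₀ hη] at hN
  linarith

/-- The Lusternik–Schnirelmann descent: points that avoid the critical orbits, in the sense that
the separating functions vanish along the descent, fall below the level `β`. -/
lemma exists_iterate_lt_of_separating {ι : Type*} [Fintype ι] (h : IsQuadGradient a g C)
    (hg : Continuous g) {c D : ℝ}
    (hc : 0 < c) (hgrow : ∀ x, c * ‖x‖ - D ≤ ‖g x‖) (hτ : 0 < τ) (hC : C * τ ≤ 1 / 2)
    (hβ : 0 < β) (Λ : ι → E → ℂ) (hΛ : ∀ i, Continuous (Λ i)) (v : ι → ℝ)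
    (hcrit : ∀ x, g x = 0 → 0 < a x → ∃ i, v i = a x ∧ Λ i x ≠ 0) (b : ℝ) :
    ∃ (M : ι → ℕ) (N : ℕ), ∀ x, a x ≤ b → (∀ i, Λ i ((descentStep a g τ β)^[M i] x) = 0) →
      a ((descentStep a g τ β)^[N] x) < β := by
  classical
  have ha := (h.contDiff hg).continuous
  suffices H : ∀ (m : ℕ) (b : ℝ), (Finset.univ.filter fun i => β ≤ v i ∧ v i ≤ b).card ≤ m →
      ∃ (M : ι → ℕ) (N : ℕ), ∀ x, a x ≤ b →
      (∀ i, v i ≤ b → Λ i ((descentStep a g τ β)^[M i] x) = 0) →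
      a ((descentStep a g τ β)^[N] x) < β by
    obtain ⟨M, N, hMN⟩ := H _ b le_rfl
    exact ⟨M, N, fun x hx hx' => hMN x hx fun i _ => hx' i⟩
  intro m
  induction m with
  | zero =>
    intro b hcard
    obtain ⟨N, hN⟩ := exists_iterate_le_of_regular (b := β) (b' := b) h hg hc hgrow hτ hC hβ le_rfl
      (by
        intro x h1 h2 h0
        obtain ⟨i, hi, -⟩ := hcrit x h0 (hβ.trans_le h1)
        have : i ∈ (Finset.univ.filter fun i => β ≤ v i ∧ v i ≤ b) := by
          simp [hi, h1, h2]
        rw [Finset.card_eq_zero.1 (Nat.le_zero.1 hcard)] at this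
        simp at this)
    exact ⟨0, N, fun x hx _ => hN x hx⟩
  | succ m ih =>
    intro b hcard
    set S := (Finset.univ.filter fun i => β ≤ v i ∧ v i ≤ b)
    rcases S.eq_empty_or_nonempty with hS | hS
    · exact ih b (by change S.card ≤ m; rw [hS]; simp)
    obtain ⟨i₀, hi₀, hmax⟩ := S.exists_max_image v hS
    set e := v i₀
    have he : β ≤ e ∧ e ≤ b := by simpa [S] using hi₀
    obtain ⟨η, hη, hη'⟩ : ∃ η > 0, ∀ i, v i ≠ e → η < |v i - e| := by
      have hfin : {t | ∃ i, v i = t ∧ t ≠ e}.Finite :=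
        (Set.finite_range v).subset fun t ⟨i, hi, _⟩ => ⟨i, hi⟩
      obtain ⟨η, hη, hb⟩ := Metric.isOpen_iff.1 hfin.isClosed.isOpen_compl e (by
        rintro ⟨i, _, hne⟩; exact hne rfl)
      refine ⟨η / 2, by positivity, fun i hi => ?_⟩
      by_contra! hlt
      exact hb (show v i ∈ Metric.ball e η by
        rw [Metric.mem_ball, Real.dist_eq]; linarith) ⟨i, rfl, hi⟩
    set η₁ := min η (β / 2)
    have hη₁ : 0 < η₁ := by positivity
    obtain ⟨δ, hδ, hW⟩ := exists_le_norm_of_isClosed hg hc hgrow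
      (W := {x | |a x - e| ≤ η₁} ∩ ⋂ i, {x | v i = e → Λ i x = 0})
      (IsClosed.inter (isClosed_le (by fun_prop) continuous_const)
        (isClosed_iInter fun i => by
          by_cases hi : v i = e
          · simpa [hi] using isClosed_eq (hΛ i) continuous_const
          · simp [hi]))
      (by
        rintro x ⟨hx1, hx2⟩ hx0
        have hx1' : |a x - e| ≤ η₁ := hx1
        have hpos : 0 < a x := by
          have := (abs_le.1 hx1').1
          have := min_le_right η (β / 2)
          linarith [he.1]
        obtain ⟨i, hi, hi'⟩ := hcrit x hx0 hpos
        have hie : v i = e := by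
          by_contra hne
          have := hη' i hne
          rw [hi] at this
          linarith [min_le_left η (β / 2)]
        exact hi' (mem_iInter.1 hx2 i hie))
    set ε := min η₁ (τ / 2 * δ ^ 2 / 2)
    have hε : 0 < ε := by positivity
    have hε₁ : ε ≤ η₁ := min_le_left _ _
    have hε₂ : 2 * ε ≤ τ / 2 * δ ^ 2 := by
      have : ε ≤ τ / 2 * δ ^ 2 / 2 := min_le_right _ _
      linarith
    obtain ⟨N₁, hN₁⟩ := exists_iterate_le_of_regular (b := e + ε) (b' := b) h hg hc hgrow hτ hC hβ
      (by linarith [he.1]) (by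
        intro x h1 h2 h0
        obtain ⟨i, hi, -⟩ := hcrit x h0 (by linarith [he.1])
        have : i ∈ S := by simp only [S, Finset.mem_filter, Finset.mem_univ, true_and]
                           constructor <;> linarith [he.1]
        have := hmax i this
        linarith)
    obtain ⟨M', N', hMN⟩ := ih (e - ε) (by
      refine Nat.lt_succ_iff.1 ((Finset.card_lt_card ?_).trans_le hcard)
      refine (Finset.ssubset_iff_of_subset ?_).2 ⟨i₀, hi₀, ?_⟩
      · intro i hi
        simp only [Finset.mem_filter, Finset.mem_univ, true_and, S] at hi ⊢
        exact ⟨hi.1, by linarith [he.2]⟩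
      · simp only [Finset.mem_filter, Finset.mem_univ, true_and, not_and, not_le]
        intro _; linarith)
    refine ⟨fun i => if v i = e then N₁ else M' i + (N₁ + 1), N' + (N₁ + 1), fun x hx hx' => ?_⟩
    rw [Function.iterate_add_apply]
    set y := (descentStep a g τ β)^[N₁] x with hy
    have hay := hN₁ x hx
    rw [← hy] at hay
    have hy1 : (descentStep a g τ β)^[N₁ + 1] x = descentStep a g τ β y := by
      rw [Function.iterate_succ_apply']
    have hle := le_descentStep (β := β) h hτ.le hC y
    have hmono := iterate_descentStep_le (β := β) h hτ.le hC y 1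
    rw [Function.iterate_one] at hmono
    rw [hy1]
    by_cases hlow : a (descentStep a g τ β y) < β
    · exact (iterate_descentStep_le h hτ.le hC _ _).trans_lt hlow
    have hay' : β ≤ a y := (not_lt.1 hlow).trans hmono
    rw [clampUnit_of_one_le ((one_le_div hβ).2 hay'), mul_one] at hle
    have hdrop : a (descentStep a g τ β y) ≤ e - ε := by
      by_cases h1 : a y ≤ e - ε
      · exact hmono.trans h1
      · have hyW := hW y ⟨by
          change |a y - e| ≤ η₁
          rw [abs_le]; constructor <;> linarith, mem_iInter.2 fun i hi => by
            have := hx' i (by rw [hi]; exact he.2)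
            dsimp only at this
            rwa [if_pos hi] at this⟩
        have : τ / 2 * δ ^ 2 ≤ τ / 2 * ‖g y‖ ^ 2 := by gcongr
        linarith
    refine hMN _ hdrop fun i hi => ?_
    have := hx' i (by linarith [he.2])
    dsimp only at this
    rw [if_neg (by intro h; linarith), Function.iterate_add_apply, hy1] at this
    exact this

end Descent

lemma LocallyLipschitz.pi {X ι : Type*} [Fintype ι] [PseudoEMetricSpace X] {Y : ι → Type*}
    [∀ i, PseudoEMetricSpace (Y i)] {f : X → ∀ i, Y i}
    (hf : ∀ i, LocallyLipschitz fun x => f x i) : LocallyLipschitz f := by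
  intro x
  choose K t ht hK using fun i => hf i x
  refine ⟨∑ i, K i, ⋂ i, t i, Filter.iInter_mem.2 ht, fun y hy z hz => ?_⟩
  refine edist_pi_le_iff.2 fun i => (hK i (mem_iInter.1 hy i) (mem_iInter.1 hz i)).trans ?_
  gcongr
  exact Finset.single_le_sum (f := K) (fun _ _ => zero_le) (Finset.mem_univ i)

section CircleAction

variable {J : Type*} [Fintype J] [DecidableEq J]

/-- The circle action with weights `l`. -/
def rotate (l : J → ℤ) (ζ : ℂ) (y : EuclideanSpace ℂ J) : EuclideanSpace ℂ J :=
  WithLp.toLp 2 fun j => ζ ^ l j * y j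

@[simp] lemma rotate_apply (l : J → ℤ) (ζ : ℂ) (y : EuclideanSpace ℂ J) (j : J) :
    rotate l ζ y j = ζ ^ l j * y j := rfl

/-- The projection to the part of positive weight. -/
def posPart' (l : J → ℤ) (y : EuclideanSpace ℂ J) : EuclideanSpace ℂ J :=
  WithLp.toLp 2 fun j => if 0 < l j then y j else 0

@[simp] lemma posPart'_apply (l : J → ℤ) (y : EuclideanSpace ℂ J) (j : J) :
    posPart' l y j = if 0 < l j then y j else 0 := rfl

lemma norm_rotate (l : J → ℤ) {ζ : ℂ} (hζ : ‖ζ‖ = 1) (y : EuclideanSpace ℂ J) :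
    ‖rotate l ζ y‖ = ‖y‖ := by
  simp [EuclideanSpace.norm_eq, hζ]

lemma posPart'_rotate (l : J → ℤ) (ζ : ℂ) (y : EuclideanSpace ℂ J) :
    posPart' l (rotate l ζ y) = rotate l ζ (posPart' l y) := by
  ext j; simp

/-- Raise a component of weight `m` to weight `L`. -/
def raiseWeight (L : ℕ) (m : ℤ) (w : ℂ) : ℂ :=
  if 0 < m then w ^ (L / m.natAbs) else (starRingEnd ℂ w) ^ (L / m.natAbs)

lemma contDiff_raiseWeight (L : ℕ) (m : ℤ) : ContDiff ℝ 1 (raiseWeight L m) := by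
  unfold raiseWeight
  have : ContDiff ℝ 1 (starRingEnd ℂ) := Complex.conjCLE.contDiff
  split_ifs <;> fun_prop

lemma conj_eq_inv_of_norm {ζ : ℂ} (hζ : ‖ζ‖ = 1) : starRingEnd ℂ ζ = ζ⁻¹ :=
  (Complex.inv_eq_conj hζ).symm

lemma raiseWeight_mul {L : ℕ} {m : ℤ} (hm : m ≠ 0) (hL : m.natAbs ∣ L) {ζ : ℂ} (hζ : ‖ζ‖ = 1)
    (w : ℂ) : raiseWeight L m (ζ ^ m * w) = ζ ^ L * raiseWeight L m w := by
  obtain ⟨q, rfl⟩ := hL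
  have h0 : m.natAbs ≠ 0 := Int.natAbs_ne_zero.2 hm
  unfold raiseWeight
  rw [Nat.mul_div_cancel_left _ (Nat.pos_of_ne_zero h0)]
  split_ifs with h
  · rw [mul_pow, pow_mul]
    congr 2
    rw [← zpow_natCast, Int.natAbs_of_nonneg h.le]
  · rw [map_mul, map_zpow₀, conj_eq_inv_of_norm hζ, mul_pow, pow_mul]
    congr 2
    rw [← zpow_natCast, inv_zpow', Int.ofNat_natAbs_of_nonpos (not_lt.1 h)]

lemma raiseWeight_eq_zero {L : ℕ} {m : ℤ} {w : ℂ} (h : raiseWeight L m w = 0) : w = 0 := by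
  unfold raiseWeight at h
  split_ifs at h
  · exact eq_zero_of_pow_eq_zero h
  · exact (map_eq_zero _).1 (eq_zero_of_pow_eq_zero h)


section Embedding

variable {k : ℕ} (l : J → ℤ) (e : Fin (k + 1) → J)

/-- Coordinates with all circle weights equal to one (or zero) on the space spanned by the
non-positive weights and the directions `e i`. -/
def weightOneCoords
    (q : ({j // l j = 0} → ℂ) × ({j // l j < 0} ⊕ Fin k → ℂ) × ℂ) : EuclideanSpace ℂ J :=
  WithLp.toLp 2 fun j => if h : l j = 0 then q.1 ⟨j, h⟩ else
    if h : l j < 0 then (starRingEnd ℂ (q.2.1 (.inl ⟨j, h⟩))) ^ (l j).natAbs else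
    ∑ i : Fin (k + 1), if e i = j then (Fin.snoc (α := fun _ => ℂ)
      (fun i' => q.2.1 (.inr i')) q.2.2 : Fin (k + 1) → ℂ) i else 0

lemma weightOneCoords_zero (q) (j : J) (h : l j = 0) :
    weightOneCoords l e q j = q.1 ⟨j, h⟩ := by
  simp [weightOneCoords, h]

lemma weightOneCoords_neg (q) (j : J) (h : l j < 0) :
    weightOneCoords l e q j = (starRingEnd ℂ (q.2.1 (.inl ⟨j, h⟩))) ^ (l j).natAbs := by
  simp [weightOneCoords, h, h.ne]

lemma weightOneCoords_pos (q) (j : J) (h : 0 < l j) :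
    weightOneCoords l e q j = ∑ i : Fin (k + 1), if e i = j then (Fin.snoc (α := fun _ => ℂ)
      (fun i' => q.2.1 (.inr i')) q.2.2 : Fin (k + 1) → ℂ) i else 0 := by
  simp [weightOneCoords, h.le, h.ne']

lemma weightOneCoords_range (he : Function.Injective e) (hle : ∀ i, l (e i) = 1) (q)
    (i : Fin (k + 1)) : weightOneCoords l e q (e i) = (Fin.snoc (α := fun _ => ℂ)
      (fun i' => q.2.1 (.inr i')) q.2.2 : Fin (k + 1) → ℂ) i := by
  rw [weightOneCoords_pos l e q (e i) (by rw [hle]; exact one_pos)]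
  simp [he.eq_iff]

lemma weightOneCoords_not_range (q) (j : J) (h : 0 < l j) (hj : j ∉ range e) :
    weightOneCoords l e q j = 0 := by
  rw [weightOneCoords_pos l e q j h]
  refine Finset.sum_eq_zero fun i _ => if_neg fun hi => hj ⟨i, hi⟩

lemma contDiff_weightOneCoords : ContDiff ℝ 1 (weightOneCoords l e) := by
  refine contDiff_piLp' 2 fun j => ?_
  have hconj : ContDiff ℝ 1 (starRingEnd ℂ) := Complex.conjCLE.contDiff
  rcases lt_trichotomy (l j) 0 with h | h | h
  · simp only [weightOneCoords_neg l e _ j h]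
    fun_prop
  · simp only [weightOneCoords_zero l e _ j h]
    fun_prop
  · simp only [weightOneCoords_pos l e _ j h]
    refine ContDiff.sum fun i _ => ?_
    split_ifs
    · induction i using Fin.lastCases with
      | last => simp only [Fin.snoc_last]; fun_prop
      | cast i => simp only [Fin.snoc_castSucc]; fun_prop
    · fun_prop

lemma weightOneCoords_smul (hle : ∀ i, l (e i) = 1) (x u z) {ζ : ℂ} (hζ : ‖ζ‖ = 1) :
    weightOneCoords l e (x, fun i => ζ * u i, ζ * z) =
      rotate l ζ (weightOneCoords l e (x, u, z)) := by
  ext j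
  rw [rotate_apply]
  rcases lt_trichotomy (l j) 0 with h | h | h
  · rw [weightOneCoords_neg l e _ j h, weightOneCoords_neg l e _ j h, map_mul, mul_pow,
      conj_eq_inv_of_norm hζ]
    congr 1
    rw [← zpow_natCast, inv_zpow', Int.ofNat_natAbs_of_nonpos h.le, neg_neg]
  · rw [weightOneCoords_zero l e _ j h, weightOneCoords_zero l e _ j h, h]
    simp
  · rw [weightOneCoords_pos l e _ j h, weightOneCoords_pos l e _ j h, Finset.mul_sum]
    refine Finset.sum_congr rfl fun i _ => ?_
    split_ifs with hi
    · rw [← hi, hle, zpow_one]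
      induction i using Fin.lastCases with
      | last => simp
      | cast i => simp
    · simp

end Embedding

end CircleAction

section CircleAction

variable {J : Type*} [Fintype J] [DecidableEq J]

lemma norm_apply_le_norm (y : EuclideanSpace ℂ J) (j : J) : ‖y j‖ ≤ ‖y‖ :=
  PiLp.norm_apply_le y j

lemma descentStep_rotate {l : J → ℤ} {a : EuclideanSpace ℂ J → ℝ}
    {g : EuclideanSpace ℂ J → EuclideanSpace ℂ J} {τ β : ℝ}
    (ha : ∀ ζ y, ‖ζ‖ = 1 → a (rotate l ζ y) = a y)
    (hg : ∀ ζ y, ‖ζ‖ = 1 → g (rotate l ζ y) = rotate l ζ (g y)) {ζ : ℂ} (hζ : ‖ζ‖ = 1)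
    (N : ℕ) (y) : (descentStep a g τ β)^[N] (rotate l ζ y) =
      rotate l ζ ((descentStep a g τ β)^[N] y) := by
  induction N generalizing y with
  | zero => rfl
  | succ N ih =>
    rw [Function.iterate_succ_apply, Function.iterate_succ_apply, ← ih]
    congr 1
    simp only [descentStep, ha ζ y hζ, hg ζ y hζ]
    ext j
    simp
    ring

/-- A function on `ℂ^J` invariant under a circle action, which is negative at infinity on the
non-positive weights plus `k + 1` directions and positive on a sphere in the positive weights,
has more than `k` critical orbits at positive level. -/
theorem exists_critical_point_of_circle_action {k : ℕ} (l : J → ℤ) (e : Fin (k + 1) → J)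
    (he : Function.Injective e) (hle : ∀ i, l (e i) = 1)
    {a : EuclideanSpace ℂ J → ℝ} {g : EuclideanSpace ℂ J → EuclideanSpace ℂ J} {C : ℝ}
    (h : IsQuadGradient a g C) (hg : LocallyLipschitz g)
    (ha_rot : ∀ ζ y, ‖ζ‖ = 1 → a (rotate l ζ y) = a y)
    (hg_rot : ∀ ζ y, ‖ζ‖ = 1 → g (rotate l ζ y) = rotate l ζ (g y))
    {c D : ℝ} (hc : 0 < c) (hgrow : ∀ x, c * ‖x‖ - D ≤ ‖g x‖)
    (hneg : ∀ y : EuclideanSpace ℂ J, (∀ j, 0 < l j → y j = 0) → a y ≤ 0) {R : ℝ}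
    (hT : ∀ y : EuclideanSpace ℂ J, (∀ j, 0 < l j → j ∉ range e → y j = 0) → R ≤ ‖y‖ → a y ≤ 0)
    {ρ β : ℝ} (hρ : 0 < ρ) (hβ : 0 < β)
    (hpos : ∀ y : EuclideanSpace ℂ J, (∀ j, l j ≤ 0 → y j = 0) → ‖y‖ = ρ → β ≤ a y)
    (Y : Fin k → EuclideanSpace ℂ J) :
    ∃ y, g y = 0 ∧ 0 < a y ∧ ∀ i ζ, ‖ζ‖ = 1 → y ≠ rotate l ζ (Y i) := by
  by_contra! hcon
  have hacont := (h.contDiff hg.continuous).continuous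
  -- choice of separating coordinates
  have hm : ∀ i : Fin k, ∃ m : J, l m ≠ 0 ∧ (0 < a (Y i) → Y i m ≠ 0) := by
    intro i
    by_cases hY : 0 < a (Y i)
    · by_contra! hno
      refine hY.not_ge (hneg _ fun j hj => ?_)
      exact (hno j hj.ne').2
    · exact ⟨e 0, by simp [hle], fun h => absurd h hY⟩
  choose m hml hm using hm
  -- the step size
  set τ : ℝ := 1 / (2 * (|C| + 1)) with hτdef
  have hτ : 0 < τ := by positivity
  have hCτ : C * τ ≤ 1 / 2 := by
    rw [hτdef, mul_one_div, div_le_div_iff₀ (by positivity) (by norm_num)]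
    nlinarith [le_abs_self C]
  -- upper bound on the test space
  obtain ⟨b, hb⟩ : ∃ b, ∀ y : EuclideanSpace ℂ J,
      (∀ j, 0 < l j → j ∉ range e → y j = 0) → a y ≤ b := by
    obtain ⟨b, hb⟩ := (isCompact_closedBall (0 : EuclideanSpace ℂ J) R).bddAbove_image
      hacont.continuousOn
    refine ⟨max b 0, fun y hy => ?_⟩
    by_cases hyR : ‖y‖ ≤ R
    · exact (hb (mem_image_of_mem _ (mem_closedBall_zero_iff.2 hyR))).trans (le_max_left _ _)
    · exact (hT y hy (not_le.1 hyR).le).trans (le_max_right _ _)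
  obtain ⟨M, N, hMN⟩ := exists_iterate_lt_of_separating h hg.continuous hc hgrow hτ hCτ hβ
    (fun i (y : EuclideanSpace ℂ J) => y (m i)) (fun i => by fun_prop) (fun i => a (Y i))
    (fun x hx hax => by
      obtain ⟨i, ζ, hζ, rfl⟩ := hcon x hx hax
      rw [ha_rot ζ _ hζ] at hax ⊢
      refine ⟨i, rfl, ?_⟩
      rw [rotate_apply]
      exact mul_ne_zero (zpow_ne_zero _ (by rintro rfl; simp at hζ)) (hm i hax)) b
  let σ : EuclideanSpace ℂ J → EuclideanSpace ℂ J := descentStep a g τ β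
  have hσL : LocallyLipschitz σ := locallyLipschitz_descentStep h hg
  have hσrot : ∀ {ζ : ℂ}, ‖ζ‖ = 1 → ∀ (N : ℕ) y, σ^[N] (rotate l ζ y) = rotate l ζ (σ^[N] y) :=
    fun hζ N y => descentStep_rotate ha_rot hg_rot hζ N y
  have hσ0 : ∀ {y}, a y ≤ 0 → ∀ N : ℕ, σ^[N] y = y :=
    fun hy N => iterate_descentStep_of_nonpos hβ hy N
  let L : ℕ := ∏ j, if l j = 0 then 1 else (l j).natAbs
  have hL : 0 < L := Finset.prod_pos fun j _ => by
    split_ifs with hj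
    · exact one_pos
    · exact Int.natAbs_pos.2 hj
  have hdvd : ∀ j, l j ≠ 0 → (l j).natAbs ∣ L := fun j hj => by
    have := Finset.dvd_prod_of_mem (fun j => if l j = 0 then 1 else (l j).natAbs)
      (Finset.mem_univ j)
    simpa [hj] using this
  let emb := weightOneCoords l e
  have hembT : ∀ q j, 0 < l j → j ∉ range e → emb q j = 0 :=
    fun q j hj hj' => weightOneCoords_not_range l e q j hj hj'
  have hembL : LocallyLipschitz emb := (contDiff_weightOneCoords l e).locallyLipschitz (𝕂 := ℝ)
  let F : ({j // l j = 0} → ℂ) × ({j // l j < 0} ⊕ Fin k → ℂ) × ℂ →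
      ({j // l j = 0} → ℂ) × ({j // l j < 0} ⊕ Fin k → ℂ) × ℝ := fun q =>
    (fun j => σ^[N] (emb q) j,
      fun i => Sum.elim (fun j : {j // l j < 0} => raiseWeight L (l j) (σ^[N] (emb q) j))
        (fun i => clampUnit (a (emb q) / β) • raiseWeight L (l (m i)) (σ^[M i] (emb q) (m i))) i,
      ‖posPart' l (σ^[N] (emb q))‖ - ρ)
  have hFL : LocallyLipschitz F := by
    have hh : ∀ N : ℕ, LocallyLipschitz fun q => σ^[N] (emb q) :=
      fun N => (hσL.iterate N).comp hembL
    refine LocallyLipschitz.prodMk (LocallyLipschitz.pi fun j => ?_)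
      (LocallyLipschitz.prodMk (LocallyLipschitz.pi fun i => ?_) ?_)
    · exact locallyLipschitz_of_contDiff_comp
        (g := fun y : EuclideanSpace ℂ J => y j) (by fun_prop) (hh N)
    · rcases i with j | i
      · exact locallyLipschitz_of_contDiff_comp (g := fun y : EuclideanSpace ℂ J =>
          raiseWeight L (l j) (y j)) ((contDiff_raiseWeight L (l j)).comp (by fun_prop)) (hh N)
      · refine LocallyLipschitz.smul_real ?_ ?_
        · exact lipschitzWith_clampUnit.locallyLipschitz.comp
            (((h.contDiff hg.continuous).div_const β).locallyLipschitz.comp hembL)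
        · exact locallyLipschitz_of_contDiff_comp (g := fun y : EuclideanSpace ℂ J =>
            raiseWeight L (l (m i)) (y (m i)))
            ((contDiff_raiseWeight L (l (m i))).comp (by fun_prop)) (hh (M i))
    · have h1 : ContDiff ℝ 1 (posPart' l) := by
        refine contDiff_piLp' 2 fun j => ?_
        simp only [posPart'_apply]
        split_ifs <;> fun_prop
      have h2 := lipschitzWith_one_norm.locallyLipschitz.comp
        (locallyLipschitz_of_contDiff_comp h1 (hh N))
      exact h2.add_vec (LocallyLipschitz.const (-ρ))
  have hFe : ∀ x u z (ζ : ℂ), ‖ζ‖ = 1 → F (x, fun i => ζ * u i, ζ * z) =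
      ((F (x, u, z)).1, fun i => ζ ^ L * (F (x, u, z)).2.1 i, (F (x, u, z)).2.2) := by
    intro x u z ζ hζ
    have hemb : emb (x, fun i => ζ * u i, ζ * z) = rotate l ζ (emb (x, u, z)) :=
      weightOneCoords_smul l e hle x u z hζ
    simp only [F, hemb, hσrot hζ, ha_rot ζ _ hζ, posPart'_rotate, norm_rotate l hζ, rotate_apply]
    refine Prod.ext ?_ (Prod.ext ?_ rfl)
    · funext j
      simp [j.2]
    · funext i
      rcases i with j | i
      · simp [raiseWeight_mul j.2.ne (hdvd _ j.2.ne) hζ]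
      · simp only [Sum.elim_inr, raiseWeight_mul (hml i) (hdvd _ (hml i)) hζ]
        rw [mul_smul_comm]
  have hF0 : ∀ x, (F (x, 0, 0)).2.2 < 0 := by
    intro x
    have hx : ∀ j, 0 < l j → emb (x, 0, 0) j = 0 := by
      intro j hj
      change weightOneCoords l e _ j = 0
      rw [weightOneCoords_pos l e _ j hj]
      refine Finset.sum_eq_zero fun i _ => ?_
      split_ifs
      · induction i using Fin.lastCases <;> simp
      · rfl
    simp only [F, hσ0 (hneg _ hx)]
    have : posPart' l (emb (x, 0, 0)) = 0 := by
      ext j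
      simp only [posPart'_apply, PiLp.zero_apply, ite_eq_right_iff]
      exact hx j
    rw [this]
    simpa using hρ
  have hnorm : ∀ x u z r, 1 ≤ r → r ≤ ‖(x, u, z)‖ → r ≤ ‖emb (x, u, z)‖ := by
    intro x u z r hr1 hr
    by_contra! hlt
    refine hr.not_gt ?_
    have hco : ∀ j, ‖emb (x, u, z) j‖ < r := fun j => (norm_apply_le_norm _ j).trans_lt hlt
    have hr0 : 0 < r := one_pos.trans_le hr1
    refine max_lt ((pi_norm_lt_iff hr0).2 fun j => ?_)
      (max_lt ((pi_norm_lt_iff hr0).2 fun i => ?_) ?_)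
    · have := hco j
      rwa [show emb (x, u, z) j = x j from weightOneCoords_zero l e _ j j.2] at this
    · rcases i with j | i
      · have := hco j
        rw [show emb (x, u, z) j = _ from weightOneCoords_neg l e _ j j.2, norm_pow,
          RCLike.norm_conj] at this
        by_contra! hge
        refine this.not_ge (hge.trans ?_)
        exact le_self_pow₀ (hr1.trans hge) (Int.natAbs_ne_zero.2 j.2.ne)
      · have := hco (e i.castSucc)
        rw [show emb (x, u, z) _ = _ from weightOneCoords_range l e he hle _ _] at this
        simpa using this
    · have := hco (e (Fin.last k))
      rw [show emb (x, u, z) _ = _ from weightOneCoords_range l e he hle _ _] at this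
      simpa using this
  obtain ⟨q, hq⟩ := exists_zero_of_circle_equivariant hL hρ hFL hFe hF0
    (R := max (max R 1) (ρ + 1)) (by
    intro x u z hxuz s hs hzero
    have hp := hnorm x u z _ ((le_max_right _ _).trans (le_max_left _ _)) hxuz
    have hap : a (emb (x, u, z)) ≤ 0 := hT _ (hembT _)
      (((le_max_left _ _).trans (le_max_left _ _)).trans hp)
    simp only [F, hσ0 hap, clampUnit_of_nonpos (div_nonpos_of_nonpos_of_nonneg hap hβ.le),
      zero_smul] at hzero
    have h1 : ∀ j, x j = 0 := by
      intro j
      have := congrFun (congrArg Prod.fst hzero) j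
      simp only [Prod.smul_mk, Prod.mk_add_mk, Pi.add_apply, Pi.smul_apply, Prod.fst_zero,
        Pi.zero_apply] at this
      rw [show emb (x, u, z) j = x j from weightOneCoords_zero l e _ j j.2, ← add_smul,
        sub_add_cancel, one_smul] at this
      exact this
    have h2 : ∀ j, u (.inl j) = 0 := by
      intro j
      have := congrFun (congrArg (fun w => w.2.1) hzero) (.inl j)
      simp only [Prod.smul_mk, Prod.mk_add_mk, Pi.add_apply, Pi.smul_apply, Prod.snd_zero,
        Prod.fst_zero, Pi.zero_apply, Sum.elim_inl] at this
      rw [show emb (x, u, z) j = _ from weightOneCoords_neg l e _ j j.2, raiseWeight,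
        if_neg j.2.not_gt, map_pow, Complex.conj_conj, ← pow_mul,
        Nat.mul_div_cancel' (hdvd _ j.2.ne), ← add_smul, sub_add_cancel, one_smul] at this
      exact eq_zero_of_pow_eq_zero this
    have h3 : ∀ i, s • u (.inr i) ^ L = 0 := by
      intro i
      have := congrFun (congrArg (fun w => w.2.1) hzero) (.inr i)
      simpa using this
    have h4 : (1 - s) * (‖posPart' l (emb (x, u, z))‖ - ρ) + s * (‖z‖ - ρ) = 0 :=
      congrArg (fun w => w.2.2) hzero
    have hpp : posPart' l (emb (x, u, z)) = emb (x, u, z) := by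
      ext j
      rw [posPart'_apply]
      split_ifs with hj
      · rfl
      · rcases (not_lt.1 hj).lt_or_eq with hj | hj
        · rw [show emb (x, u, z) j = _ from weightOneCoords_neg l e _ j hj]
          dsimp only
          rw [h2, map_zero, zero_pow (Int.natAbs_ne_zero.2 hj.ne)]
        · rw [show emb (x, u, z) j = _ from weightOneCoords_zero l e _ j hj]
          exact (h1 _).symm
    have hρlt : ρ < ‖emb (x, u, z)‖ := by
      linarith [(le_max_right (max R 1) (ρ + 1)).trans hp]
    rw [hpp] at h4
    rcases hs.1.eq_or_lt with rfl | hs0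
    · linarith
    · have hu : u = 0 := by
        funext i
        rcases i with j | i
        · exact h2 j
        · exact eq_zero_of_pow_eq_zero ((smul_eq_zero.1 (h3 i)).resolve_left hs0.ne')
      have hx : x = 0 := funext h1
      have hz : ρ + 1 ≤ ‖z‖ := by
        have := (le_max_right (max R 1) (ρ + 1)).trans hxuz
        rw [hu, hx] at this
        simpa using this
      nlinarith [hs.2])
  set p := emb q with hpdef
  set y := σ^[N] p with hy
  have hq1 : ∀ j, l j = 0 → y j = 0 := fun j hj =>
    congrFun (congrArg Prod.fst hq) ⟨j, hj⟩
  have hq2 : ∀ j, l j < 0 → y j = 0 := fun j hj =>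
    raiseWeight_eq_zero (congrFun (congrArg (fun w => w.2.1) hq) (.inl ⟨j, hj⟩))
  have hq3 : ∀ i, clampUnit (a p / β) • raiseWeight L (l (m i)) (σ^[M i] p (m i)) = 0 :=
    fun i => congrFun (congrArg (fun w => w.2.1) hq) (.inr i)
  have hq4 : ‖posPart' l y‖ - ρ = 0 := congrArg (fun w => w.2.2) hq
  have hpy : posPart' l y = y := by
    ext j
    rw [posPart'_apply]
    split_ifs with hj
    · rfl
    · rcases (not_lt.1 hj).lt_or_eq with hj | hj
      · exact (hq2 j hj).symm
      · exact (hq1 j hj).symm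
  rw [hpy] at hq4
  have hay : β ≤ a y := hpos y (fun j hj => by
    rcases hj.lt_or_eq with hj | hj
    · exact hq2 j hj
    · exact hq1 j hj) (by linarith)
  have hap : β ≤ a p := hay.trans (iterate_descentStep_le h hτ.le hCτ p N)
  have := hMN p (hb p (hembT q)) fun i => by
    have := hq3 i
    rw [clampUnit_of_one_le ((one_le_div hβ).2 hap), one_smul] at this
    exact raiseWeight_eq_zero this
  exact this.not_ge hay

end CircleAction

section Reduction

variable {J : Type*} [Fintype J] [DecidableEq J]

/-- Multiplication by real weights. -/
def diagMul (w : J → ℝ) : EuclideanSpace ℂ J →L[ℝ] EuclideanSpace ℂ J :=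
  LinearMap.toContinuousLinearMap
    { toFun := fun y => WithLp.toLp 2 fun j => (w j : ℂ) * y j
      map_add' := fun x y => by ext j; simp [mul_add]
      map_smul' := fun c y => by ext j; simp; ring }

@[simp] lemma diagMul_apply (w : J → ℝ) (y : EuclideanSpace ℂ J) (j : J) :
    diagMul w y j = (w j : ℂ) * y j := rfl

lemma inner_diagMul_self (w : J → ℝ) (y : EuclideanSpace ℂ J) :
    inner ℝ (diagMul w y) y = ∑ j, w j * ‖y j‖ ^ 2 := by
  rw [PiLp.inner_apply]
  refine Finset.sum_congr rfl fun j _ => ?_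
  rw [diagMul_apply, ← Complex.real_smul, real_inner_smul_left, real_inner_self_eq_norm_sq]

lemma inner_diagMul_comm (w : J → ℝ) (x y : EuclideanSpace ℂ J) :
    inner ℝ (diagMul w x) y = inner ℝ x (diagMul w y) := by
  rw [PiLp.inner_apply, PiLp.inner_apply]
  refine Finset.sum_congr rfl fun j _ => ?_
  rw [diagMul_apply, diagMul_apply, ← Complex.real_smul, ← Complex.real_smul,
    real_inner_smul_left, real_inner_smul_right]

lemma diagMul_rotate (w : J → ℝ) (l : J → ℤ) (ζ : ℂ) (y : EuclideanSpace ℂ J) :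
    diagMul w (rotate l ζ y) = rotate l ζ (diagMul w y) := by
  ext j; simp; ring

lemma inner_rotate (l : J → ℤ) {ζ : ℂ} (hζ : ‖ζ‖ = 1) (x y : EuclideanSpace ℂ J) :
    inner ℝ (rotate l ζ x) (rotate l ζ y) = inner ℝ x y := by
  rw [PiLp.inner_apply, PiLp.inner_apply]
  refine Finset.sum_congr rfl fun j _ => ?_
  have h1 : ζ ^ l j * (starRingEnd ℂ) (ζ ^ l j) = 1 := by
    rw [Complex.mul_conj, Complex.normSq_eq_norm_sq]
    simp [hζ]
  rw [rotate_apply, rotate_apply, Complex.inner, Complex.inner, map_mul]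
  congr 1
  linear_combination (y j * (starRingEnd ℂ) (x j)) * h1

lemma norm_diagMul_ge {w : J → ℝ} {c : ℝ} (hc : 0 ≤ c) (hw : ∀ j, c ≤ |w j|)
    (y : EuclideanSpace ℂ J) : c * ‖y‖ ≤ ‖diagMul w y‖ := by
  rw [EuclideanSpace.norm_eq, EuclideanSpace.norm_eq]
  refine Real.le_sqrt_of_sq_le ?_
  rw [mul_pow, Real.sq_sqrt (Finset.sum_nonneg fun _ _ => by positivity), Finset.mul_sum]
  refine Finset.sum_le_sum fun j _ => ?_
  rw [diagMul_apply, norm_mul, mul_pow, Complex.norm_real, Real.norm_eq_abs]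
  gcongr
  exact hw j

variable {𝓗 : Type*} [NormedAddCommGroup 𝓗] [InnerProductSpace ℝ 𝓗] [CompleteSpace 𝓗]

/-- The splitting data of a Lyapunov–Schmidt reduction: a finite dimensional space of low modes
and a small self-adjoint operator `K = Kp + Kn` on the complement. -/
structure ModeSplitting (J 𝓗 : Type*) [Fintype J] [NormedAddCommGroup 𝓗]
    [InnerProductSpace ℝ 𝓗] where
  incl : EuclideanSpace ℂ J →L[ℝ] 𝓗
  proj : 𝓗 →L[ℝ] EuclideanSpace ℂ J
  K : 𝓗 →L[ℝ] 𝓗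
  Kp : 𝓗 →L[ℝ] 𝓗
  Kn : 𝓗 →L[ℝ] 𝓗
  κ : ℝ
  weight : J → ℤ
  act : ℂ → 𝓗 →ₗ[ℝ] 𝓗
  inner_incl : ∀ y v, inner ℝ (incl y) v = inner ℝ y (proj v)
  proj_incl : ∀ y, proj (incl y) = y
  K_eq : ∀ v, K v = Kp v + Kn v
  inner_K : ∀ u v, inner ℝ (K u) v = inner ℝ u (K v)
  norm_K : ∀ v, ‖K v‖ ≤ κ * ‖v‖
  proj_K : ∀ v, proj (K v) = 0
  norm_Kp : ∀ v, ‖Kp v‖ ^ 2 ≤ κ * inner ℝ v (Kp v)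
  inner_Kn : ∀ v, inner ℝ v (Kn v) ≤ 0
  act_incl : ∀ ζ y, ‖ζ‖ = 1 → act ζ (incl y) = incl (rotate weight ζ y)
  proj_act : ∀ ζ v, ‖ζ‖ = 1 → proj (act ζ v) = rotate weight ζ (proj v)
  act_K : ∀ ζ v, ‖ζ‖ = 1 → act ζ (K v) = K (act ζ v)
  inner_act : ∀ ζ u v, ‖ζ‖ = 1 → inner ℝ (act ζ u) (act ζ v) = inner ℝ u v

namespace ModeSplitting

variable (S : ModeSplitting J 𝓗) {C : ℝ} {N : 𝓗 → 𝓗} {𝒽 : 𝓗 → ℝ}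

lemma norm_incl (y : EuclideanSpace ℂ J) : ‖S.incl y‖ = ‖y‖ := by
  have h1 := S.inner_incl y (S.incl y)
  rw [S.proj_incl, real_inner_self_eq_norm_sq, real_inner_self_eq_norm_sq] at h1
  exact (sq_eq_sq₀ (norm_nonneg _) (norm_nonneg _)).1 h1

lemma norm_K_sub_le (hκ : 0 ≤ S.κ) (hκC : S.κ * C ≤ 1 / 2)
    (hN : ∀ u v, ‖N u - N v‖ ≤ C * ‖u - v‖) (u v : 𝓗) :
    ‖S.K (N u - N v)‖ ≤ 1 / 2 * ‖u - v‖ := by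
  calc _ ≤ S.κ * (C * ‖u - v‖) := (S.norm_K _).trans (by gcongr; exact hN u v)
    _ = S.κ * C * ‖u - v‖ := by ring
    _ ≤ _ := by gcongr

lemma exists_lift (hκ : 0 ≤ S.κ) (hκC : S.κ * C ≤ 1 / 2)
    (hN : ∀ u v, ‖N u - N v‖ ≤ C * ‖u - v‖) (y : EuclideanSpace ℂ J) :
    ∃ x, x = S.incl y + S.K (N x) := by
  have hc : ContractingWith (1 / 2) fun x => S.incl y + S.K (N x) := by
    refine ⟨by norm_num, LipschitzWith.of_dist_le_mul fun u v => ?_⟩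
    rw [dist_eq_norm, dist_eq_norm, add_sub_add_left_eq_sub, ← map_sub]
    simpa using S.norm_K_sub_le hκ hκC hN u v
  exact ⟨hc.fixedPoint, hc.fixedPoint_isFixedPt.symm⟩

lemma lift_dist (hκ : 0 ≤ S.κ) (hκC : S.κ * C ≤ 1 / 2)
    (hN : ∀ u v, ‖N u - N v‖ ≤ C * ‖u - v‖) {y y' : EuclideanSpace ℂ J} {x x' : 𝓗}
    (hx : x = S.incl y + S.K (N x)) (hx' : x' = S.incl y' + S.K (N x')) :
    ‖x' - x‖ ≤ 2 * ‖y' - y‖ := by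
  have h1 : x' - x = S.incl (y' - y) + S.K (N x' - N x) := by
    conv_lhs => rw [hx, hx']
    rw [map_sub, map_sub]; abel
  have h2 := norm_add_le (S.incl (y' - y)) (S.K (N x' - N x))
  rw [← h1, S.norm_incl] at h2
  linarith [S.norm_K_sub_le hκ hκC hN x' x]

/-- **Lyapunov–Schmidt reduction.** The critical point theorem for `½⟨Lx,x⟩ - 𝒽 x`. -/
theorem exists_critical_point (hκ : 0 ≤ S.κ) (hC : 0 ≤ C) (hκC : S.κ * C ≤ 1 / 2)
    (hN : ∀ u v, ‖N u - N v‖ ≤ C * ‖u - v‖) (h𝒽 : IsQuadGradient 𝒽 N C)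
    (hNact : ∀ ζ v, ‖ζ‖ = 1 → N (S.act ζ v) = S.act ζ (N v))
    (h𝒽act : ∀ ζ v, ‖ζ‖ = 1 → 𝒽 (S.act ζ v) = 𝒽 v)
    {k : ℕ} (e : Fin (k + 1) → J) (he : Function.Injective e) (hle : ∀ i, S.weight (e i) = 1)
    (h𝒽0 : ∀ v, 0 ≤ 𝒽 v) {q : J → ℝ} {c₀ : ℝ} (hq : ∀ j, 0 < q j) (hqe : ∀ i, π < q (e i))
    (hlow : ∀ y v, ∑ j, q j * ‖y j‖ ^ 2 - c₀ ≤ 𝒽 (S.incl y + S.Kn v))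
    {Q : J → ℝ} {M δ : ℝ} (hδ : 0 < δ) (hQ : ∀ j, δ ≤ |2 * π * S.weight j - Q j|)
    (hM : ∀ v, ‖S.proj (N v) - diagMul Q (S.proj v)‖ ≤ M)
    {ρ : ℝ} (hρ : 0 < ρ)
    (hloc : ∀ y, ‖y‖ ≤ ρ → N (S.incl y) = 0 ∧ 𝒽 (S.incl y) = 0) (Y : Fin k → 𝓗) :
    ∃ x, x = S.incl (S.proj x) + S.K (N x) ∧
      diagMul (fun j => 2 * π * S.weight j) (S.proj x) = S.proj (N x) ∧
      0 < 1 / 2 * inner ℝ (N x) x - 𝒽 x ∧ ∀ i ζ, ‖ζ‖ = 1 → x ≠ S.act ζ (Y i) := by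
  choose X hX using S.exists_lift hκ hκC hN
  let Λ : EuclideanSpace ℂ J →L[ℝ] EuclideanSpace ℂ J := diagMul (fun j => 2 * π * S.weight j)
  let a : EuclideanSpace ℂ J → ℝ := fun y =>
    1 / 2 * inner ℝ (Λ y) y + 1 / 2 * inner ℝ (N (X y)) (S.K (N (X y))) - 𝒽 (X y)
  let g : EuclideanSpace ℂ J → EuclideanSpace ℂ J := fun y => Λ y - S.proj (N (X y))
  have huniq : ∀ y x, x = S.incl y + S.K (N x) → x = X y := fun y x hx => by
    have := S.lift_dist hκ hκC hN (hX y) hx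
    simpa [sub_eq_zero] using this
  have hprojX : ∀ y, S.proj (X y) = y := fun y => by
    rw [hX y, map_add, S.proj_incl, S.proj_K, add_zero]
  have hXrot : ∀ ζ y, ‖ζ‖ = 1 → X (rotate S.weight ζ y) = S.act ζ (X y) := fun ζ y hζ => by
    refine (huniq _ _ ?_).symm
    conv_lhs => rw [hX y]
    rw [map_add, S.act_incl _ _ hζ, S.act_K _ _ hζ, hNact _ _ hζ]
  have hquad : IsQuadGradient a g (‖Λ‖ / 2 + 2 * C + 4 * C) := by
    intro y y'
    set dN := N (X y') - N (X y) with hdN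
    have hd : X y' - X y = S.incl (y' - y) + S.K dN := by
      conv_lhs => rw [hX y, hX y']
      rw [hdN, map_sub, map_sub]; abel
    have hdle := S.lift_dist hκ hκC hN (hX y) (hX y')
    have hdNle : ‖dN‖ ≤ C * (2 * ‖y' - y‖) := (hN _ _).trans (by gcongr)
    have h1 := h𝒽 (X y) (X y')
    have hKdN : ‖S.K dN‖ ≤ ‖y' - y‖ := by
      have := S.norm_K_sub_le hκ hκC hN (X y') (X y)
      linarith
    have h2 : |1 / 2 * inner ℝ dN (S.K dN)| ≤ C * ‖y' - y‖ ^ 2 := by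
      rw [abs_mul, abs_of_pos (by norm_num : (0:ℝ) < 1 / 2)]
      have := abs_real_inner_le_norm dN (S.K dN)
      have h3 : ‖dN‖ * ‖S.K dN‖ ≤ C * (2 * ‖y' - y‖) * ‖y' - y‖ := by gcongr
      nlinarith
    have h3 : |1 / 2 * inner ℝ (Λ (y' - y)) (y' - y)| ≤ ‖Λ‖ / 2 * ‖y' - y‖ ^ 2 := by
      rw [abs_mul, abs_of_pos (by norm_num : (0:ℝ) < 1 / 2)]
      have := abs_real_inner_le_norm (Λ (y' - y)) (y' - y)
      have h3 : ‖Λ (y' - y)‖ * ‖y' - y‖ ≤ ‖Λ‖ * ‖y' - y‖ * ‖y' - y‖ := by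
        gcongr; exact Λ.le_opNorm _
      nlinarith
    have h4 : C * ‖X y' - X y‖ ^ 2 ≤ 4 * C * ‖y' - y‖ ^ 2 := by
      have : ‖X y' - X y‖ ^ 2 ≤ (2 * ‖y' - y‖) ^ 2 := by gcongr
      nlinarith
    have hkey : a y' - a y - inner ℝ (g y) (y' - y) =
        1 / 2 * inner ℝ (Λ (y' - y)) (y' - y) + 1 / 2 * inner ℝ dN (S.K dN) -
        (𝒽 (X y') - 𝒽 (X y) - inner ℝ (N (X y)) (X y' - X y)) := by
      have e1 : N (X y') = N (X y) + dN := by rw [hdN]; abel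
      rw [hd, inner_add_right]
      have e3 : ∀ w, inner ℝ (N (X y)) (S.incl w) = inner ℝ (S.proj (N (X y))) w := fun w => by
        rw [real_inner_comm, S.inner_incl, real_inner_comm]
      have e4 : inner ℝ dN (S.K (N (X y))) = inner ℝ (N (X y)) (S.K dN) := by
        rw [← S.inner_K, real_inner_comm]
      have e5 : inner ℝ (Λ y') y = inner ℝ (Λ y) y' := by
        rw [inner_diagMul_comm, real_inner_comm]
      simp only [a, g, e1, e3, map_add, map_sub, inner_add_left, inner_add_right, inner_sub_left,
        inner_sub_right, e4, e5]
      ring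
    rw [hkey]
    have h5 := abs_sub (1 / 2 * inner ℝ (Λ (y' - y)) (y' - y) + 1 / 2 * inner ℝ dN (S.K dN))
      (𝒽 (X y') - 𝒽 (X y) - inner ℝ (N (X y)) (X y' - X y))
    have h6 := abs_add_le (1 / 2 * inner ℝ (Λ (y' - y)) (y' - y)) (1 / 2 * inner ℝ dN (S.K dN))
    nlinarith [mul_nonneg hC (sq_nonneg ‖y' - y‖)]
  have hgL : LipschitzWith (‖Λ‖ + ‖S.proj‖ * (C * 2)).toNNReal g := by
    refine LipschitzWith.of_dist_le_mul fun y y' => ?_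
    rw [Real.coe_toNNReal _ (by positivity), dist_eq_norm, dist_eq_norm]
    have : g y - g y' = Λ (y - y') - S.proj (N (X y) - N (X y')) := by
      simp only [g, map_sub]; abel
    rw [this]
    calc _ ≤ ‖Λ (y - y')‖ + ‖S.proj (N (X y) - N (X y'))‖ := norm_sub_le _ _
      _ ≤ ‖Λ‖ * ‖y - y'‖ + ‖S.proj‖ * (C * (2 * ‖y - y'‖)) := by
        gcongr
        · exact Λ.le_opNorm _
        · refine (S.proj.le_opNorm _).trans ?_
          gcongr
          refine (hN _ _).trans ?_
          gcongr
          exact S.lift_dist hκ hκC hN (hX y') (hX y)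
      _ = _ := by ring
  have ha_rot : ∀ ζ y, ‖ζ‖ = 1 → a (rotate S.weight ζ y) = a y := fun ζ y hζ => by
    simp only [a, hXrot ζ y hζ, hNact _ _ hζ, h𝒽act _ _ hζ, ← S.act_K _ _ hζ,
      S.inner_act _ _ _ hζ, Λ, diagMul_rotate, inner_rotate _ hζ]
  have hrotsub : ∀ ζ (x y : EuclideanSpace ℂ J), rotate S.weight ζ (x - y) =
      rotate S.weight ζ x - rotate S.weight ζ y := fun ζ x y => by ext j; simp [mul_sub]
  have hg_rot : ∀ ζ y, ‖ζ‖ = 1 → g (rotate S.weight ζ y) = rotate S.weight ζ (g y) :=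
    fun ζ y hζ => by
      simp only [g, hXrot ζ y hζ, hNact _ _ hζ, S.proj_act _ _ hζ, Λ, diagMul_rotate, hrotsub]
  have hgrow : ∀ y, δ * ‖y‖ - M ≤ ‖g y‖ := fun y => by
    have h1 := norm_diagMul_ge hδ.le hQ y
    have h2 := hM (X y)
    rw [hprojX] at h2
    have h3 : diagMul (fun j => 2 * π * S.weight j - Q j) y =
        g y + (S.proj (N (X y)) - diagMul Q y) := by
      ext j; simp [g, Λ]; ring
    rw [h3] at h1
    linarith [norm_add_le (g y) (S.proj (N (X y)) - diagMul Q y)]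
  have hupper : ∀ y, a y ≤ 1 / 2 * inner ℝ (Λ y) y - 𝒽 (S.incl y + S.Kn (N (X y))) := fun y => by
    have h1 := (abs_le.1 (h𝒽 (X y) (S.incl y + S.Kn (N (X y))))).2
    have h2 : S.incl y + S.Kn (N (X y)) - X y = - S.Kp (N (X y)) := by
      have hX' := hX y
      rw [S.K_eq] at hX'
      linear_combination (norm := module) -(1:ℝ) • hX'
    rw [h2, norm_neg, inner_neg_right] at h1
    have h3 := S.norm_Kp (N (X y))
    have h4 := S.inner_Kn (N (X y))
    have h5 : C * ‖S.Kp (N (X y))‖ ^ 2 ≤ 1 / 2 * inner ℝ (N (X y)) (S.Kp (N (X y))) := by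
      by_cases h0 : 0 ≤ inner ℝ (N (X y)) (S.Kp (N (X y)))
      · have h6 := mul_le_mul_of_nonneg_left h3 hC
        have h7 := mul_le_mul_of_nonneg_right hκC h0
        linarith
      · have h6 : ‖S.Kp (N (X y))‖ ^ 2 ≤ 0 :=
          h3.trans (mul_nonpos_of_nonneg_of_nonpos hκ (not_le.1 h0).le)
        have h7 : S.Kp (N (X y)) = 0 := by
          rw [← norm_eq_zero]
          exact pow_eq_zero_iff two_ne_zero |>.1 (h6.antisymm (by positivity))
        simp [h7] at h0
    simp only [a, S.K_eq, inner_add_right]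
    linarith
  have hsum : ∀ y, inner ℝ (Λ y) y = ∑ j, 2 * π * S.weight j * ‖y j‖ ^ 2 :=
    fun y => inner_diagMul_self _ y
  have hneg : ∀ y : EuclideanSpace ℂ J, (∀ j, 0 < S.weight j → y j = 0) → a y ≤ 0 := by
    intro y hy
    refine (hupper y).trans ?_
    have : inner ℝ (Λ y) y ≤ 0 := by
      rw [hsum]
      refine Finset.sum_nonpos fun j _ => ?_
      by_cases hj : 0 < S.weight j
      · simp [hy j hj]
      · have : (S.weight j : ℝ) ≤ 0 := by exact_mod_cast not_lt.1 hj
        have : 2 * π * S.weight j ≤ 0 := mul_nonpos_of_nonneg_of_nonpos (by positivity) this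
        exact mul_nonpos_of_nonpos_of_nonneg this (by positivity)
    linarith [h𝒽0 (S.incl y + S.Kn (N (X y)))]
  obtain ⟨ε, hε, hεq⟩ : ∃ ε > 0, (∀ j, ε ≤ q j) ∧ ∀ i, π + ε ≤ q (e i) := by
    have : Nonempty J := ⟨e 0⟩
    obtain ⟨j₀, hj₀⟩ := Finite.exists_min q
    obtain ⟨i₀, hi₀⟩ := Finite.exists_min (fun i => q (e i) - π)
    refine ⟨min (q j₀) (q (e i₀) - π), lt_min (hq _) (sub_pos.2 (hqe _)), fun j =>
      (min_le_left _ _).trans (hj₀ j), fun i => ?_⟩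
    linarith [min_le_right (q j₀) (q (e i₀) - π), hi₀ i]
  have hT : ∀ y : EuclideanSpace ℂ J, (∀ j, 0 < S.weight j → j ∉ range e → y j = 0) →
      √(|c₀| / ε) ≤ ‖y‖ → a y ≤ 0 := by
    intro y hy hyR
    refine (hupper y).trans ?_
    have h1 := hlow y (N (X y))
    have h2 : 1 / 2 * inner ℝ (Λ y) y + ε * ‖y‖ ^ 2 ≤ ∑ j, q j * ‖y j‖ ^ 2 := by
      rw [hsum, EuclideanSpace.norm_sq_eq, Finset.mul_sum, Finset.mul_sum,
        ← Finset.sum_add_distrib]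
      refine Finset.sum_le_sum fun j _ => ?_
      by_cases hj : 0 < S.weight j
      · by_cases hje : j ∈ range e
        · obtain ⟨i, rfl⟩ := hje
          rw [hle]
          have := mul_le_mul_of_nonneg_right (hεq.2 i) (sq_nonneg ‖y (e i)‖)
          push_cast
          linarith
        · simp [hy j hj hje]
      · have h3 : (S.weight j : ℝ) ≤ 0 := by exact_mod_cast not_lt.1 hj
        have h4 : π * S.weight j * ‖y j‖ ^ 2 ≤ 0 :=
          mul_nonpos_of_nonpos_of_nonneg
            (mul_nonpos_of_nonneg_of_nonpos (by positivity) h3) (by positivity)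
        have := mul_le_mul_of_nonneg_right (hεq.1 j) (sq_nonneg ‖y j‖)
        linarith
    have h3 : |c₀| ≤ ε * ‖y‖ ^ 2 := by
      have := Real.sqrt_le_left (norm_nonneg y) |>.1 hyR
      rw [div_le_iff₀ hε] at this
      linarith
    linarith [le_abs_self c₀]
  have hpos : ∀ y : EuclideanSpace ℂ J, (∀ j, S.weight j ≤ 0 → y j = 0) → ‖y‖ = ρ →
      π * ρ ^ 2 ≤ a y := by
    intro y hy hyρ
    obtain ⟨h1, h2⟩ := hloc y hyρ.le
    have h3 : S.incl y = X y := huniq _ _ (by rw [h1, map_zero, add_zero])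
    simp only [a, ← h3, h1, h2, hsum, inner_zero_left]
    rw [← hyρ, EuclideanSpace.norm_sq_eq, Finset.mul_sum, Finset.mul_sum, mul_zero, add_zero,
      sub_zero]
    refine Finset.sum_le_sum fun j _ => ?_
    by_cases hj : S.weight j ≤ 0
    · simp [hy j hj]
    · have : (1:ℝ) ≤ S.weight j := by exact_mod_cast not_le.1 hj
      have : π * ‖y j‖ ^ 2 * 1 ≤ π * ‖y j‖ ^ 2 * S.weight j := by gcongr
      linarith
  obtain ⟨y, hy0, hya, hyY⟩ := exists_critical_point_of_circle_action S.weight e he hle hquad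
    hgL.locallyLipschitz ha_rot hg_rot hδ hgrow hneg hT hρ (by positivity) hpos
    (fun i => S.proj (Y i))
  have hΛ : Λ y = S.proj (N (X y)) := sub_eq_zero.1 hy0
  refine ⟨X y, by rw [hprojX]; exact hX y, by rw [hprojX]; exact hΛ, ?_, fun i ζ hζ hx => ?_⟩
  · refine hya.trans_eq ?_
    simp only [a]
    have h1 : inner ℝ (N (X y)) (X y) =
        inner ℝ (N (X y)) (S.incl y) + inner ℝ (N (X y)) (S.K (N (X y))) := by
      rw [← inner_add_right, ← hX y]
    rw [h1, real_inner_comm, hΛ, ← S.inner_incl, real_inner_comm]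
    ring
  · refine hyY i ζ hζ ?_
    rw [← S.proj_act _ _ hζ, ← hx, hprojX]

end ModeSplitting

end Reduction

section Multiplier

variable {I : Type*}

lemma lp_two_norm_sq (v : lp (fun _ : I => ℂ) 2) : ‖v‖ ^ 2 = ∑' j, ‖v j‖ ^ 2 := by
  have := lp.norm_rpow_eq_tsum (p := 2) (by norm_num) v
  simpa using this

lemma lp_two_summable (v : lp (fun _ : I => ℂ) 2) : Summable fun j => ‖v j‖ ^ 2 := by
  have := (lp.memℓp v).summable (by norm_num)
  simpa using this

lemma memℓp_two_of_summable {v : I → ℂ} (h : Summable fun j => ‖v j‖ ^ 2) :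
    Memℓp (E := fun _ : I => ℂ) v 2 :=
  memℓp_gen (by simpa using h)

/-- The operator on `ℓ²` multiplying by a bounded family of scalars. -/
def multiplier (m : I → ℂ) (B : ℝ) (hB : ∀ j, ‖m j‖ ≤ B) :
    lp (fun _ : I => ℂ) 2 →L[ℝ] lp (fun _ : I => ℂ) 2 :=
  LinearMap.mkContinuous
    { toFun := fun v => ⟨fun j => m j * v j, memℓp_two_of_summable <| by
        refine Summable.of_nonneg_of_le (fun _ => by positivity) (fun j => ?_)
          ((lp_two_summable v).mul_left (B ^ 2))
        rw [norm_mul, mul_pow]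
        gcongr
        exact hB j⟩
      map_add' := fun u v => by ext j; exact mul_add _ _ _
      map_smul' := fun c v => by ext j; exact mul_smul_comm c (m j) (v j) } |B| (fun v => by
    refine le_of_sq_le_sq ?_ (by positivity)
    rw [lp_two_norm_sq, mul_pow, lp_two_norm_sq, ← tsum_mul_left]
    refine Summable.tsum_le_tsum (fun j => ?_) (lp_two_summable _)
      ((lp_two_summable v).mul_left _)
    change ‖m j * v j‖ ^ 2 ≤ _
    rw [norm_mul, mul_pow]
    gcongr
    exact (hB j).trans (le_abs_self B))

@[simp] lemma multiplier_apply (m : I → ℂ) (B : ℝ) (hB : ∀ j, ‖m j‖ ≤ B)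
    (v : lp (fun _ : I => ℂ) 2) (j : I) : multiplier m B hB v j = m j * v j := rfl

lemma norm_multiplier_le (m : I → ℂ) {B : ℝ} (hB : ∀ j, ‖m j‖ ≤ B) (h : 0 ≤ B)
    (v : lp (fun _ : I => ℂ) 2) : ‖multiplier m B hB v‖ ≤ B * ‖v‖ := by
  refine (ContinuousLinearMap.le_of_opNorm_le _ (LinearMap.mkContinuous_norm_le _ (abs_nonneg B) _)
    v).trans_eq ?_
  rw [abs_of_nonneg h]

lemma inner_multiplier_real_comm (m : I → ℝ) (B : ℝ) (hB : ∀ j, ‖(m j : ℂ)‖ ≤ B)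
    (u v : lp (fun _ : I => ℂ) 2) :
    inner ℝ (multiplier (fun j => (m j : ℂ)) B hB u) v =
      inner ℝ u (multiplier (fun j => (m j : ℂ)) B hB v) := by
  rw [lp.inner_eq_tsum, lp.inner_eq_tsum]
  refine tsum_congr fun j => ?_
  rw [multiplier_apply, multiplier_apply, ← Complex.real_smul, ← Complex.real_smul,
    real_inner_smul_left, real_inner_smul_right]

lemma norm_sq_multiplier_le_inner (m : I → ℝ) (B : ℝ) (hB : ∀ j, ‖(m j : ℂ)‖ ≤ B)
    {κ : ℝ} (hm : ∀ j, m j * m j ≤ κ * m j) (v : lp (fun _ : I => ℂ) 2) :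
    ‖multiplier (fun j => (m j : ℂ)) B hB v‖ ^ 2 ≤
      κ * inner ℝ v (multiplier (fun j => (m j : ℂ)) B hB v) := by
  rw [lp_two_norm_sq, ← (lp.hasSum_inner (𝕜 := ℝ) (G := fun _ : I => ℂ) v
    (multiplier (fun j => (m j : ℂ)) B hB v)).tsum_eq, ← tsum_mul_left]
  refine Summable.tsum_le_tsum (fun j => ?_) (lp_two_summable _)
    ((lp.summable_inner (𝕜 := ℝ) (G := fun _ : I => ℂ) v
      (multiplier (fun j => (m j : ℂ)) B hB v)).mul_left κ)
  rw [multiplier_apply, ← Complex.real_smul, real_inner_smul_right, real_inner_self_eq_norm_sq,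
    norm_smul, mul_pow, Real.norm_eq_abs, sq_abs]
  have := mul_le_mul_of_nonneg_right (hm j) (sq_nonneg ‖v j‖)
  nlinarith

lemma inner_multiplier_nonpos (m : I → ℝ) (B : ℝ) (hB : ∀ j, ‖(m j : ℂ)‖ ≤ B)
    (hm : ∀ j, m j ≤ 0) (v : lp (fun _ : I => ℂ) 2) :
    inner ℝ v (multiplier (fun j => (m j : ℂ)) B hB v) ≤ 0 := by
  rw [lp.inner_eq_tsum]
  refine tsum_nonpos fun j => ?_
  rw [multiplier_apply, ← Complex.real_smul, real_inner_smul_right, real_inner_self_eq_norm_sq]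
  exact mul_nonpos_of_nonpos_of_nonneg (hm j) (sq_nonneg _)

lemma inner_multiplier_unit (m : I → ℂ) (B : ℝ) (hB : ∀ j, ‖m j‖ ≤ B) (hm : ∀ j, ‖m j‖ = 1)
    (u v : lp (fun _ : I => ℂ) 2) :
    inner ℝ (multiplier m B hB u) (multiplier m B hB v) = inner ℝ u v := by
  rw [lp.inner_eq_tsum, lp.inner_eq_tsum]
  refine tsum_congr fun j => ?_
  rw [multiplier_apply, multiplier_apply]
  have h1 : m j * (starRingEnd ℂ) (m j) = 1 := by
    rw [Complex.mul_conj, Complex.normSq_eq_norm_sq]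
    simp [hm]
  rw [Complex.inner, Complex.inner, map_mul]
  congr 1
  linear_combination (v j * (starRingEnd ℂ) (u j)) * h1

/-- Restriction to finitely many coordinates. -/
def coordProj {J : Type*} [Fintype J] (s : J → I) :
    lp (fun _ : I => ℂ) 2 →L[ℝ] EuclideanSpace ℂ J :=
  ((PiLp.continuousLinearEquiv 2 ℝ (fun _ : J => ℂ)).symm : (J → ℂ) →L[ℝ] EuclideanSpace ℂ J).comp
    (ContinuousLinearMap.pi fun j => LinearMap.mkContinuous
      { toFun := fun v : lp (fun _ : I => ℂ) 2 => v (s j)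
        map_add' := fun u v => rfl
        map_smul' := fun c v => rfl } 1 (fun v => by
          rw [one_mul]; exact lp.norm_apply_le_norm (by norm_num) v (s j)))

@[simp] lemma coordProj_apply {J : Type*} [Fintype J] (s : J → I)
    (v : lp (fun _ : I => ℂ) 2) (j : J) : coordProj s v j = v (s j) := rfl

/-- Extension by zero of finitely many coordinates. -/
def coordIncl [DecidableEq I] {J : Type*} [Fintype J] (s : J → I) :
    EuclideanSpace ℂ J →L[ℝ] lp (fun _ : I => ℂ) 2 :=
  LinearMap.toContinuousLinearMap
    { toFun := fun y => ∑ j, lp.single (E := fun _ : I => ℂ) 2 (s j) (y j)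
      map_add' := fun x y => by
        rw [← Finset.sum_add_distrib]
        exact Finset.sum_congr rfl fun j _ => lp.single_add _ _ _ _
      map_smul' := fun c y => by
        rw [Finset.smul_sum]
        refine Finset.sum_congr rfl fun j _ => ?_
        exact lp.single_smul (𝕜 := ℝ) (E := fun _ : I => ℂ) 2 (s j) c (y j) }

lemma coordIncl_apply [DecidableEq I] {J : Type*} [Fintype J] (s : J → I)
    (y : EuclideanSpace ℂ J) :
    coordIncl s y = ∑ j, lp.single (E := fun _ : I => ℂ) 2 (s j) (y j) := rfl

lemma coordIncl_apply_of_mem [DecidableEq I] {J : Type*} [Fintype J] {s : J → I}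
    (hs : Function.Injective s) (y : EuclideanSpace ℂ J) (j : J) :
    coordIncl s y (s j) = y j := by
  classical
  rw [coordIncl_apply, lp.coeFn_sum, Finset.sum_apply, Finset.sum_eq_single j]
  · exact lp.single_apply_self (E := fun _ : I => ℂ) 2 (s j) (y j)
  · intro b _ hb
    exact lp.single_apply_ne (E := fun _ : I => ℂ) 2 (s b) (y b) fun h => hb (hs h.symm)
  · simp

lemma coordIncl_apply_of_notMem [DecidableEq I] {J : Type*} [Fintype J] {s : J → I}
    (y : EuclideanSpace ℂ J) {i : I} (hi : i ∉ range s) : coordIncl s y i = 0 := by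
  rw [coordIncl_apply, lp.coeFn_sum, Finset.sum_apply]
  exact Finset.sum_eq_zero fun b _ => lp.single_apply_ne (E := fun _ : I => ℂ) 2 (s b) (y b)
    fun h => hi ⟨b, h.symm⟩

lemma inner_coordIncl [DecidableEq I] {J : Type*} [Fintype J] (s : J → I)
    (y : EuclideanSpace ℂ J) (v : lp (fun _ : I => ℂ) 2) :
    inner ℝ (coordIncl s y) v = inner ℝ y (coordProj s v) := by
  rw [coordIncl_apply, sum_inner, PiLp.inner_apply]
  refine Finset.sum_congr rfl fun j _ => ?_
  rw [lp.inner_single_left]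
  rfl

end Multiplier

section Fourier

variable (n p : ℕ)

/-- The Fourier modes of frequency at most `p`. -/
abbrev LowMode : Type := Finset.Icc (-(p : ℤ)) p × Fin n

/-- The index of a low mode among all modes. -/
def LowMode.mode (j : LowMode n p) : ℤ × Fin n := (j.1, j.2)

variable {n p} in
lemma LowMode.mode_injective : Function.Injective (LowMode.mode n p) := by
  rintro ⟨⟨a, ha⟩, b⟩ ⟨⟨c, hc⟩, d⟩ h
  simp only [LowMode.mode, Prod.mk.injEq] at h
  obtain ⟨rfl, rfl⟩ := h
  rfl

variable {n p} in
lemma LowMode.mem_range_mode {j : ℤ × Fin n} : j ∈ range (LowMode.mode n p) ↔ |j.1| ≤ p := by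
  rw [abs_le]
  constructor
  · rintro ⟨⟨⟨a, ha⟩, b⟩, rfl⟩
    exact Finset.mem_Icc.1 ha
  · intro h
    exact ⟨(⟨j.1, Finset.mem_Icc.2 h⟩, j.2), rfl⟩

/-- The symbol of the inverse of `-i d/dt` on frequencies above `p`. -/
def highSymbol (j : ℤ × Fin n) : ℝ := if |j.1| ≤ p then 0 else 1 / (2 * π * j.1)

variable {n p}

lemma highSymbol_abs_le (hp : 0 < p) (j : ℤ × Fin n) : |highSymbol n p j| ≤ 1 / (2 * π * p) := by
  unfold highSymbol
  split_ifs with h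
  · rw [abs_zero]; positivity
  · have h1 : (p:ℝ) ≤ |(j.1 : ℝ)| := by
      rw [← Int.cast_abs]; exact_mod_cast (not_le.1 h).le
    have h2 : (0:ℝ) < p := by exact_mod_cast hp
    rw [abs_div, abs_one, abs_mul, abs_of_pos (by positivity : (0:ℝ) < 2 * π)]
    gcongr

lemma highSymbol_mul_self_le (hp : 0 < p) (j : ℤ × Fin n) :
    max (highSymbol n p j) 0 * max (highSymbol n p j) 0 ≤
      1 / (2 * π * p) * max (highSymbol n p j) 0 := by
  gcongr
  exact max_le ((le_abs_self _).trans (highSymbol_abs_le hp j)) (by positivity)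

/-- The splitting of `ℓ²` into frequencies at most `p` and above `p`. -/
def fourierSplitting (hp : 0 < p) :
    ModeSplitting (LowMode n p) (lp (fun _ : ℤ × Fin n => ℂ) 2) where
  incl := coordIncl (LowMode.mode n p)
  proj := coordProj (LowMode.mode n p)
  K := multiplier (fun j => (highSymbol n p j : ℂ)) (1 / (2 * π * p)) (fun j => by
    rw [Complex.norm_real]; exact highSymbol_abs_le hp j)
  Kp := multiplier (fun j => ((max (highSymbol n p j) 0 : ℝ) : ℂ)) (1 / (2 * π * p)) (fun j => by
    rw [Complex.norm_real, Real.norm_eq_abs, abs_of_nonneg (le_max_right _ _)]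
    exact max_le ((le_abs_self _).trans (highSymbol_abs_le hp j)) (by positivity))
  Kn := multiplier (fun j => ((min (highSymbol n p j) 0 : ℝ) : ℂ)) (1 / (2 * π * p)) (fun j => by
    rw [Complex.norm_real, Real.norm_eq_abs, abs_of_nonpos (min_le_right _ _), neg_le]
    exact le_min (neg_le_of_abs_le (highSymbol_abs_le hp j)) (neg_nonpos.2 (by positivity)))
  κ := 1 / (2 * π * p)
  weight := fun j => j.1
  act := fun ζ => if hζ : ‖ζ‖ = 1 then
    (multiplier (fun j => ζ ^ j.1) 1 (fun j => by simp [hζ])).toLinearMap else 0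
  inner_incl := fun y v => inner_coordIncl _ y v
  proj_incl := fun y => by
    ext j; exact coordIncl_apply_of_mem LowMode.mode_injective y j
  K_eq := fun v => by
    ext j
    change _ * v j = _ * v j + _ * v j
    rw [← add_mul, ← Complex.ofReal_add, max_add_min, add_zero]
  inner_K := inner_multiplier_real_comm _ _ _
  norm_K := fun v => norm_multiplier_le _ _ (by positivity) v
  proj_K := fun v => by
    ext j
    rw [coordProj_apply, multiplier_apply, highSymbol,
      if_pos (LowMode.mem_range_mode.1 (mem_range_self j))]
    simp
  norm_Kp := norm_sq_multiplier_le_inner _ _ _ (highSymbol_mul_self_le hp)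
  inner_Kn := inner_multiplier_nonpos _ _ _ fun _ => min_le_right _ _
  act_incl := fun ζ y hζ => by
    simp only [dif_pos hζ]
    ext j
    change ζ ^ j.1 * coordIncl (LowMode.mode n p) y j = _
    by_cases hj : j ∈ range (LowMode.mode n p)
    · obtain ⟨i, rfl⟩ := hj
      rw [coordIncl_apply_of_mem LowMode.mode_injective,
        coordIncl_apply_of_mem LowMode.mode_injective, rotate_apply]
      rfl
    · rw [coordIncl_apply_of_notMem _ hj, coordIncl_apply_of_notMem _ hj, mul_zero]
  proj_act := fun ζ v hζ => by
    simp only [dif_pos hζ]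
    ext j
    rfl
  act_K := fun ζ v hζ => by
    simp only [dif_pos hζ]
    ext j
    exact mul_left_comm _ _ _
  inner_act := fun ζ u v hζ => by
    simp only [dif_pos hζ]
    exact inner_multiplier_unit _ _ _ (fun j => by simp [hζ]) u v

end Fourier

section Nemytskii

variable {E : Type*} [NormedAddCommGroup E] [InnerProductSpace ℝ E] [FiniteDimensional ℝ E]
  {α : Type*} [MeasurableSpace α] {μ : Measure α}
  {H : E → ℝ} {X : E → E} {C : ℝ}

lemma L2_norm_sq_eq_integral (f : Lp E 2 μ) : ‖f‖ ^ 2 = ∫ t, ‖f t‖ ^ 2 ∂μ := by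
  rw [← real_inner_self_eq_norm_sq, L2.inner_def]
  simp only [real_inner_self_eq_norm_sq]

lemma L2_integrable_norm_sq (f : Lp E 2 μ) : Integrable (fun t => ‖f t‖ ^ 2) μ := by
  have := L2.integrable_inner (𝕜 := ℝ) f f
  simpa only [real_inner_self_eq_norm_sq] using this

lemma IsQuadGradient.continuous (h : IsQuadGradient H X C) : Continuous H :=
  continuous_iff_continuousAt.2 fun x => (h.hasFDerivAt x).continuousAt

lemma IsQuadGradient.integrable_comp (h : IsQuadGradient H X C) (hX0 : X 0 = 0) (hH0 : H 0 = 0)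
    (f : Lp E 2 μ) : Integrable (fun t => H (f t)) μ := by
  refine ((L2_integrable_norm_sq f).const_mul C).mono'
    (h.continuous.comp_aestronglyMeasurable (Lp.aestronglyMeasurable f))
    (Filter.Eventually.of_forall fun t => ?_)
  have := h 0 (f t)
  rwa [hX0, hH0, inner_zero_left, sub_zero, sub_zero, sub_zero] at this

/-- The integral functional of a function with quadratic first order expansions has quadratic
first order expansions. -/
lemma IsQuadGradient.integral {K : NNReal} (h : IsQuadGradient H X C) (hX : LipschitzWith K X)
    (hX0 : X 0 = 0) (hH0 : H 0 = 0) :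
    IsQuadGradient (fun f : Lp E 2 μ => ∫ t, H (f t) ∂μ) (fun f => hX.compLp hX0 f) C := by
  intro f g
  have e1 : inner ℝ (hX.compLp hX0 f) (g - f) = ∫ t, inner ℝ (X (f t)) (g t - f t) ∂μ := by
    rw [L2.inner_def]
    refine integral_congr_ae ?_
    filter_upwards [hX.coeFn_compLp hX0 f, Lp.coeFn_sub g f] with t h1 h2
    rw [h1, h2]; rfl
  have i1 : Integrable (fun t => inner ℝ (X (f t)) (g t - f t)) μ := by
    refine (L2.integrable_inner (𝕜 := ℝ) (hX.compLp hX0 f) (g - f)).congr ?_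
    filter_upwards [hX.coeFn_compLp hX0 f, Lp.coeFn_sub g f] with t h1 h2
    rw [h1, h2]; rfl
  have e2 : ‖g - f‖ ^ 2 = ∫ t, ‖g t - f t‖ ^ 2 ∂μ := by
    rw [L2_norm_sq_eq_integral]
    refine integral_congr_ae ?_
    filter_upwards [Lp.coeFn_sub g f] with t h2
    rw [h2]; rfl
  have i2 : Integrable (fun t => ‖g t - f t‖ ^ 2) μ := by
    refine (L2_integrable_norm_sq (g - f)).congr ?_
    filter_upwards [Lp.coeFn_sub g f] with t h2
    rw [h2]; rfl
  have ig := h.integrable_comp hX0 hH0 g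
  have jf := h.integrable_comp hX0 hH0 f
  have i3 : Integrable (fun t => H (g t) - H (f t)) μ := ig.sub jf
  dsimp only
  rw [e1, e2, ← integral_sub ig jf, ← integral_sub i3 i1, ← integral_const_mul]
  refine norm_integral_le_of_norm_le (i2.const_mul C)
    (f := fun t => H (g t) - H (f t) - inner ℝ (X (f t)) (g t - f t))
    (Filter.Eventually.of_forall fun t => h (f t) (g t))

end Nemytskii

section FourierBasis

open AddCircle

variable {n : ℕ}

/-- Square integrable loops in `ℂⁿ`. -/
abbrev LoopL2 (n : ℕ) : Type :=
  Lp (EuclideanSpace ℂ (Fin n)) 2 (haarAddCircle (T := (1 : ℝ)))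

/-- Continuous loops in `ℂⁿ`. -/
abbrev ContLoop (n : ℕ) : Type := C(AddCircle (1 : ℝ), EuclideanSpace ℂ (Fin n))

/-- The loop `t ↦ e^{2πilt} e_i`. -/
def modeLoop (j : ℤ × Fin n) : ContLoop n where
  toFun t := fourier j.1 t • EuclideanSpace.single j.2 (1 : ℂ)
  continuous_toFun := by fun_prop

lemma modeLoop_apply (j : ℤ × Fin n) (t : AddCircle (1 : ℝ)) :
    modeLoop j t = fourier j.1 t • EuclideanSpace.single j.2 (1 : ℂ) := rfl

lemma norm_fourier_apply (l : ℤ) (t : AddCircle (1 : ℝ)) : ‖fourier l t‖ = 1 := by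
  rw [fourier_apply]; exact Circle.norm_coe _

lemma norm_modeLoop_apply (j : ℤ × Fin n) (t : AddCircle (1 : ℝ)) : ‖modeLoop j t‖ = 1 := by
  rw [modeLoop_apply, norm_smul, norm_fourier_apply]; simp

/-- The square integrable class of a continuous loop. -/
def ContLoop.toL2 : ContLoop n →L[ℂ] LoopL2 n := ContinuousMap.toLp 2 haarAddCircle ℂ

lemma ContLoop.coeFn_toL2 (f : ContLoop n) : f.toL2 =ᵐ[haarAddCircle] f :=
  ContinuousMap.coeFn_toLp _ f

lemma inner_modeLoop (j : ℤ × Fin n) (f : LoopL2 n) :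
    inner ℂ (ContLoop.toL2 (modeLoop j)) f = fourierCoeff (fun t => f t j.2) j.1 := by
  rw [L2.inner_def, fourierCoeff]
  refine integral_congr_ae ?_
  filter_upwards [ContLoop.coeFn_toL2 (modeLoop j)] with t ht
  rw [ht, modeLoop_apply, inner_smul_left, EuclideanSpace.inner_single_left, fourier_neg]
  simp

/-- The components of a square integrable loop. -/
def component (i : Fin n) (f : LoopL2 n) : Lp ℂ 2 (haarAddCircle (T := (1 : ℝ))) :=
  (EuclideanSpace.proj (𝕜 := ℂ) i).compLp f

lemma coeFn_component (i : Fin n) (f : LoopL2 n) :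
    component i f =ᵐ[haarAddCircle] fun t => f t i :=
  ContinuousLinearMap.coeFn_compLp' _ f

lemma fourierCoeff_component (i : Fin n) (f : LoopL2 n) (l : ℤ) :
    fourierCoeff (component i f) l = fourierCoeff (fun t => f t i) l :=
  congr_fun (fourierCoeff_congr_ae (coeFn_component i f)) l

lemma loop_eq_zero_of_fourierCoeff {f : LoopL2 n}
    (h : ∀ j : ℤ × Fin n, fourierCoeff (fun t => f t j.2) j.1 = 0) : f = 0 := by
  have h1 : ∀ i, component i f = 0 := by
    intro i
    refine fourierBasis.repr.injective ?_
    ext l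
    rw [fourierBasis_repr, fourierCoeff_component, h (l, i), map_zero]
    rfl
  refine (Lp.eq_zero_iff_ae_eq_zero).2 ?_
  have h2 : ∀ᵐ t ∂(haarAddCircle (T := (1 : ℝ))), ∀ i, f t i = 0 := by
    refine ae_all_iff.2 fun i => ?_
    have h3 := coeFn_component i f
    rw [h1 i] at h3
    filter_upwards [h3, Lp.coeFn_zero ℂ 2 (haarAddCircle (T := (1 : ℝ)))] with t h4 h5
    rw [← h4, h5]; rfl
  filter_upwards [h2] with t ht
  ext i
  exact ht i

lemma orthonormal_modeLoop : Orthonormal ℂ fun j : ℤ × Fin n => ContLoop.toL2 (modeLoop j) := by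
  classical
  rw [orthonormal_iff_ite]
  rintro ⟨l, i⟩ ⟨l', i'⟩
  rw [inner_modeLoop]
  have h1 : fourierCoeff (fun t => ContLoop.toL2 (modeLoop (l', i')) t i) l =
      fourierCoeff (T := (1:ℝ)) (fun t => (if i = i' then (1:ℂ) else 0) * fourier l' t) l := by
    refine congr_fun (fourierCoeff_congr_ae ?_) l
    filter_upwards [ContLoop.coeFn_toL2 (modeLoop (l', i'))] with t ht
    rw [ht, modeLoop_apply]
    by_cases h : i = i' <;> simp [h]
  dsimp only
  rw [h1, fourierCoeff.const_mul, fourierCoeff_fourier]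
  by_cases h : i = i' <;> by_cases h' : l = l' <;> simp [h, h']

/-- The Hilbert basis of Fourier modes. -/
def modeBasis (n : ℕ) : HilbertBasis (ℤ × Fin n) ℂ (LoopL2 n) :=
  HilbertBasis.mkOfOrthogonalEqBot orthonormal_modeLoop <| by
    rw [Submodule.eq_bot_iff]
    intro f hf
    refine loop_eq_zero_of_fourierCoeff fun j => ?_
    rw [← inner_modeLoop]
    exact (Submodule.mem_orthogonal _ f).1 hf _ (Submodule.subset_span ⟨j, rfl⟩)

lemma modeBasis_apply (j : ℤ × Fin n) : modeBasis n j = ContLoop.toL2 (modeLoop j) :=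
  congr_fun (HilbertBasis.coe_mkOfOrthogonalEqBot _ _) j

lemma modeBasis_repr (f : LoopL2 n) (j : ℤ × Fin n) :
    (modeBasis n).repr f j = fourierCoeff (fun t => f t j.2) j.1 := by
  rw [HilbertBasis.repr_apply_apply, modeBasis_apply, inner_modeLoop]

/-- The loop with given Fourier coefficients, as a real linear isometry. -/
def ofCoeff (n : ℕ) : lp (fun _ : ℤ × Fin n => ℂ) 2 ≃ₗᵢ[ℝ] LoopL2 n where
  toLinearEquiv := (modeBasis n).repr.symm.toLinearEquiv.restrictScalars ℝ
  norm_map' := (modeBasis n).repr.symm.norm_map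

lemma ofCoeff_symm_apply (f : LoopL2 n) (j : ℤ × Fin n) :
    (ofCoeff n).symm f j = fourierCoeff (fun t => f t j.2) j.1 :=
  modeBasis_repr f j

lemma hasSum_ofCoeff (v : lp (fun _ : ℤ × Fin n => ℂ) 2) :
    HasSum (fun j => v j • ContLoop.toL2 (modeLoop j)) (ofCoeff n v) := by
  have := (modeBasis n).hasSum_repr_symm v
  simp only [modeBasis_apply] at this
  exact this

/-- Time translation of square integrable loops. -/
def loopShift (s : AddCircle (1 : ℝ)) : LoopL2 n →+ LoopL2 n :=
  Lp.compMeasurePreserving (fun t => t + s) (measurePreserving_add_right haarAddCircle s)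

lemma coeFn_loopShift (s : AddCircle (1 : ℝ)) (f : LoopL2 n) :
    loopShift s f =ᵐ[haarAddCircle] fun t => f (t + s) :=
  Lp.coeFn_compMeasurePreserving _ _

lemma fourierCoeff_shift (g : AddCircle (1 : ℝ) → ℂ) (s : AddCircle (1 : ℝ)) (l : ℤ) :
    fourierCoeff (fun t => g (t + s)) l = fourier l s * fourierCoeff g l := by
  rw [fourierCoeff, fourierCoeff,
    ← integral_add_right_eq_self (fun t => fourier (-l) t • g t) s, ← integral_const_mul]
  refine integral_congr_ae (Filter.Eventually.of_forall fun t => ?_)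
  have h1 : fourier l s * fourier (-l) s = 1 := by
    rw [← fourier_add, add_neg_cancel, fourier_zero]
  have h2 : fourier (-l) (t + s) = fourier (-l) t * fourier (-l) s := by
    simp only [fourier_apply, smul_add, toCircle_add, Circle.coe_mul]
  simp only [smul_eq_mul]
  rw [h2]
  linear_combination -(fourier (-l) t * g (t + s)) * h1

lemma ofCoeff_symm_loopShift (s : AddCircle (1 : ℝ)) (f : LoopL2 n) (j : ℤ × Fin n) :
    (ofCoeff n).symm (loopShift s f) j = fourier 1 s ^ j.1 * (ofCoeff n).symm f j := by
  rw [ofCoeff_symm_apply, ofCoeff_symm_apply]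
  have h1 : fourierCoeff (fun t => loopShift s f t j.2) j.1 =
      fourierCoeff (fun t => f (t + s) j.2) j.1 := by
    refine congr_fun (fourierCoeff_congr_ae ?_) _
    filter_upwards [coeFn_loopShift s f] with t ht
    rw [ht]
  rw [h1, fourierCoeff_shift (fun t => f t j.2), fourier_one, fourier_apply, toCircle_zsmul]
  simp

lemma exists_fourier_one_eq {ζ : ℂ} (h : ‖ζ‖ = 1) : ∃ s : AddCircle (1 : ℝ), fourier 1 s = ζ := by
  obtain ⟨s, hs⟩ := (homeomorphCircle (T := (1 : ℝ)) one_ne_zero).surjective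
    ⟨ζ, by simpa [Submonoid.unitSphere] using h⟩
  refine ⟨s, ?_⟩
  rw [fourier_one]
  rw [homeomorphCircle_apply] at hs
  rw [hs]

end FourierBasis

section Regularity

open AddCircle

/-- A continuous loop whose Fourier coefficients satisfy `2πl f̂(l) = ĝ(l)` has derivative `ig`. -/
lemma hasDerivAt_of_fourierCoeff {f g : C(AddCircle (1 : ℝ), ℂ)}
    (h : ∀ l : ℤ, ((2 * π * l : ℝ) : ℂ) * fourierCoeff f l = fourierCoeff g l) (t : ℝ) :
    HasDerivAt (fun t : ℝ => f t) (Complex.I * g t) t := by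
  have hgc : Continuous fun t : ℝ => g t := g.continuous.comp (AddCircle.continuous_mk' 1)
  have hfc : Continuous fun t : ℝ => f t := f.continuous.comp (AddCircle.continuous_mk' 1)
  have coeff : ∀ (u : AddCircle (1 : ℝ) → ℂ) (l : ℤ),
      fourierCoeff u l = ∫ t in (0:ℝ)..1, fourier (-l) (t : AddCircle (1:ℝ)) * u t := by
    intro u l
    rw [fourierCoeff_eq_intervalIntegral u l 0]
    simp
  let G : ℝ → ℂ := fun t => ∫ s in (0:ℝ)..t, g s
  have hG : ∀ t : ℝ, HasDerivAt G (g t) t := fun t =>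
    intervalIntegral.integral_hasDerivAt_right (hgc.intervalIntegrable _ _)
      (hgc.stronglyMeasurableAtFilter _ _) hgc.continuousAt
  have hg0 : ∫ s in (0:ℝ)..1, g s = 0 := by
    have h1 := h 0
    rw [coeff g] at h1
    simpa using h1.symm
  have hper : Function.Periodic G 1 := by
    intro t
    have hp : Function.Periodic (fun t : ℝ => g t) 1 := fun t => by
      simp
    have h1 := hp.intervalIntegral_add_eq 0 t
    rw [zero_add, hg0] at h1
    change (∫ s in (0:ℝ)..(t+1), g s) = ∫ s in (0:ℝ)..t, g s
    rw [← intervalIntegral.integral_add_adjacent_intervals (hgc.intervalIntegrable 0 t)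
      (hgc.intervalIntegrable t (t+1)), ← h1, add_zero]
  have hGc : Continuous G := continuous_iff_continuousAt.2 fun t => (hG t).continuousAt
  let Gc : C(AddCircle (1 : ℝ), ℂ) := ⟨hper.lift, hGc.quotient_lift _⟩
  have hGt : ∀ t : ℝ, Gc t = G t := fun t => hper.lift_coe t
  have hGl : ∀ l : ℤ, 2 * π * Complex.I * l * fourierCoeff Gc l = fourierCoeff g l := by
    intro l
    rw [coeff Gc, coeff g]
    have hd : ∀ t : ℝ, HasDerivAt (fun t : ℝ => fourier (-l) (t : AddCircle (1:ℝ)) * Gc t)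
        (fourier (-l) (t : AddCircle (1:ℝ)) * g t
          - 2 * π * Complex.I * l * (fourier (-l) (t : AddCircle (1:ℝ)) * Gc t)) t := by
      intro t
      simp only [hGt]
      refine ((hasDerivAt_fourier_neg 1 l t).mul (hG t)).congr_deriv ?_
      push_cast
      ring
    have hcm : ∀ u : C(AddCircle (1 : ℝ), ℂ),
        Continuous fun t : ℝ => fourier (-l) (t : AddCircle (1:ℝ)) * u t := fun u =>
      ((fourier (-l) * u).continuous.comp (AddCircle.continuous_mk' 1))
    have h1 := intervalIntegral.integral_eq_sub_of_hasDerivAt (a := 0) (b := 1) (fun t _ => hd t)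
      (((hcm g).sub ((hcm Gc).const_mul _)).intervalIntegrable _ _)
    rw [intervalIntegral.integral_sub ((hcm g).intervalIntegrable _ _)
      (((hcm Gc).const_mul _).intervalIntegrable _ _), intervalIntegral.integral_const_mul] at h1
    have h2 : ((1:ℝ) : AddCircle (1:ℝ)) = ((0:ℝ) : AddCircle (1:ℝ)) := by
      simp [AddCircle.coe_period]
    rw [h2, sub_self, sub_eq_zero] at h1
    exact h1.symm
  let D : C(AddCircle (1 : ℝ), ℂ) := f - Complex.I • Gc
  have hD : ∀ l ≠ 0, fourierCoeff D l = 0 := by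
    intro l hl
    have h1 : fourierCoeff D l = fourierCoeff f l - Complex.I * fourierCoeff Gc l := by
      have e : (D : AddCircle (1:ℝ) → ℂ) = (f : AddCircle (1:ℝ) → ℂ) +
          (fun t => (-Complex.I) * Gc t) := by
        ext t; simp [D, sub_eq_add_neg]
      have hi : Integrable (fun t => (-Complex.I) * Gc t) (haarAddCircle (T := (1 : ℝ))) :=
        (continuous_const.mul Gc.continuous).integrable_of_hasCompactSupport
          (HasCompactSupport.of_compactSpace _)
      rw [e, fourierCoeff.add (f.continuous.integrable_of_hasCompactSupport
          (HasCompactSupport.of_compactSpace _)) hi, Pi.add_apply, fourierCoeff.const_mul]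
      ring
    have h2 : (2 * π * l : ℂ) ≠ 0 := by
      simp [Real.pi_ne_zero, hl]
    have h3 := h l
    have h4 := hGl l
    push_cast at h3
    rw [h1]
    refine (mul_eq_zero.1 ?_).resolve_left h2
    linear_combination h3 - h4
  have hs : Summable (fourierCoeff D) := summable_of_ne_finset_zero (s := {0}) fun l hl =>
    hD l (by simpa using hl)
  have hconst : ∀ t, D t = fourierCoeff D 0 := by
    intro t
    have h1 := has_pointwise_sum_fourier_series_of_summable hs t
    have h2 := hasSum_single (f := fun i => fourierCoeff D i • fourier i t) 0 (fun l hl => by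
      rw [hD l hl, zero_smul])
    rw [h1.unique h2]
    simp
  have hf : (fun t : ℝ => f t) = fun t : ℝ => fourierCoeff D 0 + Complex.I * G t := by
    funext t
    rw [← hconst t, ← hGt]
    simp [D]
  rw [hf]
  simpa using ((hG t).const_mul Complex.I).const_add (fourierCoeff D 0)

variable {n : ℕ}

lemma exists_contLoop_of_coeff {x y : lp (fun _ : ℤ × Fin n => ℂ) 2}
    (h : ∀ j, ((2 * π * j.1 : ℝ) : ℂ) * x j = y j) : ∃ F : ContLoop n, F.toL2 = ofCoeff n x := by
  have hs2 : Summable fun j : ℤ × Fin n => 1 / (j.1 : ℝ) ^ 2 := by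
    refine (summable_prod_of_nonneg fun _ => by positivity).2 ⟨fun l => .of_finite, ?_⟩
    simp only [tsum_fintype, Finset.sum_const, nsmul_eq_mul]
    exact (Real.summable_one_div_int_pow.2 one_lt_two).mul_left _
  have hs0 : Summable fun j : ℤ × Fin n => if j.1 = 0 then ‖x j‖ else 0 := by
    refine summable_of_hasFiniteSupport (((Set.finite_singleton (0:ℤ)).prod
      (Set.finite_univ (α := Fin n))).subset fun j hj => ?_)
    refine ⟨?_, mem_univ _⟩
    by_contra h0
    exact hj (if_neg h0)
  have hs : Summable fun j => ‖x j‖ := by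
    refine Summable.of_nonneg_of_le (fun _ => norm_nonneg _) (fun j => ?_)
      ((hs0.add hs2).add (lp_two_summable y))
    by_cases h0 : j.1 = 0
    · rw [if_pos h0]
      have : 0 ≤ 1 / (j.1 : ℝ) ^ 2 := by positivity
      nlinarith [sq_nonneg ‖y j‖]
    · rw [if_neg h0, zero_add, ← h j, norm_mul, Complex.norm_real, Real.norm_eq_abs, mul_pow,
        sq_abs]
      have hl : (0:ℝ) < (j.1 : ℝ) ^ 2 := by positivity
      have hpi : 1 ≤ π ^ 2 := by nlinarith [Real.pi_gt_three]
      have h1 : 2 * ‖x j‖ ≤ 1 / (j.1 : ℝ) ^ 2 + (j.1 : ℝ) ^ 2 * ‖x j‖ ^ 2 := by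
        have h2 : 1 / (j.1 : ℝ) ^ 2 = (1 / (j.1 : ℝ)) ^ 2 := by ring
        have h3 : (1 / (j.1 : ℝ)) * (j.1 : ℝ) = 1 := by
          field_simp
        rw [h2]
        have h5 := sq_nonneg (1 / (j.1 : ℝ) - (j.1 : ℝ) * ‖x j‖)
        have h6 : (1 / (j.1 : ℝ) - (j.1 : ℝ) * ‖x j‖) ^ 2 = (1 / (j.1 : ℝ)) ^ 2
          - 2 * (1 / (j.1 : ℝ) * (j.1 : ℝ)) * ‖x j‖ + (j.1 : ℝ) ^ 2 * ‖x j‖ ^ 2 := by ring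
        rw [h3] at h6
        linarith
      have h4 : (j.1 : ℝ) ^ 2 * ‖x j‖ ^ 2 ≤ (2 * π * j.1) ^ 2 * ‖x j‖ ^ 2 := by
        gcongr ?_ * _
        nlinarith
      linarith [norm_nonneg (x j)]
  have hm : Summable fun j => x j • modeLoop j := by
    refine Summable.of_norm_bounded hs fun j => ?_
    rw [norm_smul]
    refine mul_le_of_le_one_right (norm_nonneg _) ?_
    exact (ContinuousMap.norm_le _ zero_le_one).2 fun t => (norm_modeLoop_apply j t).le
  refine ⟨∑' j, x j • modeLoop j, ?_⟩
  have h1 := ContLoop.toL2.hasSum hm.hasSum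
  simp only [map_smul] at h1
  exact h1.unique (hasSum_ofCoeff x)

lemma hasDerivAt_euclidean_of_components {F : ℝ → EuclideanSpace ℂ (Fin n)}
    {F' : EuclideanSpace ℂ (Fin n)} {t : ℝ} (h : ∀ i, HasDerivAt (fun t => F t i) (F' i) t) :
    HasDerivAt F F' t := by
  have h1 : HasDerivAt (fun t => (PiLp.continuousLinearEquiv 2 ℝ fun _ : Fin n => ℂ) (F t))
      ((PiLp.continuousLinearEquiv 2 ℝ fun _ : Fin n => ℂ) F') t := hasDerivAt_pi.2 h
  exact ((PiLp.continuousLinearEquiv 2 ℝ fun _ : Fin n => ℂ).symm.hasFDerivAt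
    (x := (PiLp.continuousLinearEquiv 2 ℝ fun _ : Fin n => ℂ) (F t))).comp_hasDerivAt t h1

lemma exists_solution_of_coeff {X : EuclideanSpace ℂ (Fin n) → EuclideanSpace ℂ (Fin n)}
    {K : NNReal} (hX : LipschitzWith K X) (hX0 : X 0 = 0) {x : lp (fun _ : ℤ × Fin n => ℂ) 2}
    (h : ∀ j, ((2 * π * j.1 : ℝ) : ℂ) * x j =
      (ofCoeff n).symm (hX.compLp hX0 (ofCoeff n x)) j) :
    ∃ F : ContLoop n, F.toL2 = ofCoeff n x ∧
      ∀ t : ℝ, HasDerivAt (fun t : ℝ => F t) (Complex.I • X (F t)) t := by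
  obtain ⟨F, hF⟩ := exists_contLoop_of_coeff h
  refine ⟨F, hF, fun t => ?_⟩
  refine hasDerivAt_euclidean_of_components fun i => ?_
  let f : C(AddCircle (1 : ℝ), ℂ) := ⟨fun t => F t i, by fun_prop⟩
  let g : C(AddCircle (1 : ℝ), ℂ) := ⟨fun t => X (F t) i, by
    have := hX.continuous.comp F.continuous
    exact (EuclideanSpace.proj (𝕜 := ℂ) i).continuous.comp this⟩
  have hFae : F =ᵐ[haarAddCircle] ofCoeff n x := hF ▸ (ContLoop.coeFn_toL2 F).symm
  have hfx : ∀ l, fourierCoeff f l = x (l, i) := by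
    intro l
    rw [← (ofCoeff n).symm_apply_apply x, ofCoeff_symm_apply]
    refine congr_fun (fourierCoeff_congr_ae ?_) _
    filter_upwards [hFae] with t ht
    rw [← ht]; rfl
  have hgx : ∀ l, fourierCoeff g l =
      (ofCoeff n).symm (hX.compLp hX0 (ofCoeff n x)) (l, i) := by
    intro l
    rw [ofCoeff_symm_apply]
    refine congr_fun (fourierCoeff_congr_ae ?_) _
    filter_upwards [hFae, hX.coeFn_compLp hX0 (ofCoeff n x)] with t ht ht'
    rw [ht', Function.comp_apply, ← ht]; rfl
  exact hasDerivAt_of_fourierCoeff (f := f) (g := g) (fun l => by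
    rw [hfx, hgx]; exact h (l, i)) t

end Regularity

section Solutions

open AddCircle

variable {n : ℕ}

lemma ModeSplitting.norm_proj_le {J 𝓗 : Type*} [Fintype J] [NormedAddCommGroup 𝓗]
    [InnerProductSpace ℝ 𝓗] [CompleteSpace 𝓗] (S : ModeSplitting J 𝓗) (v : 𝓗) :
    ‖S.proj v‖ ≤ ‖v‖ := by
  classical
  have h1 := S.inner_incl (S.proj v) v
  rw [real_inner_self_eq_norm_sq] at h1
  have h2 := real_inner_le_norm (S.incl (S.proj v)) v
  rw [h1, S.norm_incl] at h2
  rcases (norm_nonneg (S.proj v)).eq_or_lt with h3 | h3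
  · rw [← h3]; exact norm_nonneg v
  · nlinarith

lemma fourierSplitting_incl_add_Kn {p : ℕ} (hp : 0 < p) (y : EuclideanSpace ℂ (LowMode n p))
    (v : lp (fun _ : ℤ × Fin n => ℂ) 2) (j : LowMode n p) :
    ((fourierSplitting hp).incl y + (fourierSplitting hp).Kn v) (LowMode.mode n p j) = y j := by
  have h1 : (fourierSplitting hp).incl y (LowMode.mode n p j) = y j :=
    coordIncl_apply_of_mem LowMode.mode_injective y j
  have h2 : (fourierSplitting hp).Kn v (LowMode.mode n p j) = 0 := by
    change ((min (highSymbol n p _) 0 : ℝ) : ℂ) * _ = 0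
    rw [highSymbol, if_pos (LowMode.mem_range_mode.1 (mem_range_self j))]
    simp
  rw [lp.coeFn_add, Pi.add_apply, h1, h2, add_zero]

lemma fourierSplitting_act {p : ℕ} (hp : 0 < p) (s : AddCircle (1 : ℝ))
    (v : lp (fun _ : ℤ × Fin n => ℂ) 2) :
    (fourierSplitting hp).act (fourier 1 s) v =
      (ofCoeff n).symm (loopShift s (ofCoeff n v)) := by
  ext j
  rw [ofCoeff_symm_loopShift, (ofCoeff n).symm_apply_apply]
  simp only [fourierSplitting, dif_pos (norm_fourier_apply 1 s)]
  rfl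

lemma compLp_loopShift {X : EuclideanSpace ℂ (Fin n) → EuclideanSpace ℂ (Fin n)}
    {K : NNReal} (hX : LipschitzWith K X) (hX0 : X 0 = 0) (s : AddCircle (1 : ℝ))
    (f : LoopL2 n) : hX.compLp hX0 (loopShift s f) = loopShift s (hX.compLp hX0 f) := by
  refine Lp.ext ?_
  have h1 := (measurePreserving_add_right (haarAddCircle (T := (1:ℝ))) s).quasiMeasurePreserving.ae
    (hX.coeFn_compLp hX0 f)
  filter_upwards [hX.coeFn_compLp hX0 (loopShift s f), coeFn_loopShift s f,
    coeFn_loopShift s (hX.compLp hX0 f), h1] with t h2 h3 h4 h5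
  rw [h2, h4, h5, Function.comp_apply, h3]; rfl

lemma integral_comp_loopShift (H : EuclideanSpace ℂ (Fin n) → ℝ) (s : AddCircle (1 : ℝ))
    (f : LoopL2 n) :
    ∫ t, H (loopShift s f t) ∂haarAddCircle = ∫ t, H (f t) ∂haarAddCircle := by
  rw [← integral_add_right_eq_self (fun t => H (f t)) s]
  refine integral_congr_ae ?_
  filter_upwards [coeFn_loopShift s f] with t ht
  rw [ht]

lemma integral_haar_eq_intervalIntegral (u : AddCircle (1 : ℝ) → ℝ) :
    ∫ t, u t ∂haarAddCircle = ∫ t in (0:ℝ)..1, u t := by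
  rw [integral_haarAddCircle, ← AddCircle.intervalIntegral_preimage 1 0 u]
  simp

/-- Bessel's inequality for the components of a loop, summed with weights. -/
lemma sum_weight_le_integral {p : ℕ} {q : Fin n → ℝ} (hq : ∀ i, 0 < q i)
    (v : lp (fun _ : ℤ × Fin n => ℂ) 2) :
    ∑ j : LowMode n p, q j.2 * ‖v (LowMode.mode n p j)‖ ^ 2 ≤
      ∫ t, ∑ i, q i * ‖ofCoeff n v t i‖ ^ 2 ∂haarAddCircle := by
  have hc : ∀ i, (fun t => ‖component i (ofCoeff n v) t‖ ^ 2) =ᵐ[haarAddCircle]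
      fun t => ‖ofCoeff n v t i‖ ^ 2 := fun i => by
    filter_upwards [coeFn_component i (ofCoeff n v)] with t ht
    rw [ht]
  have hi : ∀ i, Integrable (fun t => ‖ofCoeff n v t i‖ ^ 2) (haarAddCircle (T := (1:ℝ))) :=
    fun i => (L2_integrable_norm_sq (component i (ofCoeff n v))).congr (hc i)
  rw [integral_finsetSum _ fun i _ => (hi i).const_mul _, Fintype.sum_prod_type,
    Finset.sum_comm]
  refine Finset.sum_le_sum fun i _ => ?_
  rw [integral_const_mul, ← integral_congr_ae (hc i)]
  change ∑ l : Finset.Icc (-(p : ℤ)) p, q i * ‖v ((l : ℤ), i)‖ ^ 2 ≤ _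
  rw [← Finset.mul_sum]
  refine mul_le_mul_of_nonneg_left ?_ (hq i).le
  have h1 := hasSum_sq_fourierCoeff (component i (ofCoeff n v))
  have h2 : ∀ l, fourierCoeff (component i (ofCoeff n v)) l = v (l, i) := fun l => by
    rw [fourierCoeff_component, ← ofCoeff_symm_apply (ofCoeff n v) (l, i),
      (ofCoeff n).symm_apply_apply]
  simp only [h2] at h1
  have h3 := sum_le_hasSum (Finset.Icc (-(p : ℤ)) p) (fun _ _ => by positivity) h1
  rw [← Finset.sum_coe_sort] at h3
  exact h3

lemma ofCoeff_single (j : ℤ × Fin n) (a : ℂ) :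
    ofCoeff n (lp.single (E := fun _ : ℤ × Fin n => ℂ) 2 j a) =
      a • ContLoop.toL2 (modeLoop j) := by
  refine (hasSum_ofCoeff _).unique ?_
  have h1 := hasSum_single (f := fun j' => (lp.single (E := fun _ : ℤ × Fin n => ℂ) 2 j a) j' •
    ContLoop.toL2 (modeLoop j')) j fun j' h => by
      rw [lp.single_apply_ne (E := fun _ : ℤ × Fin n => ℂ) 2 j a h, zero_smul]
  rwa [lp.single_apply_self (E := fun _ : ℤ × Fin n => ℂ) 2 j a] at h1

lemma ofCoeff_incl_bound {p : ℕ} (hp : 0 < p) (y : EuclideanSpace ℂ (LowMode n p)) :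
    ∀ᵐ t ∂(haarAddCircle (T := (1:ℝ))),
      ‖ofCoeff n ((fourierSplitting hp).incl y) t‖ ≤ Fintype.card (LowMode n p) * ‖y‖ := by
  let F : ContLoop n := ∑ j, y j • modeLoop (LowMode.mode n p j)
  have h1 : ofCoeff n ((fourierSplitting hp).incl y) = F.toL2 := by
    change ofCoeff n (∑ j, lp.single (E := fun _ : ℤ × Fin n => ℂ) 2 (LowMode.mode n p j) (y j)) = _
    rw [map_sum, map_sum]
    refine Finset.sum_congr rfl fun j _ => ?_
    rw [map_smul, ofCoeff_single]
  rw [h1]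
  filter_upwards [ContLoop.coeFn_toL2 F] with t ht
  rw [ht, ContinuousMap.sum_apply]
  refine (norm_sum_le_of_le _ (f := fun j => (y j • modeLoop (LowMode.mode n p j)) t)
    (n := fun _ => ‖y‖) fun j _ => ?_).trans_eq (by simp)
  rw [ContinuousMap.smul_apply, norm_smul, norm_modeLoop_apply, mul_one]
  exact PiLp.norm_apply_le y j

end Solutions

section PeriodicSolutions

open AddCircle

variable {n : ℕ} {H : EuclideanSpace ℂ (Fin n) → ℝ}
  {X : EuclideanSpace ℂ (Fin n) → EuclideanSpace ℂ (Fin n)}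

/-- The gradient of the Hamiltonian action on the coefficient side. -/
def coeffField {K : NNReal} (hX : LipschitzWith K X) (hX0 : X 0 = 0)
    (x : lp (fun _ : ℤ × Fin n => ℂ) 2) : lp (fun _ : ℤ × Fin n => ℂ) 2 :=
  (ofCoeff n).symm (hX.compLp hX0 (ofCoeff n x))

lemma norm_coeffField_sub_le {K : NNReal} (hX : LipschitzWith K X) (hX0 : X 0 = 0)
    (u v : lp (fun _ : ℤ × Fin n => ℂ) 2) :
    ‖coeffField hX hX0 u - coeffField hX hX0 v‖ ≤ K * ‖u - v‖ := by
  rw [coeffField, coeffField, ← map_sub, LinearIsometryEquiv.norm_map]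
  refine (hX.norm_compLp_sub_le hX0 _ _).trans_eq ?_
  rw [← map_sub, LinearIsometryEquiv.norm_map]

lemma isQuadGradient_coeffField {K : NNReal} (hX : LipschitzWith K X) (hX0 : X 0 = 0)
    (hH : IsQuadGradient H X K) (hH0 : H 0 = 0) :
    IsQuadGradient (fun x => ∫ t, H (ofCoeff n x t) ∂haarAddCircle) (coeffField hX hX0) K := by
  intro x y
  have h1 := hH.integral (μ := haarAddCircle (T := (1:ℝ))) hX hX0 hH0 (ofCoeff n x) (ofCoeff n y)
  rw [← map_sub, LinearIsometryEquiv.norm_map] at h1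
  rw [coeffField, LinearIsometryEquiv.inner_map_eq_flip (ofCoeff n).symm]
  exact h1

lemma coeffField_act {K : NNReal} (hX : LipschitzWith K X) (hX0 : X 0 = 0) {p : ℕ} (hp : 0 < p)
    (ζ : ℂ) (v : lp (fun _ : ℤ × Fin n => ℂ) 2) (hζ : ‖ζ‖ = 1) :
    coeffField hX hX0 ((fourierSplitting hp).act ζ v) =
      (fourierSplitting hp).act ζ (coeffField hX hX0 v) := by
  obtain ⟨s, rfl⟩ := exists_fourier_one_eq hζ
  rw [fourierSplitting_act, fourierSplitting_act, coeffField, coeffField,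
    LinearIsometryEquiv.apply_symm_apply, LinearIsometryEquiv.apply_symm_apply, compLp_loopShift]

lemma integral_comp_act (H : EuclideanSpace ℂ (Fin n) → ℝ) {p : ℕ} (hp : 0 < p)
    (ζ : ℂ) (v : lp (fun _ : ℤ × Fin n => ℂ) 2) (hζ : ‖ζ‖ = 1) :
    ∫ t, H (ofCoeff n ((fourierSplitting hp).act ζ v) t) ∂haarAddCircle =
      ∫ t, H (ofCoeff n v t) ∂haarAddCircle := by
  obtain ⟨s, rfl⟩ := exists_fourier_one_eq hζ
  rw [fourierSplitting_act, LinearIsometryEquiv.apply_symm_apply, integral_comp_loopShift]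

lemma sum_weight_le_integral_comp {K : NNReal} (hX0 : X 0 = 0)
    (hH : IsQuadGradient H X K) (hH0 : H 0 = 0) {q : Fin n → ℝ} {c : ℝ} (hq : ∀ i, 0 < q i)
    (hlow : ∀ z, ∑ i, q i * ‖z i‖ ^ 2 - c ≤ H z) {p : ℕ} (v : lp (fun _ : ℤ × Fin n => ℂ) 2) :
    ∑ j : LowMode n p, q j.2 * ‖v (LowMode.mode n p j)‖ ^ 2 - c ≤
      ∫ t, H (ofCoeff n v t) ∂haarAddCircle := by
  have hc : ∀ i, (fun t => ‖component i (ofCoeff n v) t‖ ^ 2) =ᵐ[haarAddCircle]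
      fun t => ‖ofCoeff n v t i‖ ^ 2 := fun i => by
    filter_upwards [coeFn_component i (ofCoeff n v)] with t ht
    rw [ht]
  have hi : Integrable (fun t => ∑ i, q i * ‖ofCoeff n v t i‖ ^ 2) (haarAddCircle (T := (1:ℝ))) :=
    integrable_finsetSum _ fun i _ =>
      ((L2_integrable_norm_sq (component i (ofCoeff n v))).congr (hc i)).const_mul _
  calc _ ≤ ∫ t, ∑ i, q i * ‖ofCoeff n v t i‖ ^ 2 ∂haarAddCircle - c :=
        sub_le_sub_right (sum_weight_le_integral hq v) c
    _ = ∫ t, (∑ i, q i * ‖ofCoeff n v t i‖ ^ 2 - c) ∂haarAddCircle := by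
        rw [integral_sub hi (integrable_const c)]; simp
    _ ≤ _ := integral_mono (hi.sub (integrable_const c)) (hH.integrable_comp hX0 hH0 _)
        fun t => hlow _

lemma norm_proj_coeffField_sub_le {K : NNReal} (hX : LipschitzWith K X) (hX0 : X 0 = 0)
    {Q : Fin n → ℝ} {M : ℝ} (hM : ∀ z, ‖X z - diagMul Q z‖ ≤ M) {p : ℕ} (hp : 0 < p)
    (v : lp (fun _ : ℤ × Fin n => ℂ) 2) :
    ‖(fourierSplitting hp).proj (coeffField hX hX0 v) -
      diagMul (fun j : LowMode n p => Q j.2) ((fourierSplitting hp).proj v)‖ ≤ M := by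
  have hM0 : 0 ≤ M := (norm_nonneg _).trans (hM 0)
  let w : lp (fun _ : ℤ × Fin n => ℂ) 2 :=
    (ofCoeff n).symm ((diagMul Q).compLp (ofCoeff n v))
  have h1 : diagMul (fun j : LowMode n p => Q j.2) ((fourierSplitting hp).proj v) =
      (fourierSplitting hp).proj w := by
    ext j
    change (Q j.2 : ℂ) * v (LowMode.mode n p j) = w (LowMode.mode n p j)
    have h2 := ofCoeff_symm_apply (ofCoeff n v) (LowMode.mode n p j)
    rw [(ofCoeff n).symm_apply_apply] at h2
    rw [h2, ofCoeff_symm_apply, ← smul_eq_mul, ← fourierCoeff.const_smul]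
    refine integral_congr_ae ?_
    filter_upwards [(diagMul Q).coeFn_compLp (ofCoeff n v)] with t ht
    rw [ht]; rfl
  rw [h1, ← map_sub]
  refine (ModeSplitting.norm_proj_le _ _).trans ?_
  rw [coeffField, ← map_sub, LinearIsometryEquiv.norm_map]
  refine (Lp.norm_le_of_ae_bound hM0 ?_).trans_eq
    (by simp [measureUnivNNReal] : _ ^ (ENNReal.toReal 2)⁻¹ * M = M)
  filter_upwards [(diagMul Q).coeFn_compLp (ofCoeff n v), hX.coeFn_compLp hX0 (ofCoeff n v),
    Lp.coeFn_sub (hX.compLp hX0 (ofCoeff n v)) ((diagMul Q).compLp (ofCoeff n v))] with t h2 h3 h4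
  rw [h4, Pi.sub_apply, h2, h3]
  exact hM _

lemma coeffField_incl_eq_zero {K : NNReal} (hX : LipschitzWith K X) (hX0 : X 0 = 0)
    {ε : ℝ} (hloc : ∀ z, ‖z‖ ≤ ε → X z = 0 ∧ H z = 0) {p : ℕ} (hp : 0 < p)
    {y : EuclideanSpace ℂ (LowMode n p)} (hy : Fintype.card (LowMode n p) * ‖y‖ ≤ ε) :
    coeffField hX hX0 ((fourierSplitting hp).incl y) = 0 ∧
      ∫ t, H (ofCoeff n ((fourierSplitting hp).incl y) t) ∂haarAddCircle = 0 := by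
  have hb := ofCoeff_incl_bound hp y
  constructor
  · rw [coeffField]
    convert map_zero (ofCoeff n).symm
    rw [Lp.eq_zero_iff_ae_eq_zero]
    filter_upwards [hb, hX.coeFn_compLp hX0 (ofCoeff n ((fourierSplitting hp).incl y))] with t h1 h2
    rw [h2]
    exact (hloc _ (h1.trans hy)).1
  · refine integral_eq_zero_of_ae ?_
    filter_upwards [hb] with t h1
    exact (hloc _ (h1.trans hy)).2

lemma exists_dist_two_pi_mul {p : ℕ} {Q : Fin n → ℝ} (hQ : ∀ i (l : ℤ), 2 * π * l ≠ Q i) :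
    ∃ δ > 0, ∀ j : LowMode n p, δ ≤ |2 * π * ((j.1 : ℤ) : ℝ) - Q j.2| := by
  rcases isEmpty_or_nonempty (LowMode n p) with h | h
  · exact ⟨1, one_pos, fun j => (h.false j).elim⟩
  · obtain ⟨j₀, h₀⟩ := Finite.exists_min
      fun j : LowMode n p => |2 * π * ((j.1 : ℤ) : ℝ) - Q j.2|
    exact ⟨_, abs_pos.2 (sub_ne_zero.2 (hQ _ _)), h₀⟩

lemma two_pi_mul_coeff_eq {p : ℕ} (hp : 0 < p) {x w : lp (fun _ : ℤ × Fin n => ℂ) 2}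
    (h1 : x = (fourierSplitting hp).incl ((fourierSplitting hp).proj x) +
      (fourierSplitting hp).K w)
    (h2 : diagMul (fun j => 2 * π * (fourierSplitting hp).weight j)
      ((fourierSplitting hp).proj x) = (fourierSplitting hp).proj w) (j : ℤ × Fin n) :
    ((2 * π * j.1 : ℝ) : ℂ) * x j = w j := by
  by_cases hj : j ∈ range (LowMode.mode n p)
  · obtain ⟨i, rfl⟩ := hj
    exact congrArg (fun v : EuclideanSpace ℂ (LowMode n p) => v i) h2
  · have hj' : ¬ |j.1| ≤ (p : ℤ) := fun h => hj (LowMode.mem_range_mode.2 h)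
    have hne : (j.1 : ℝ) ≠ 0 := by
      rw [Int.cast_ne_zero]
      rintro h
      rw [h] at hj'
      exact hj' (by simp)
    have h3 : x j = (highSymbol n p j : ℂ) * w j := by
      conv_lhs => rw [h1]
      rw [lp.coeFn_add, Pi.add_apply]
      have h4 : (fourierSplitting hp).incl ((fourierSplitting hp).proj x) j = 0 :=
        coordIncl_apply_of_notMem _ hj
      rw [h4, zero_add]
      rfl
    rw [h3, highSymbol, if_neg hj', ← mul_assoc, ← Complex.ofReal_mul,
      mul_one_div_cancel (by positivity), Complex.ofReal_one, one_mul]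

/-- Existence of `1`-periodic solutions of positive action for a Hamiltonian that grows fast
enough in `k + 1` complex directions, avoiding the translates of `k` given loops. -/
theorem exists_periodic_solution {k : ℕ} (hk : k + 1 ≤ n) {C : ℝ}
    (hC : 0 ≤ C) (hX : ∀ u v, ‖X u - X v‖ ≤ C * ‖u - v‖) (hH : IsQuadGradient H X C)
    (hH0 : ∀ z, 0 ≤ H z) {ε : ℝ} (hε : 0 < ε) (hloc : ∀ z, ‖z‖ ≤ ε → X z = 0 ∧ H z = 0)
    {q : Fin n → ℝ} {c : ℝ} (hq : ∀ i, 0 < q i) (hq' : ∀ i : Fin n, (i : ℕ) < k + 1 → π < q i)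
    (hlow : ∀ z, ∑ i, q i * ‖z i‖ ^ 2 - c ≤ H z)
    {Q : Fin n → ℝ} {M : ℝ} (hQ : ∀ i (l : ℤ), 2 * π * l ≠ Q i)
    (hM : ∀ z, ‖X z - diagMul Q z‖ ≤ M) (Y : Fin k → ContLoop n) :
    ∃ F : ContLoop n, (∀ t : ℝ, HasDerivAt (fun t : ℝ => F t) (Complex.I • X (F t)) t) ∧
      0 < ∫ t in (0:ℝ)..1, (1 / 2 * inner ℝ (X (F t)) (F t) - H (F t)) ∧
      ∀ i s, ∃ t, F t ≠ Y i (t + s) := by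
  lift C to NNReal using hC
  have hXL : LipschitzWith C X := LipschitzWith.of_dist_le_mul fun u v => by
    simpa only [dist_eq_norm] using hX u v
  obtain ⟨hX0, hH00⟩ := hloc 0 (by simpa using hε.le)
  obtain ⟨p, hp1, hpC⟩ : ∃ p : ℕ, 0 < p ∧ (C:ℝ) ≤ p := by
    obtain ⟨p, hp⟩ := exists_nat_ge (C:ℝ)
    exact ⟨p + 1, p.succ_pos, hp.trans (by simp)⟩
  let S := fourierSplitting (n := n) hp1
  have hpR : (0:ℝ) < p := by exact_mod_cast hp1
  have hκC : S.κ * C ≤ 1 / 2 := by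
    change 1 / (2 * π * p) * (C:ℝ) ≤ 1 / 2
    have := Real.pi_gt_three
    rw [one_div_mul_eq_div, div_le_div_iff₀ (by positivity) two_pos]
    nlinarith
  let e : Fin (k + 1) → LowMode n p := fun i =>
    (⟨1, Finset.mem_Icc.2 ⟨by omega, by omega⟩⟩, Fin.castLE hk i)
  have he : Function.Injective e := fun i i' h => Fin.castLE_injective hk (congrArg Prod.snd h)
  obtain ⟨δ, hδ, hδQ⟩ := exists_dist_two_pi_mul (p := p) hQ
  obtain ⟨x, hx1, hx2, hx3, hx4⟩ := S.exists_critical_point (C := C)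
    (N := coeffField hXL hX0) (𝒽 := fun x => ∫ t, H (ofCoeff n x t) ∂haarAddCircle)
    (show 0 ≤ 1 / (2 * π * p) by positivity) C.2 hκC
    (norm_coeffField_sub_le hXL hX0) (isQuadGradient_coeffField hXL hX0 hH hH00)
    (coeffField_act hXL hX0 hp1) (integral_comp_act H hp1) e he (fun _ => rfl)
    (fun v => integral_nonneg fun t => hH0 _) (q := fun j => q j.2) (c₀ := c)
    (fun j => hq _) (fun i => hq' _ (by simpa [e] using i.is_le))
    (fun y v => by
      have h1 := sum_weight_le_integral_comp hX0 hH hH00 hq hlow (p := p) (S.incl y + S.Kn v)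
      simp only [S, fourierSplitting_incl_add_Kn] at h1
      exact h1)
    (Q := fun j => Q j.2) hδ hδQ (norm_proj_coeffField_sub_le hXL hX0 hM hp1)
    (ρ := ε / (Fintype.card (LowMode n p) + 1)) (by positivity)
    (fun y hy => coeffField_incl_eq_zero hXL hX0 hloc hp1 (by
      rw [le_div_iff₀ (by positivity)] at hy
      nlinarith [norm_nonneg y]))
    (fun i => (ofCoeff n).symm (Y i).toL2)
  obtain ⟨F, hF1, hF2⟩ := exists_solution_of_coeff hXL hX0 (two_pi_mul_coeff_eq hp1 hx1 hx2)
  have hFx : ofCoeff n x =ᵐ[haarAddCircle] F := hF1 ▸ F.coeFn_toL2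
  refine ⟨F, hF2, ?_, ?_⟩
  · have hXc : Continuous X := hXL.continuous
    have hintegrable : ∀ u : AddCircle (1:ℝ) → ℝ, Continuous u → Integrable u haarAddCircle :=
      fun u hu =>
      hu.integrable_of_hasCompactSupport (HasCompactSupport.of_compactSpace _)
    have e1 : inner ℝ (coeffField hXL hX0 x) x =
        ∫ t, inner ℝ (X (F t)) (F t) ∂haarAddCircle := by
      rw [coeffField, LinearIsometryEquiv.inner_map_eq_flip (ofCoeff n).symm,
        LinearIsometryEquiv.symm_symm, L2.inner_def]
      refine integral_congr_ae ?_
      filter_upwards [hFx, hXL.coeFn_compLp hX0 (ofCoeff n x)] with t h1 h2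
      rw [h2, Function.comp_apply, h1]
    have e2 : ∫ t, H (ofCoeff n x t) ∂haarAddCircle = ∫ t, H (F t) ∂haarAddCircle := by
      refine integral_congr_ae ?_
      filter_upwards [hFx] with t h1
      rw [h1]
    rw [e1, e2, ← integral_const_mul, ← integral_sub
      (hintegrable (fun t => 1 / 2 * inner ℝ (X (F t)) (F t)) (by fun_prop))
      (hintegrable (fun t => H (F t)) (hH.continuous.comp F.continuous))] at hx3
    rw [← integral_haar_eq_intervalIntegral
      fun t => 1 / 2 * inner ℝ (X (F t)) (F t) - H (F t)]
    exact hx3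
  · by_contra! hcon
    obtain ⟨i, s, hs⟩ := hcon
    refine hx4 i (fourier 1 s) (norm_fourier_apply 1 s) ?_
    rw [fourierSplitting_act, LinearIsometryEquiv.apply_symm_apply,
      LinearIsometryEquiv.eq_symm_apply]
    refine Lp.ext ?_
    have h1 := (measurePreserving_add_right (haarAddCircle (T := (1:ℝ)))
      s).quasiMeasurePreserving.ae (Y i).coeFn_toL2
    filter_upwards [hFx, coeFn_loopShift s (Y i).toL2, h1] with t h2 h3 h4
    rw [h2, h3, h4, hs]

end PeriodicSolutions

section Profiles

lemma smoothTransition_injOn : InjOn Real.smoothTransition (Ioo 0 1) := by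
  have key : ∀ x ∈ Ioo (0:ℝ) 1, ∀ y ∈ Ioo (0:ℝ) 1, x < y →
      Real.smoothTransition x ≠ Real.smoothTransition y := by
    intro x hx y hy hxy h
    have mono : ∀ u v : ℝ, 0 < u → u < v → expNegInvGlue u < expNegInvGlue v := by
      intro u v hu huv
      rw [expNegInvGlue, expNegInvGlue, if_neg (not_le.2 hu), if_neg (not_le.2 (hu.trans huv)),
        Real.exp_lt_exp, neg_lt_neg_iff]
      exact inv_strictAnti₀ hu huv
    unfold Real.smoothTransition at h
    rw [div_eq_div_iff (Real.smoothTransition.pos_denom x).ne'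
      (Real.smoothTransition.pos_denom y).ne'] at h
    have h1 := mono x y hx.1 hxy
    have h2 := mono (1 - y) (1 - x) (by linarith [hy.2]) (by linarith)
    have h3 := expNegInvGlue.pos_of_pos hx.1
    have h4 := expNegInvGlue.pos_of_pos (x := 1 - y) (by linarith [hy.2])
    nlinarith [mul_lt_mul h1 h2.le h4 (h3.trans h1).le]
  intro x hx y hy h
  rcases lt_trichotomy x y with h1 | h1 | h1
  · exact (key x hx y hy h1 h).elim
  · exact h1
  · exact (key y hy x hx h1 h.symm).elim

lemma hasDerivAt_primitive {g : ℝ → ℝ} (hg : Continuous g) (s : ℝ) :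
    HasDerivAt (fun s => ∫ u in (0:ℝ)..s, g u) (g s) s :=
  (hg.integral_hasStrictDerivAt 0 s).hasDerivAt

lemma eq_of_hasDerivAt_eq_zero {f g : ℝ → ℝ} (h : ∀ s, HasDerivAt f (g s) s) {a b : ℝ}
    (hab : a ≤ b) (h0 : ∀ s ∈ Icc a b, g s = 0) : f b = f a := by
  refine constant_of_has_deriv_right_zero (f := f) (a := a) (b := b)
    (fun s _ => (h s).continuousAt.continuousWithinAt) (fun s hs => ?_) b (right_mem_Icc.2 hab)
  have := (h s).hasDerivWithinAt (s := Ici s)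
  rwa [h0 s (Ico_subset_Icc_self hs)] at this

/-- A smooth ramp function of eventual slope one. -/
lemma exists_ramp {w : ℝ} (hw : 0 < w) : ∃ γ γ' : ℝ → ℝ, ContDiff ℝ 1 γ' ∧
    (∀ τ, HasDerivAt γ (γ' τ) τ) ∧ (∀ τ ≤ 0, γ τ = 0 ∧ γ' τ = 0) ∧ (∀ τ, 0 ≤ γ τ) ∧
    (∀ τ, τ - w ≤ γ τ) ∧ (∀ τ, 0 ≤ γ' τ) ∧ (∀ τ, γ' τ ≤ 1) ∧ (∀ τ ≥ w, γ' τ = 1) := by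
  let γ' : ℝ → ℝ := fun τ => Real.smoothTransition (τ / w)
  have hc : ContDiff ℝ 1 γ' := Real.smoothTransition.contDiff.comp (contDiff_id.div_const w)
  let γ : ℝ → ℝ := fun τ => ∫ u in (0:ℝ)..τ, γ' u
  have hd : ∀ τ, HasDerivAt γ (γ' τ) τ := hasDerivAt_primitive hc.continuous
  have hm := monotone_of_hasDerivAt_nonneg hd fun τ => Real.smoothTransition.nonneg _
  have h0 : ∀ τ ≤ 0, γ' τ = 0 := fun τ hτ =>
    Real.smoothTransition.zero_of_nonpos (div_nonpos_of_nonpos_of_nonneg hτ hw.le)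
  have h1 : ∀ τ ≥ w, γ' τ = 1 := fun τ hτ =>
    Real.smoothTransition.one_of_one_le ((one_le_div hw).2 hτ)
  have hγ0 : γ 0 = 0 := intervalIntegral.integral_same
  have hn : ∀ τ ≤ 0, γ τ = 0 := fun τ hτ => by
    rw [← eq_of_hasDerivAt_eq_zero hd hτ fun s hs => h0 s hs.2, hγ0]
  have hpos : ∀ τ, 0 ≤ γ τ := fun τ => by
    rcases le_total τ 0 with h | h
    · exact (hn τ h).ge
    · exact hγ0 ▸ hm h
  refine ⟨γ, γ', hc, hd, fun τ hτ => ⟨hn τ hτ, h0 τ hτ⟩, hpos, fun τ => ?_,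
    fun τ => Real.smoothTransition.nonneg _, fun τ => Real.smoothTransition.le_one _, h1⟩
  rcases le_total τ w with h | h
  · linarith [hpos τ]
  · have := eq_of_hasDerivAt_eq_zero (f := fun s => γ s - s) (g := fun s => γ' s - 1)
      (fun s => (hd s).sub (hasDerivAt_id s)) h fun s hs => by rw [h1 s hs.1, sub_self]
    linarith [hpos w]

/-- A profile with slope less than `k` and total variation close to `k`. -/
lemma exists_profile {k ν : ℝ} (hν : 0 ≤ ν) (hνk : ν < k) :
    ∃ (η m : ℝ) (f g : ℝ → ℝ), 0 < η ∧ η < 1 / 2 ∧ ν < m ∧ ContDiff ℝ 1 g ∧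
      (∀ s, HasDerivAt f (g s) s) ∧ (∀ s, 0 ≤ g s) ∧ (∀ s, g s < k) ∧ (∀ s, 0 ≤ f s) ∧
      (∀ s, f s ≤ m) ∧ (∀ s ≤ η, f s = 0 ∧ g s = 0) ∧ (∀ s ≥ 1 - η, f s = m) ∧
      (∀ s ≤ 1 / 2, ∀ s' ≤ 1 / 2, 0 < g s → g s ≤ ν → g s = g s' → s = s') ∧
      ∀ s > 1 / 2, g s ≤ ν → ν < f s := by
  let T := Real.smoothTransition
  let σ := (ν + k) / 2
  have hσν : ν < σ := by simp only [σ]; linarith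
  have hσk : σ < k := by simp only [σ]; linarith
  have hσ : 0 < σ := hν.trans_lt hσν
  let η := (σ - ν) / (8 * σ)
  have hη : 0 < η := div_pos (by linarith) (by linarith)
  have hησ : 8 * σ * η = σ - ν := mul_div_cancel₀ _ (by positivity)
  have hη8 : η ≤ 1 / 8 := by
    by_contra! h
    nlinarith
  clear_value η σ
  let g : ℝ → ℝ := fun s => σ * T ((s - η) / η) * T ((1 - η - s) / η)
  have hc : ContDiff ℝ 1 g :=
    (contDiff_const.mul (Real.smoothTransition.contDiff.comp
      ((contDiff_id.sub contDiff_const).div_const η))).mul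
      (Real.smoothTransition.contDiff.comp ((contDiff_const.sub contDiff_id).div_const η))
  let f : ℝ → ℝ := fun τ => ∫ u in (0:ℝ)..τ, g u
  have hd : ∀ τ, HasDerivAt f (g τ) τ := hasDerivAt_primitive hc.continuous
  have T0 : ∀ u, 0 ≤ T u := Real.smoothTransition.nonneg
  have T1 : ∀ u, T u ≤ 1 := Real.smoothTransition.le_one
  have hg0 : ∀ s, 0 ≤ g s := fun s => mul_nonneg (mul_nonneg hσ.le (T0 _)) (T0 _)
  have hgσ : ∀ s, g s ≤ σ := fun s => by
    calc g s ≤ σ * 1 * 1 := by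
          refine mul_le_mul ?_ (T1 _) (T0 _) (by linarith)
          exact mul_le_mul_of_nonneg_left (T1 _) hσ.le
      _ = σ := by ring
  have hm := monotone_of_hasDerivAt_nonneg hd hg0
  have hf0 : f 0 = 0 := intervalIntegral.integral_same
  have gl : ∀ s ≤ η, g s = 0 := fun s hs => by
    have : T ((s - η) / η) = 0 := Real.smoothTransition.zero_of_nonpos
      (div_nonpos_of_nonpos_of_nonneg (by linarith) hη.le)
    simp only [g, this, mul_zero, zero_mul]
  have gr : ∀ s ≥ 1 - η, g s = 0 := fun s hs => by
    have : T ((1 - η - s) / η) = 0 := Real.smoothTransition.zero_of_nonpos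
      (div_nonpos_of_nonpos_of_nonneg (by linarith) hη.le)
    simp only [g, this, mul_zero]
  have left1 : ∀ s ≤ 1 - 2 * η, g s = σ * T ((s - η) / η) := fun s hs => by
    have : T ((1 - η - s) / η) = 1 := Real.smoothTransition.one_of_one_le
      ((one_le_div hη).2 (by linarith))
    simp only [g, this, mul_one]
  have mid : ∀ s ≥ 2 * η, s ≤ 1 - 2 * η → g s = σ := fun s hs hs' => by
    have : T ((s - η) / η) = 1 := Real.smoothTransition.one_of_one_le
      ((one_le_div hη).2 (by linarith))
    rw [left1 s hs', this, mul_one]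
  have fl : ∀ s ≤ η, f s = 0 := fun s hs => by
    rcases le_total s 0 with h | h
    · rw [← eq_of_hasDerivAt_eq_zero hd h fun u hu => gl u (by linarith [hu.2]), hf0]
    · rw [eq_of_hasDerivAt_eq_zero hd h fun u hu => gl u (by linarith [hu.2]), hf0]
  have fr : ∀ s ≥ 1 - η, f s = f (1 - η) := fun s hs =>
    eq_of_hasDerivAt_eq_zero hd hs fun u hu => gr u hu.1
  have fm : ν < f (1 - 2 * η) := by
    have h1 : (fun s => f s - σ * s) (1 - 2 * η) = (fun s => f s - σ * s) (2 * η) :=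
      eq_of_hasDerivAt_eq_zero (f := fun s => f s - σ * s) (g := fun s => g s - σ * 1)
      (fun s => (hd s).sub ((hasDerivAt_id s).const_mul σ))
      (by linarith) fun s hs => by rw [mid s hs.1 hs.2, mul_one, sub_self]
    dsimp only at h1
    have h2 : 0 ≤ f (2 * η) := fl η le_rfl ▸ hm (by linarith)
    nlinarith
  refine ⟨η, f (1 - η), f, g, hη, by linarith, fm.trans_le (hm (by linarith)), hc, hd, hg0,
    fun s => (hgσ s).trans_lt hσk, fun s => ?_, fun s => ?_, fun s hs => ⟨fl s hs, gl s hs⟩, fr,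
    fun s hs s' hs' h1 h2 h3 => ?_, fun s hs hgs => ?_⟩
  · rcases le_total s η with h | h
    · exact (fl s h).ge
    · exact fl η le_rfl ▸ hm h
  · rcases le_total s (1 - η) with h | h
    · exact hm h
    · exact (fr s h).le
  · have key : ∀ u ≤ 1 / 2, 0 < g u → g u ≤ ν → (u - η) / η ∈ Ioo (0:ℝ) 1 := by
      intro u hu hu1 hu2
      have hlt : η < u := by
        by_contra! h
        exact hu1.ne' (gl u h)
      have hlt' : u < 2 * η := by
        by_contra! h
        linarith [mid u h (by linarith)]
      exact ⟨div_pos (by linarith) hη, (div_lt_one hη).2 (by linarith)⟩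
    have e := h3
    rw [left1 s (by linarith), left1 s' (by linarith)] at e
    have := smoothTransition_injOn (key s hs h1 h2) (key s' hs' (h3 ▸ h1) (h3 ▸ h2))
      (mul_left_cancel₀ hσ.ne' e)
    rw [div_left_inj' hη.ne'] at this
    linarith
  · refine fm.trans_le (hm ?_)
    by_contra! h
    linarith [mid s (by linarith) h.le]

end Profiles

section RadialTerms

variable {E : Type*} [NormedAddCommGroup E] [InnerProductSpace ℝ E]

lemma IsQuadGradient.of_hasFDerivAt {H : E → ℝ} {X : E → E} {C : ℝ} (hC : 0 ≤ C)
    (hH : ∀ x, HasFDerivAt H (innerSL ℝ (X x)) x) (hX : ∀ u v, ‖X u - X v‖ ≤ C * ‖u - v‖) :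
    IsQuadGradient H X C := by
  intro x y
  have h1 : ∀ z ∈ segment ℝ x y, HasFDerivWithinAt (fun z => H z - innerSL ℝ (X x) z)
      (innerSL ℝ (X z) - innerSL ℝ (X x)) (segment ℝ x y) z := fun z _ =>
    ((hH z).sub (innerSL ℝ (X x)).hasFDerivAt).hasFDerivWithinAt
  have h2 : ∀ z ∈ segment ℝ x y, ‖innerSL ℝ (X z) - innerSL ℝ (X x)‖ ≤ C * ‖y - x‖ := by
    intro z hz
    rw [← map_sub, innerSL_apply_norm]
    refine (hX z x).trans (mul_le_mul_of_nonneg_left ?_ hC)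
    exact norm_sub_le_of_mem_segment hz
  have h3 := (convex_segment x y).norm_image_sub_le_of_norm_hasFDerivWithin_le h1 h2
    (left_mem_segment ℝ x y) (right_mem_segment ℝ x y)
  rw [Real.norm_eq_abs, innerSL_apply_apply, innerSL_apply_apply] at h3
  rw [inner_sub_right]
  calc _ = _ := by congr 1; ring
    _ ≤ _ := h3
    _ = _ := by ring

/-- A ramp function composed with a seminorm square. -/
def radialEnergy (γ : ℝ → ℝ) (ρ : ℝ) (P : E →L[ℝ] E) (x : E) : ℝ := γ (‖P x‖ ^ 2 - ρ)

/-- The gradient of `radialEnergy`. -/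
def radialField (γ' : ℝ → ℝ) (ρ : ℝ) (P : E →L[ℝ] E) (x : E) : E :=
  (2 * γ' (‖P x‖ ^ 2 - ρ)) • P x

variable {γ γ' : ℝ → ℝ} {ρ w : ℝ} {P : E →L[ℝ] E}

lemma hasFDerivAt_radialEnergy (hγ : ∀ τ, HasDerivAt γ (γ' τ) τ)
    (hP : ∀ x y, inner ℝ (P x) (P y) = inner ℝ (P x) y) (x : E) :
    HasFDerivAt (radialEnergy γ ρ P) (innerSL ℝ (radialField γ' ρ P x)) x := by
  have h1 := (hγ (‖P x‖ ^ 2 - ρ)).comp_hasFDerivAt x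
    ((P.hasFDerivAt.norm_sq (x := x)).sub_const ρ)
  refine h1.congr_fderiv ?_
  ext v
  simp only [radialField, innerSL_apply_apply, inner_smul_left, smul_apply,
    ContinuousLinearMap.comp_apply, hP, smul_eq_mul, RCLike.conj_to_real, nsmul_eq_mul]
  push_cast
  ring

lemma exists_radialField_bounds [FiniteDimensional ℝ E] (hγ' : ContDiff ℝ 1 γ')
    (h1 : ∀ τ ≥ w, γ' τ = 1) : ∃ C ≥ 0, ∃ M,
      (∀ u v, ‖radialField γ' ρ P u - radialField γ' ρ P v‖ ≤ C * ‖u - v‖) ∧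
      ∀ x, ‖radialField γ' ρ P x - (2:ℝ) • P x‖ ≤ M := by
  let β : E → E := fun u => (1 - γ' (‖u‖ ^ 2 - ρ)) • u
  have hβ : ContDiff ℝ 1 β := (contDiff_const.sub (hγ'.comp
    ((contDiff_norm_sq ℝ).sub contDiff_const))).smul contDiff_id
  have hβc : HasCompactSupport β := by
    refine HasCompactSupport.of_support_subset_isCompact
      (isCompact_closedBall (0:E) (√(|w + ρ|))) fun u hu => ?_
    rw [mem_closedBall_zero_iff]
    refine Real.le_sqrt_of_sq_le ?_
    by_contra! h
    refine hu ?_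
    have := h1 (‖u‖ ^ 2 - ρ) (by linarith [le_abs_self (w + ρ)])
    simp only [β, this, sub_self, zero_smul]
  obtain ⟨L, hL⟩ := ContDiff.lipschitzWith_of_hasCompactSupport hβc hβ one_ne_zero
  obtain ⟨B, hB⟩ := hβc.exists_bound_of_continuous hβ.continuous
  have e1 : ∀ x, radialField γ' ρ P x = (2:ℝ) • (P x - β (P x)) := fun x => by
    simp only [radialField, β]
    module
  refine ⟨2 * (‖P‖ + L * ‖P‖), by positivity, 2 * B, fun u v => ?_, fun x => ?_⟩
  · rw [e1, e1, ← smul_sub, norm_smul, Real.norm_two, mul_assoc]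
    refine mul_le_mul_of_nonneg_left ?_ two_pos.le
    have h2 : ‖P u - P v‖ ≤ ‖P‖ * ‖u - v‖ := by rw [← map_sub]; exact P.le_opNorm _
    have h3 : ‖β (P u) - β (P v)‖ ≤ L * ‖P u - P v‖ := by
      simpa only [dist_eq_norm] using hL.dist_le_mul (P u) (P v)
    calc _ = ‖(P u - P v) - (β (P u) - β (P v))‖ := by congr 1; abel
      _ ≤ ‖P‖ * ‖u - v‖ + L * (‖P‖ * ‖u - v‖) :=
        (norm_sub_le _ _).trans (add_le_add h2 (h3.trans (by gcongr)))
      _ = _ := by ring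
  · rw [e1, ← smul_sub, norm_smul, Real.norm_two, sub_sub_cancel_left, norm_neg]
    exact mul_le_mul_of_nonneg_left (hB _) two_pos.le

lemma radialEnergy_ge (hw : ∀ τ, τ - w ≤ γ τ) (x : E) :
    ‖P x‖ ^ 2 - ρ - w ≤ radialEnergy γ ρ P x := hw _

lemma radial_eq_zero (h0 : ∀ τ ≤ 0, γ τ = 0 ∧ γ' τ = 0) {x : E} (hx : ‖P x‖ ^ 2 ≤ ρ) :
    radialEnergy γ ρ P x = 0 ∧ radialField γ' ρ P x = 0 := by
  obtain ⟨h1, h2⟩ := h0 (‖P x‖ ^ 2 - ρ) (by linarith)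
  exact ⟨h1, by rw [radialField, h2, mul_zero, zero_smul]⟩

lemma radial_action_le (hρ : 0 ≤ ρ) (hw0 : 0 ≤ w) (h0 : ∀ τ ≤ 0, γ τ = 0 ∧ γ' τ = 0)
    (hpos : ∀ τ, 0 ≤ γ τ)
    (hw : ∀ τ, τ - w ≤ γ τ) (hn : ∀ τ, 0 ≤ γ' τ) (hle : ∀ τ, γ' τ ≤ 1)
    (hP : ∀ x y, inner ℝ (P x) (P y) = inner ℝ (P x) y) (x : E) :
    1 / 2 * inner ℝ (radialField γ' ρ P x) x - radialEnergy γ ρ P x ≤ ρ + w := by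
  rw [radialField, radialEnergy, inner_smul_left, ← hP, real_inner_self_eq_norm_sq]
  simp only [RCLike.conj_to_real]
  set τ := ‖P x‖ ^ 2 - ρ with hτ
  have e : ‖P x‖ ^ 2 = τ + ρ := by linarith
  rw [e]
  have a1 := hpos τ; have a2 := hw τ; have a3 := hn τ; have a4 := hle τ
  rcases le_total τ 0 with h | h
  · obtain ⟨h1, h2⟩ := h0 τ h
    rw [h1, h2]; simp; linarith
  · rcases le_total τ w with h' | h' <;> nlinarith

lemma norm_sq_add_ge {δ : ℝ} (hδ : 0 < δ) (u v : E) :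
    (1 - δ) * ‖u‖ ^ 2 - 1 / δ * ‖v‖ ^ 2 ≤ ‖u + v‖ ^ 2 := by
  have h1 := norm_add_sq_real u v
  have h2 := neg_le_of_abs_le (abs_real_inner_le_norm u v)
  have h3 : 2 * (‖u‖ * ‖v‖) ≤ δ * ‖u‖ ^ 2 + 1 / δ * ‖v‖ ^ 2 := by
    have h4 : δ * ‖u‖ ^ 2 + 1 / δ * ‖v‖ ^ 2 - 2 * (‖u‖ * ‖v‖) =
        1 / δ * (δ * ‖u‖ - ‖v‖) ^ 2 := by field_simp; ring
    have : 0 ≤ 1 / δ * (δ * ‖u‖ - ‖v‖) ^ 2 := by positivity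
    linarith
  nlinarith [sq_nonneg ‖v‖]

lemma exists_growth_parameters {m a b : ℝ} (ha : 0 ≤ a) (hb : 0 ≤ b) (h : π * a < m) :
    ∃ w > 0, ∃ σ ε : ℝ, 1 < σ ∧ σ < 2 ∧ 0 < ε ∧ ε < 1 ∧ σ * π * (a + w) + ε * (b + w) < m := by
  have hπ := Real.pi_pos
  let d := m - π * a
  have hd : 0 < d := sub_pos.2 h
  have hm : m = π * a + d := by simp only [d]; ring
  clear_value d
  have hw : 0 < d / (8 * π) := by positivity
  have e1 : π * (d / (8 * π)) = d / 8 := by field_simp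
  have hθ1 : d / (4 * (π * a + d)) < 1 := by
    rw [div_lt_one (by positivity)]; nlinarith [mul_nonneg hπ.le ha]
  have hθ : d / (4 * (π * a + d)) * (π * a) ≤ d / 4 := by
    rw [div_mul_eq_mul_div, div_le_div_iff₀ (by positivity) (by norm_num)]
    nlinarith [mul_nonneg hπ.le ha]
  have hθ0 : 0 < d / (4 * (π * a + d)) := by positivity
  set w := d / (8 * π)
  set θ := d / (4 * (π * a + d))
  have hε : d / (4 * (b + w) + d) * (b + w) ≤ d / 4 := by
    rw [div_mul_eq_mul_div, div_le_div_iff₀ (by positivity) (by norm_num)]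
    nlinarith
  refine ⟨w, hw, 1 + θ, d / (4 * (b + w) + d), by linarith, by linarith, by positivity, ?_, ?_⟩
  · rw [div_lt_one (by positivity)]; nlinarith
  · rw [hm]
    nlinarith

end RadialTerms

section BumpHamiltonian

variable {n : ℕ}

lemma inner_diagMul_diagMul {w : Fin n → ℝ} (hw : ∀ i, w i * w i = w i)
    (x y : EuclideanSpace ℂ (Fin n)) :
    inner ℝ (diagMul w x) (diagMul w y) = inner ℝ (diagMul w x) y := by
  rw [PiLp.inner_apply, PiLp.inner_apply]
  refine Finset.sum_congr rfl fun i _ => ?_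
  rw [diagMul_apply, diagMul_apply, ← Complex.real_smul, ← Complex.real_smul,
    real_inner_smul_left, real_inner_smul_left, real_inner_smul_right, ← mul_assoc, hw]

lemma norm_diagMul_sq {w : Fin n → ℝ} (hw : ∀ i, w i * w i = w i)
    (x : EuclideanSpace ℂ (Fin n)) : ‖diagMul w x‖ ^ 2 = ∑ i, w i * ‖x i‖ ^ 2 := by
  rw [← real_inner_self_eq_norm_sq, inner_diagMul_diagMul hw, inner_diagMul_self]

/-- The indicator of the first `k` indices. -/
def firstWeight (n k : ℕ) (i : Fin n) : ℝ := if (i : ℕ) < k then 1 else 0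

/-- The indicator of the remaining indices. -/
def lastWeight (n k : ℕ) (i : Fin n) : ℝ := if (i : ℕ) < k then 0 else 1

lemma firstWeight_mul_self (n k : ℕ) (i : Fin n) :
    firstWeight n k i * firstWeight n k i = firstWeight n k i := by
  unfold firstWeight; split_ifs <;> norm_num

lemma lastWeight_mul_self (n k : ℕ) (i : Fin n) :
    lastWeight n k i * lastWeight n k i = lastWeight n k i := by
  unfold lastWeight; split_ifs <;> norm_num

lemma real_inner_I_smul_self_euclidean (v : EuclideanSpace ℂ (Fin n)) :
    inner ℝ v (Complex.I • v) = 0 := by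
  rw [PiLp.inner_apply]
  refine Finset.sum_eq_zero fun i _ => ?_
  rw [PiLp.smul_apply, Complex.inner]
  simp
  ring

/-- If `F` solves the Hamiltonian equation then the energy is constant. -/
lemma energy_const {H : EuclideanSpace ℂ (Fin n) → ℝ}
    {X : EuclideanSpace ℂ (Fin n) → EuclideanSpace ℂ (Fin n)}
    (hH : ∀ x, HasFDerivAt H (innerSL ℝ (X x)) x) {x : ℝ → EuclideanSpace ℂ (Fin n)}
    (hx : ∀ t, HasDerivAt x (Complex.I • X (x t)) t) (s t : ℝ) : H (x s) = H (x t) := by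
  have h1 : ∀ t, HasDerivAt (fun t => H (x t)) 0 t := fun t => by
    refine ((hH (x t)).comp_hasDerivAt t (hx t)).congr_deriv ?_
    rw [innerSL_apply_apply, real_inner_I_smul_self_euclidean]
  exact is_const_of_deriv_eq_zero (fun t => (h1 t).differentiableAt) (fun t => (h1 t).deriv) s t

theorem exists_solution_of_bump {k : ℕ} (hk : k + 1 ≤ n) {ψ : EuclideanSpace ℂ (Fin n) → ℝ}
    {Ψ : EuclideanSpace ℂ (Fin n) → EuclideanSpace ℂ (Fin n)}
    (hψ : ∀ x, HasFDerivAt ψ (innerSL ℝ (Ψ x)) x) (hΨ : ContDiff ℝ 1 Ψ)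
    (hΨc : HasCompactSupport Ψ) {m a b : ℝ} (h0 : ∀ x, 0 ≤ ψ x) (hm : ∀ x, ψ x ≤ m)
    (ha : 0 ≤ a) (hb : 0 ≤ b) (ham : π * a < m)
    (hsupp : ∀ x, ψ x ≠ 0 → ‖diagMul (firstWeight n (k + 1)) x‖ ^ 2 ≤ a ∧
      ‖diagMul (lastWeight n (k + 1)) x‖ ^ 2 ≤ b)
    {p : EuclideanSpace ℂ (Fin n)} (hp : ∀ᶠ x in nhds p, ψ x = m) (Y : Fin k → ContLoop n) :
    ∃ F : ContLoop n, (∀ t, ψ (F t) ≠ 0) ∧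
      (∀ t : ℝ, HasDerivAt (fun t : ℝ => F t) (-(Complex.I • Ψ (F t))) t) ∧
      0 < ∫ t in (0:ℝ)..1, (1 / 2 * inner ℝ (-Ψ (F t)) (F t) - (m - ψ (F t))) ∧
      ∀ i s, ∃ t, F t ≠ Y i (t + s) := by
  obtain ⟨w, hw, σ, ε, hσ1, hσ2, hε0, hε1, hpar⟩ := exists_growth_parameters ha hb ham
  obtain ⟨γ, γ', g1, g2, g3, g4, g5, g6, g7, g8⟩ := exists_ramp hw
  let P := diagMul (firstWeight n (k + 1))
  let R := diagMul (lastWeight n (k + 1))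
  have hP := inner_diagMul_diagMul (firstWeight_mul_self n (k + 1))
  have hR := inner_diagMul_diagMul (lastWeight_mul_self n (k + 1))
  have hπ := Real.pi_pos
  have hπ3 := Real.pi_gt_three
  have hm0 : 0 < m := lt_of_le_of_lt (by positivity) ham
  let H₁ : EuclideanSpace ℂ (Fin n) → ℝ := fun x =>
    m - ψ x + σ * π * radialEnergy γ a P x + ε * radialEnergy γ b R x
  let X₁ : EuclideanSpace ℂ (Fin n) → EuclideanSpace ℂ (Fin n) := fun x =>
    -Ψ x + (σ * π) • radialField γ' a P x + ε • radialField γ' b R x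
  have hd : ∀ x, HasFDerivAt H₁ (innerSL ℝ (X₁ x)) x := fun x => by
    refine ((((hψ x).const_sub m).add ((hasFDerivAt_radialEnergy g2 hP x).const_mul
      (σ * π))).add ((hasFDerivAt_radialEnergy g2 hR x).const_mul ε)).congr_fderiv ?_
    simp only [X₁, map_add, map_neg, map_smul]
    rfl
  have hXin : ∀ x, ψ x ≠ 0 → H₁ x = m - ψ x ∧ X₁ x = -Ψ x := fun x hx => by
    obtain ⟨h1, h2⟩ := hsupp x hx
    obtain ⟨h3, h4⟩ := radial_eq_zero g3 (P := P) h1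
    obtain ⟨h5, h6⟩ := radial_eq_zero g3 (P := R) h2
    simp only [H₁, X₁, h3, h4, h5, h6]
    simp
  have hX0 : ∀ x, ψ x = 0 → Ψ x = 0 := fun x hx => by
    have h1 : IsLocalMin ψ x := Filter.Eventually.of_forall fun y => hx ▸ h0 y
    have h2 := h1.hasFDerivAt_eq_zero (hψ x)
    have h3 := congrArg (fun L : _ →L[ℝ] ℝ => L (Ψ x)) h2
    simpa using h3
  have hH1ge : ∀ x, m - ψ x ≤ H₁ x := fun x => by
    have h1 : 0 ≤ σ * π * radialEnergy γ a P x := mul_nonneg (by positivity) (g4 _)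
    have h2 : 0 ≤ ε * radialEnergy γ b R x := mul_nonneg hε0.le (g4 _)
    simp only [H₁]; linarith
  obtain ⟨L, hL⟩ := ContDiff.lipschitzWith_of_hasCompactSupport hΨc hΨ one_ne_zero
  obtain ⟨B, hB⟩ := hΨc.exists_bound_of_continuous hΨ.continuous
  obtain ⟨C₁, hC₁, M₁, hL₁, hM₁⟩ := exists_radialField_bounds (ρ := a) (P := P) g1 g8
  obtain ⟨C₂, hC₂, M₂, hL₂, hM₂⟩ := exists_radialField_bounds (ρ := b) (P := R) g1 g8
  let C : ℝ := L + σ * π * C₁ + ε * C₂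
  have hC : 0 ≤ C := by positivity
  have hXL : ∀ u v, ‖X₁ u - X₁ v‖ ≤ C * ‖u - v‖ := fun u v => by
    have h1 : ‖Ψ u - Ψ v‖ ≤ L * ‖u - v‖ := by simpa only [dist_eq_norm] using hL.dist_le_mul u v
    calc ‖X₁ u - X₁ v‖ = ‖-(Ψ u - Ψ v) + (σ * π) • (radialField γ' a P u - radialField γ' a P v) +
          ε • (radialField γ' b R u - radialField γ' b R v)‖ := by
          congr 1; simp only [X₁]; module
      _ ≤ ‖Ψ u - Ψ v‖ + σ * π * ‖radialField γ' a P u - radialField γ' a P v‖ +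
          ε * ‖radialField γ' b R u - radialField γ' b R v‖ := by
          refine (norm_add₃_le).trans_eq ?_
          rw [norm_neg, norm_smul, norm_smul, Real.norm_of_nonneg (by positivity : 0 ≤ σ * π),
            Real.norm_of_nonneg hε0.le]
      _ ≤ L * ‖u - v‖ + σ * π * (C₁ * ‖u - v‖) + ε * (C₂ * ‖u - v‖) := by
          gcongr
          · exact hL₁ u v
          · exact hL₂ u v
      _ = C * ‖u - v‖ := by simp only [C]; ring
  let Q : Fin n → ℝ := fun i => if (i : ℕ) < k + 1 then 2 * (σ * π) else 2 * ε
  have hQe : ∀ x, diagMul Q x = (σ * π) • (2:ℝ) • P x + ε • (2:ℝ) • R x := fun x => by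
    ext i
    simp only [P, R, PiLp.add_apply, PiLp.smul_apply, diagMul_apply, firstWeight, lastWeight, Q,
      Complex.real_smul]
    split_ifs <;> push_cast <;> ring
  have hQX : ∀ x, ‖X₁ x - diagMul Q x‖ ≤ B + σ * π * M₁ + ε * M₂ := fun x => by
    calc ‖X₁ x - diagMul Q x‖ = ‖-Ψ x + (σ * π) • (radialField γ' a P x - (2:ℝ) • P x) +
          ε • (radialField γ' b R x - (2:ℝ) • R x)‖ := by
          congr 1; rw [hQe]; simp only [X₁]; module
      _ ≤ ‖Ψ x‖ + σ * π * ‖radialField γ' a P x - (2:ℝ) • P x‖ +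
          ε * ‖radialField γ' b R x - (2:ℝ) • R x‖ := by
          refine (norm_add₃_le).trans_eq ?_
          rw [norm_neg, norm_smul, norm_smul, Real.norm_of_nonneg (by positivity : 0 ≤ σ * π),
            Real.norm_of_nonneg hε0.le]
      _ ≤ _ := by
          gcongr
          · exact hB x
          · exact hM₁ x
          · exact hM₂ x
  have hQne : ∀ i (l : ℤ), 2 * π * l ≠ Q i := by
    intro i l h
    simp only [Q] at h
    split_ifs at h
    · have h1 : (l : ℝ) = σ := by
        have : 2 * π * (l - σ) = 0 := by linarith
        rcases mul_eq_zero.1 this with h2 | h2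
        · linarith
        · linarith
      have h2 : (1:ℤ) < l := by exact_mod_cast h1 ▸ hσ1
      have h3 : l < (2:ℤ) := by exact_mod_cast h1 ▸ hσ2
      omega
    · rcases le_or_gt l 0 with h1 | h1
      · have : (l : ℝ) ≤ 0 := by exact_mod_cast h1
        nlinarith
      · have : (1 : ℝ) ≤ l := by exact_mod_cast h1
        nlinarith
  let δ : ℝ := (1 - 1 / σ) / 2
  have hδ0 : 0 < δ := by
    have : 1 / σ < 1 := by rw [div_lt_one (by linarith)]; exact hσ1
    simp only [δ]; linarith
  have hδσ : σ * (1 - δ) = (σ + 1) / 2 := by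
    have : σ ≠ 0 := by linarith
    simp only [δ]; field_simp; ring
  have hδ1 : δ ≤ 1 / 2 := by
    have : 0 < 1 / σ := by positivity
    simp only [δ]; linarith
  clear_value δ
  let q : Fin n → ℝ := fun i =>
    if (i : ℕ) < k + 1 then σ * π * (1 - δ) else ε * (1 - δ)
  have hq : ∀ i, 0 < q i := fun i => by
    simp only [q]
    have : 0 < 1 - δ := by linarith
    split_ifs <;> positivity
  have hq' : ∀ i : Fin n, (i : ℕ) < k + 1 → π < q i := fun i hi => by
    simp only [q, if_pos hi]
    nlinarith
  have hqe : ∀ z : EuclideanSpace ℂ (Fin n), ∑ i, q i * ‖z i‖ ^ 2 =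
      σ * π * (1 - δ) * ‖P z‖ ^ 2 + ε * (1 - δ) * ‖R z‖ ^ 2 := fun z => by
    rw [norm_diagMul_sq (firstWeight_mul_self n _), norm_diagMul_sq (lastWeight_mul_self n _),
      Finset.mul_sum, Finset.mul_sum, ← Finset.sum_add_distrib]
    refine Finset.sum_congr rfl fun i _ => ?_
    simp only [q, firstWeight, lastWeight]
    split_ifs <;> ring
  let c : ℝ := σ * π * (1 / δ * ‖P p‖ ^ 2 + a + w) + ε * (1 / δ * ‖R p‖ ^ 2 + b + w)
  have hlow : ∀ z, ∑ i, q i * ‖z i‖ ^ 2 - c ≤ H₁ (z + p) := fun z => by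
    have h1 := norm_sq_add_ge hδ0 (P z) (P p)
    have h2 := norm_sq_add_ge hδ0 (R z) (R p)
    have h3 := radialEnergy_ge (ρ := a) (P := P) g5 (z + p)
    have h4 := radialEnergy_ge (ρ := b) (P := R) g5 (z + p)
    rw [map_add] at h3 h4
    have h5 := mul_le_mul_of_nonneg_left (h1.trans (by linarith :
      _ ≤ radialEnergy γ a P (z + p) + a + w)) (by positivity : 0 ≤ σ * π)
    have h6 := mul_le_mul_of_nonneg_left (h2.trans (by linarith :
      _ ≤ radialEnergy γ b R (z + p) + b + w)) hε0.le
    rw [hqe]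
    have h7 := hm (z + p)
    simp only [H₁, c]
    linarith
  obtain ⟨r, hr, hrp⟩ := Metric.eventually_nhds_iff.1 hp
  have hloc : ∀ z, ‖z‖ ≤ r / 2 → X₁ (z + p) = 0 ∧ H₁ (z + p) = 0 := fun z hz => by
    have h1 : ψ (z + p) = m := hrp (by rw [dist_eq_norm, add_sub_cancel_right]; linarith)
    obtain ⟨h2, h3⟩ := hXin (z + p) (h1 ▸ hm0.ne')
    refine ⟨?_, by rw [h2, h1, sub_self]⟩
    rw [h3, neg_eq_zero]
    have h4 : IsLocalMax ψ (z + p) := Filter.Eventually.of_forall fun y => h1 ▸ hm y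
    have h5 := h4.hasFDerivAt_eq_zero (hψ _)
    have h6 := congrArg (fun L : _ →L[ℝ] ℝ => L (Ψ (z + p))) h5
    simpa using h6
  obtain ⟨F₀, hF1, hF2, hF3⟩ := exists_periodic_solution hk hC
    (H := fun z => H₁ (z + p)) (X := fun z => X₁ (z + p))
    (fun u v => by simpa using hXL (u + p) (v + p))
    (fun u v => by
      simpa using IsQuadGradient.of_hasFDerivAt hC hd hXL (u + p) (v + p))
    (fun z => (sub_nonneg.2 (hm _)).trans (hH1ge _)) (half_pos hr) hloc hq hq' hlow
    (M := B + σ * π * M₁ + ε * M₂ + ‖diagMul Q p‖) hQne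
    (fun z => by
      have : X₁ (z + p) - diagMul Q z = (X₁ (z + p) - diagMul Q (z + p)) + diagMul Q p := by
        rw [map_add]; abel
      rw [this]
      exact (norm_add_le _ _).trans (add_le_add_left (hQX _) _))
    (fun i => Y i - ContinuousMap.const _ p)
  let F : ContLoop n := F₀ + ContinuousMap.const _ p
  have hFF : ∀ t, F t = F₀ t + p := fun t => rfl
  have hsol : ∀ t : ℝ, HasDerivAt (fun t : ℝ => F t) (Complex.I • X₁ (F t)) t :=
    fun t => (hF1 t).add_const p
  have hXc : Continuous X₁ := (LipschitzWith.of_dist_le_mul (K := C.toNNReal) fun u v => by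
    simpa only [dist_eq_norm, Real.coe_toNNReal C hC] using hXL u v).continuous
  have hHc : Continuous H₁ := continuous_iff_continuousAt.2 fun x => (hd x).continuousAt
  have hFc : Continuous fun t : ℝ => F (t : AddCircle (1:ℝ)) :=
    F.continuous.comp (AddCircle.continuous_mk' 1)
  have hmean : ∫ t in (0:ℝ)..1, X₁ (F t) = 0 := by
    have h1 := intervalIntegral.integral_eq_sub_of_hasDerivAt (a := 0) (b := 1)
      (fun t _ => hsol t) ((hXc.comp hFc).const_smul Complex.I |>.intervalIntegrable 0 1)
    rw [intervalIntegral.integral_smul] at h1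
    have h2 : F ((1:ℝ) : AddCircle (1:ℝ)) = F ((0:ℝ) : AddCircle (1:ℝ)) := by
      congr 1
      rw [AddCircle.coe_period]; rfl
    rw [h2, sub_self] at h1
    exact (smul_eq_zero.1 h1).resolve_left Complex.I_ne_zero
  have haction : 0 < ∫ t in (0:ℝ)..1, (1 / 2 * inner ℝ (X₁ (F t)) (F t) - H₁ (F t)) := by
    have i1 : IntervalIntegrable (fun t : ℝ => 1 / 2 * inner ℝ (X₁ (F t)) (F t) - H₁ (F t))
        volume 0 1 := Continuous.intervalIntegrable (by fun_prop) 0 1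
    have i2 : IntervalIntegrable (fun t : ℝ => 1 / 2 * inner ℝ p (X₁ (F t))) volume 0 1 :=
      Continuous.intervalIntegrable (by fun_prop) 0 1
    have e1 : ∫ t in (0:ℝ)..1, 1 / 2 * inner ℝ p (X₁ (F t)) = 0 := by
      rw [intervalIntegral.integral_const_mul]
      have := (innerSL ℝ p).intervalIntegral_comp_comm
        ((hXc.comp hFc).intervalIntegrable (μ := volume) 0 1)
      simp only [innerSL_apply_apply, Function.comp_apply] at this
      rw [this, hmean, inner_zero_right, mul_zero]
    refine hF2.trans_eq ?_
    have e2 : ∫ t in (0:ℝ)..1, (1 / 2 * inner ℝ (X₁ (F t)) (F t) - H₁ (F t)) =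
        (∫ t in (0:ℝ)..1, (1 / 2 * inner ℝ (X₁ (F t)) (F t) - H₁ (F t))) -
          ∫ t in (0:ℝ)..1, 1 / 2 * inner ℝ p (X₁ (F t)) := by rw [e1, sub_zero]
    rw [e2, ← intervalIntegral.integral_sub i1 i2]
    refine intervalIntegral.integral_congr fun t _ => ?_
    simp only [hFF, inner_add_right, real_inner_comm p]
    ring
  have hin : ∀ t, ψ (F t) ≠ 0 := by
    have henergy : ∀ s t : ℝ, H₁ (F s) = H₁ (F t) := energy_const hd hsol
    by_cases he : H₁ (F ((0:ℝ) : AddCircle (1:ℝ))) < m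
    · intro t ht
      obtain ⟨t, rfl⟩ := QuotientAddGroup.mk_surjective t
      have h1 := hH1ge (F (t : AddCircle (1:ℝ)))
      rw [henergy t 0] at h1
      change ψ (F (t : AddCircle (1:ℝ))) = 0 at ht
      linarith
    · exfalso
      push Not at he
      have hz : ∀ t : ℝ, ψ (F t) = 0 := fun t => by
        by_contra h
        have h1 := (hXin _ h).1
        rw [henergy t 0] at h1
        exact h (le_antisymm (by linarith) (h0 _))
      have hle : ∀ t ∈ Icc (0:ℝ) 1, 1 / 2 * inner ℝ (X₁ (F t)) (F t) - H₁ (F t) ≤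
          σ * π * (a + w) + ε * (b + w) - m := fun t _ => by
        have h1 := radial_action_le ha hw.le g3 g4 g5 g6 g7 hP (F t)
        have h2 := radial_action_le hb hw.le g3 g4 g5 g6 g7 hR (F t)
        have h3 := mul_le_mul_of_nonneg_left h1 (by positivity : 0 ≤ σ * π)
        have h4 := mul_le_mul_of_nonneg_left h2 hε0.le
        simp only [X₁, H₁, hz t, hX0 _ (hz t), inner_add_left, real_inner_smul_left, neg_zero,
          inner_zero_left]
        linarith
      have h5 := intervalIntegral.integral_mono_on zero_le_one
        (Continuous.intervalIntegrable (by fun_prop) 0 1)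
        (continuous_const.intervalIntegrable (μ := volume) 0 1) hle
      rw [intervalIntegral.integral_const] at h5
      simp only [sub_zero, one_smul] at h5
      linarith
  refine ⟨F, hin, fun t => ?_, ?_, fun i s => ?_⟩
  · have := hsol t
    rwa [(hXin _ (hin t)).2, smul_neg] at this
  · refine haction.trans_eq (intervalIntegral.integral_congr fun t _ => ?_)
    rw [(hXin _ (hin t)).2, (hXin _ (hin t)).1]
  · obtain ⟨t, ht⟩ := hF3 i s
    refine ⟨t, fun h => ht ?_⟩
    rw [ContinuousMap.sub_apply, ContinuousMap.const_apply, ← h, hFF, add_sub_cancel_right]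

end BumpHamiltonian

section SymplecticMaps

variable {n : ℕ}

local notation "E" => EuclideanSpace ℂ (Fin n)

lemma real_inner_I_smul_I_smul (v w : E) :
    inner ℝ (Complex.I • v) (Complex.I • w) = inner ℝ v w := by
  rw [PiLp.inner_apply, PiLp.inner_apply]
  refine Finset.sum_congr rfl fun i _ => ?_
  simp only [Complex.inner, PiLp.smul_apply, smul_eq_mul, map_mul, Complex.conj_I]
  congr 1
  linear_combination -((starRingEnd ℂ) (v i) * w i) * Complex.I_mul_I

/-- The symplectic form `(v, w) ↦ ⟪i v, w⟫` as a continuous bilinear map. -/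
def symplecticForm (n : ℕ) :
    EuclideanSpace ℂ (Fin n) →L[ℝ] EuclideanSpace ℂ (Fin n) →L[ℝ] ℝ :=
  LinearMap.mkContinuous₂
    (LinearMap.mk₂ ℝ (fun v w : EuclideanSpace ℂ (Fin n) => (inner ℝ (Complex.I • v) w : ℝ))
      (fun _ _ _ => by rw [smul_add, inner_add_left])
      (fun _ _ _ => by rw [smul_comm, real_inner_smul_left, smul_eq_mul])
      (fun _ _ _ => by rw [inner_add_right])
      (fun _ _ _ => by rw [real_inner_smul_right, smul_eq_mul])) 1
    (fun v w => by
      rw [LinearMap.mk₂_apply, one_mul]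
      refine (norm_inner_le_norm _ _).trans_eq ?_
      rw [norm_smul, Complex.norm_I, one_mul])

lemma symplecticForm_apply (v w : E) :
    symplecticForm n v w = inner ℝ (Complex.I • v) w := rfl

lemma exists_equiv_of_symplectic {A : E →L[ℝ] E}
    (hA : ∀ v w, symplecticForm n (A v) (A w) = symplecticForm n v w) :
    ∃ B : E ≃L[ℝ] E, (B : E →L[ℝ] E) = A := by
  have hinj : Function.Injective (A : E →ₗ[ℝ] E) := by
    rw [← LinearMap.ker_eq_bot, LinearMap.ker_eq_bot']
    intro v hv
    have hv' : A v = 0 := hv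
    have h := hA v (Complex.I • v)
    rw [hv', map_zero, symplecticForm_apply, real_inner_I_smul_I_smul,
      real_inner_self_eq_norm_sq, zero_apply] at h
    exact norm_eq_zero.1 (eq_zero_of_pow_eq_zero h.symm)
  exact ⟨(LinearEquiv.ofInjectiveEndo _ hinj).toContinuousLinearEquiv, by ext; rfl⟩

lemma exists_openPartialHomeomorph {Φ : E → E} {V : Set E} (hV : IsOpen V) (hinj : InjOn Φ V)
    (hΦ : ∀ z ∈ V, ContDiffAt ℝ 2 Φ z)
    (hsymp : ∀ z ∈ V, ∀ v w, symplecticForm n (fderiv ℝ Φ z v) (fderiv ℝ Φ z w) =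
      symplecticForm n v w) :
    ∃ e : OpenPartialHomeomorph E E, e.source = V ∧ (∀ z, e z = Φ z) ∧
      ∀ x ∈ e.target, ContDiffAt ℝ 2 e.symm x := by
  have hopen : IsOpenMap (V.domRestrict Φ) := by
    rw [isOpenMap_iff_nhds_le]
    rintro ⟨z, hz⟩
    obtain ⟨B, hB⟩ := exists_equiv_of_symplectic (hsymp z hz)
    have h1 : HasStrictFDerivAt Φ (B : E →L[ℝ] E) z := by
      rw [hB]
      exact (hΦ z hz).hasStrictFDerivAt (by norm_num)
    have h2 := h1.map_nhds_eq_of_equiv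
    rw [domRestrict_apply, ← h2, domRestrict_eq, ← Filter.map_map, map_nhds_subtype_val,
      hV.nhdsWithin_eq hz]
  have hcont : ContinuousOn Φ V := fun z hz => (hΦ z hz).continuousAt.continuousWithinAt
  let e : OpenPartialHomeomorph E E := OpenPartialHomeomorph.ofContinuousOpenRestrict
    (hinj.toPartialEquiv Φ V) hcont hopen hV
  refine ⟨e, rfl, fun z => rfl, fun x hx => ?_⟩
  have hs : e.symm x ∈ V := e.map_target hx
  obtain ⟨B, hB⟩ := exists_equiv_of_symplectic (hsymp _ hs)
  refine e.contDiffAt_symm (f₀' := B) hx ?_ (hΦ _ hs)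
  rw [hB]
  exact ((hΦ _ hs).differentiableAt (by norm_num)).hasFDerivAt

/-- The pullback of the Liouville form under a symplectic map differs from the Liouville form by
an exact form. -/
lemma exists_primitive_of_symplectic {Φ : E → E} {V : Set E} (hV : IsOpen V) (hc : Convex ℝ V)
    (hΦ : ∀ z ∈ V, ContDiffAt ℝ 2 Φ z)
    (hsymp : ∀ z ∈ V, ∀ v w, symplecticForm n (fderiv ℝ Φ z v) (fderiv ℝ Φ z w) =
      symplecticForm n v w) :
    ∃ (G : E → ℝ) (G' : E → E →L[ℝ] ℝ), ∀ z ∈ V, HasFDerivAt G (G' z) z ∧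
      ∀ v, G' z v = symplecticForm n (Φ z) (fderiv ℝ Φ z v) - symplecticForm n z v := by
  let α : E → E →L[ℝ] ℝ := fun z =>
    (symplecticForm n (Φ z)).comp (fderiv ℝ Φ z) - symplecticForm n z
  have hα : ∀ z ∈ V, HasFDerivAt α
      ((ContinuousLinearMap.compL ℝ E E ℝ (symplecticForm n (Φ z))).comp
        (fderiv ℝ (fderiv ℝ Φ) z) +
        ((ContinuousLinearMap.compL ℝ E E ℝ).flip (fderiv ℝ Φ z)).comp
          ((symplecticForm n).comp (fderiv ℝ Φ z)) - symplecticForm n) z := by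
    intro z hz
    have h1 : HasFDerivAt Φ (fderiv ℝ Φ z) z :=
      ((hΦ z hz).differentiableAt (by norm_num)).hasFDerivAt
    have h2 : HasFDerivAt (fderiv ℝ Φ) (fderiv ℝ (fderiv ℝ Φ) z) z :=
      (((hΦ z hz).fderiv_right (m := 1) (by norm_num)).differentiableAt (by norm_num)).hasFDerivAt
    have h3 := ((symplecticForm n).hasFDerivAt (x := Φ z)).comp z h1
    exact (h3.clm_comp h2).sub (symplecticForm n).hasFDerivAt
  obtain ⟨G, hG⟩ := hc.exists_forall_hasFDerivAt_of_fderiv_symmetric (ω := α) hV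
    (fun z hz => (hα z hz).differentiableAt.differentiableWithinAt) (fun z hz u v => by
      rw [(hα z hz).fderiv]
      have hs : fderiv ℝ (fderiv ℝ Φ) z u v = fderiv ℝ (fderiv ℝ Φ) z v u :=
        ((hΦ z hz).isSymmSndFDerivAt (by simp)) u v
      simp [hs, hsymp z hz])
  exact ⟨G, α, fun z hz => ⟨hG z hz, fun v => rfl⟩⟩

end SymplecticMaps

section Bump

variable {n : ℕ}

local notation "E" => EuclideanSpace ℂ (Fin n)

/-- A `C²` function on a Euclidean space has a `C¹` gradient field. -/
lemma exists_gradient_of_contDiff {ψ : E → ℝ} (hψ : ContDiff ℝ 2 ψ) :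
    ∃ Ψ : E → E, ContDiff ℝ 1 Ψ ∧ (∀ x, HasFDerivAt ψ (innerSL ℝ (Ψ x)) x) ∧
      ∀ x, fderiv ℝ ψ x = 0 → Ψ x = 0 := by
  let b := stdOrthonormalBasis ℝ E
  refine ⟨fun x => ∑ i, (fderiv ℝ ψ x (b i)) • b i, ?_, fun x => ?_, fun x hx => ?_⟩
  · refine ContDiff.sum fun i _ => ContDiff.fun_smul ?_ contDiff_const
    exact (hψ.fderiv_right (m := 1) (by norm_num)).clm_apply contDiff_const
  · refine ((hψ.differentiable (by norm_num)) x).hasFDerivAt.congr_fderiv ?_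
    ext v
    rw [innerSL_apply_apply, sum_inner]
    conv_lhs => rw [← b.sum_repr' v, map_sum]
    refine Finset.sum_congr rfl fun i _ => ?_
    rw [real_inner_smul_left, map_smul, smul_eq_mul, mul_comm]
  · simp [hx]

lemma contDiff_two_of_hasDerivAt {f g : ℝ → ℝ} (hg : ContDiff ℝ 1 g)
    (hf : ∀ s, HasDerivAt f (g s) s) : ContDiff ℝ 2 f := by
  have h : deriv f = g := funext fun s => (hf s).deriv
  have h2 : ContDiff ℝ (1 + 1) f := contDiff_succ_iff_deriv.2
    ⟨fun s => (hf s).differentiableAt, by simp, by rwa [h]⟩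
  rwa [one_add_one_eq_two] at h2

/-- Transport of a radial bump by a diffeomorphism of the sublevel set `{S < 1}`. -/
theorem exists_bump (e : OpenPartialHomeomorph E E) {S : E → ℝ} (hS : ContDiff ℝ 2 S)
    (hsource : e.source = {z | S z < 1}) (he : ∀ x ∈ e.target, ContDiffAt ℝ 2 e.symm x)
    {f g : ℝ → ℝ} (hg : ContDiff ℝ 1 g) (hf : ∀ s, HasDerivAt f (g s) s) {m η : ℝ} (hη : 0 < η)
    (hm : ∀ s ≥ 1 - η, f s = m) (hcomp : IsCompact {z | S z ≤ 1 - η}) :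
    ∃ (ψ : E → ℝ) (Ψ : E → E), (∀ x, HasFDerivAt ψ (innerSL ℝ (Ψ x)) x) ∧ ContDiff ℝ 1 Ψ ∧
      HasCompactSupport Ψ ∧ (∀ z, S z < 1 → ψ (e z) = m - f (S z)) ∧
      ∀ x ∉ e.target, ψ x = 0 := by
  classical
  let ψ : E → ℝ := fun x => if x ∈ e.target then m - f (S (e.symm x)) else 0
  have hin : ∀ x ∈ e.target, ψ x = m - f (S (e.symm x)) := fun x hx => if_pos hx
  have hout : ∀ x ∉ e.target, ψ x = 0 := fun x hx => if_neg hx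
  have hsub : {z | S z ≤ 1 - η} ⊆ e.source := by
    rw [hsource]
    intro z hz
    have : S z ≤ 1 - η := hz
    show S z < 1
    linarith
  have hL : IsCompact (e '' {z | S z ≤ 1 - η}) :=
    hcomp.image_of_continuousOn (e.continuousOn.mono hsub)
  have hzero : ∀ x ∉ e '' {z | S z ≤ 1 - η}, ψ x = 0 := by
    intro x hx
    by_cases ht : x ∈ e.target
    · rw [hin x ht]
      have : 1 - η ≤ S (e.symm x) := by
        by_contra h
        exact hx ⟨e.symm x, (not_le.1 h).le, e.right_inv ht⟩
      rw [hm _ this, sub_self]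
    · exact hout x ht
  have hnear : ∀ x ∉ e '' {z | S z ≤ 1 - η}, ψ =ᶠ[nhds x] fun _ => 0 := fun x hx => by
    filter_upwards [hL.isClosed.isOpen_compl.mem_nhds hx] with y hy using hzero y hy
  have hf2 : ContDiff ℝ 2 f := contDiff_two_of_hasDerivAt hg hf
  have hψ : ContDiff ℝ 2 ψ := by
    rw [contDiff_iff_contDiffAt]
    intro x
    by_cases ht : x ∈ e.target
    · have h1 : ContDiffAt ℝ 2 (fun x => m - f (S (e.symm x))) x :=
        contDiffAt_const.sub (hf2.contDiffAt.comp x (hS.contDiffAt.comp x (he x ht)))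
      refine h1.congr_of_eventuallyEq ?_
      filter_upwards [e.open_target.mem_nhds ht] with y hy using hin y hy
    · refine (contDiffAt_const (c := (0 : ℝ))).congr_of_eventuallyEq (hnear x ?_)
      rintro ⟨z, hz, rfl⟩
      exact ht (e.map_source (hsub hz))
  obtain ⟨Ψ, hΨ, hψΨ, hΨ0⟩ := exists_gradient_of_contDiff hψ
  refine ⟨ψ, Ψ, hψΨ, hΨ, HasCompactSupport.intro hL fun x hx => hΨ0 x ?_, fun z hz => ?_, hout⟩
  · rw [(hnear x hx).fderiv_eq]
    simp
  · have hz' : z ∈ e.source := by rw [hsource]; exact hz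
    rw [hin _ (e.map_source hz'), e.left_inv hz']

/-- Trajectories of a transported radial Hamiltonian inside the image of the sublevel set are
transported rotations, with explicitly known action density. -/
theorem transported_trajectory (e : OpenPartialHomeomorph E E) {S : E → ℝ} {D : E → E}
    (hS : ∀ z, HasFDerivAt S (innerSL ℝ (D z)) z)
    (hsource : e.source = {z | S z < 1}) (he : ∀ x ∈ e.target, ContDiffAt ℝ 2 e.symm x)
    (heΦ : ∀ z ∈ e.source, ContDiffAt ℝ 2 e z)
    (hsymp : ∀ z ∈ e.source, ∀ v w, symplecticForm n (fderiv ℝ e z v) (fderiv ℝ e z w) =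
      symplecticForm n v w) {f g : ℝ → ℝ} (hf : ∀ s, HasDerivAt f (g s) s) {m : ℝ}
    {ψ : E → ℝ} {Ψ : E → E} (hψ : ∀ x, HasFDerivAt ψ (innerSL ℝ (Ψ x)) x)
    (hψe : ∀ z, S z < 1 → ψ (e z) = m - f (S z)) {F : ℝ → E}
    (hF : ∀ t, HasDerivAt F (-(Complex.I • Ψ (F t))) t) (hin : ∀ t, F t ∈ e.target) (t : ℝ) :
    HasDerivAt (fun t => e.symm (F t))
      (Complex.I • (g (S (e.symm (F t))) • D (e.symm (F t)))) t := by
  have hz : e.symm (F t) ∈ e.source := e.map_target (hin t)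
  have hez : e (e.symm (F t)) = F t := e.right_inv (hin t)
  have h1 : HasDerivAt (fun t => e.symm (F t))
      (fderiv ℝ e.symm (F t) (-(Complex.I • Ψ (F t)))) t :=
    (((he _ (hin t)).differentiableAt (by norm_num)).hasFDerivAt).comp_hasDerivAt t (hF t)
  have h2 := (((heΦ _ hz).differentiableAt (by norm_num)).hasFDerivAt).comp_hasDerivAt t h1
  have h3 : HasDerivAt F (fderiv ℝ e (e.symm (F t))
      (fderiv ℝ e.symm (F t) (-(Complex.I • Ψ (F t))))) t :=
    h2.congr_of_eventuallyEq (Filter.Eventually.of_forall fun s => (e.right_inv (hin s)).symm)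
  have h4 := h3.unique (hF t)
  generalize fderiv ℝ e.symm (F t) (-(Complex.I • Ψ (F t))) = u at h1 h4
  refine h1.congr_deriv ?_
  have h5 : ∀ v, inner ℝ (Ψ (F t)) (fderiv ℝ e (e.symm (F t)) v) =
      -(g (S (e.symm (F t))) * inner ℝ (D (e.symm (F t))) v) := by
    intro v
    have hA : HasFDerivAt (fun z => ψ (e z))
        ((innerSL ℝ (Ψ (e (e.symm (F t))))).comp (fderiv ℝ e (e.symm (F t)))) (e.symm (F t)) :=
      (hψ _).comp _ (((heΦ _ hz).differentiableAt (by norm_num)).hasFDerivAt)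
    have hB : HasFDerivAt (fun z => m - f (S z))
        (-(g (S (e.symm (F t))) • innerSL ℝ (D (e.symm (F t))))) (e.symm (F t)) :=
      ((hf _).comp_hasFDerivAt _ (hS _)).const_sub m
    have hC := hA.unique (hB.congr_of_eventuallyEq (by
      filter_upwards [e.open_source.mem_nhds hz] with y hy
      exact hψe y (by rw [hsource] at hy; exact hy)))
    rw [hez] at hC
    have := congrArg (fun A : E →L[ℝ] ℝ => A v) hC
    simpa using this
  have h6 : ∀ v, inner ℝ (Complex.I • u + g (S (e.symm (F t))) • D (e.symm (F t))) v = 0 := by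
    intro v
    have h7 := hsymp _ hz u v
    rw [h4, symplecticForm_apply, symplecticForm_apply, smul_neg, smul_smul, Complex.I_mul_I,
      neg_one_smul, neg_neg, h5] at h7
    rw [inner_add_left, real_inner_smul_left, ← h7, neg_add_cancel]
  have h8 := inner_self_eq_zero.1 (h6 _)
  have h9 : u = -(Complex.I • (Complex.I • u)) := by
    rw [smul_smul, Complex.I_mul_I, neg_one_smul, neg_neg]
  rw [h9, eq_neg_of_add_eq_zero_left h8, smul_neg, neg_neg]

end Bump

section Ellipsoid

variable {n k : ℕ}

local notation "E" => EuclideanSpace ℂ (Fin n)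

/-- The weights of the ellipsoid with one short and `n - 1` long axes. -/
def ellipsoidWeight (n k : ℕ) (i : Fin n) : ℝ := if (i : ℕ) = 0 then 1 else 1 / k

/-- The quadratic Hamiltonian whose unit sublevel set is the ellipsoid `E(1, k, …, k)`. -/
def ellipsoidEnergy (n k : ℕ) (z : EuclideanSpace ℂ (Fin n)) : ℝ :=
  π * inner ℝ (diagMul (ellipsoidWeight n k) z) z

lemma ellipsoidEnergy_eq_sum (z : E) :
    ellipsoidEnergy n k z = π * ∑ i, ellipsoidWeight n k i * ‖z i‖ ^ 2 := by
  rw [ellipsoidEnergy, inner_diagMul_self]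

lemma ellipsoidWeight_nonneg (i : Fin n) : 0 ≤ ellipsoidWeight n k i := by
  unfold ellipsoidWeight; split_ifs <;> positivity

lemma one_le_mul_ellipsoidWeight (hk : 0 < k) (i : Fin n) : 1 ≤ k * ellipsoidWeight n k i := by
  have : (1 : ℝ) ≤ k := by exact_mod_cast hk
  unfold ellipsoidWeight
  split_ifs
  · rwa [mul_one]
  · rw [mul_one_div_cancel (by positivity)]

lemma pi_mul_norm_sq_le_ellipsoidEnergy (z : E) (h0 : 0 < n) :
    π * ‖z ⟨0, h0⟩‖ ^ 2 ≤ ellipsoidEnergy n k z := by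
  rw [ellipsoidEnergy_eq_sum]
  refine mul_le_mul_of_nonneg_left ?_ Real.pi_pos.le
  refine le_trans ?_ (Finset.single_le_sum (f := fun i => ellipsoidWeight n k i * ‖z i‖ ^ 2)
    (fun i _ => mul_nonneg (ellipsoidWeight_nonneg i) (by positivity))
    (Finset.mem_univ ⟨0, h0⟩))
  simp [ellipsoidWeight]

lemma hasFDerivAt_ellipsoidEnergy (z : E) :
    HasFDerivAt (ellipsoidEnergy n k)
      (innerSL ℝ ((2 * π) • diagMul (ellipsoidWeight n k) z)) z := by
  have h := (((diagMul (ellipsoidWeight n k)).hasFDerivAt (x := z)).inner ℝ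
    (hasFDerivAt_id z)).const_mul π
  refine h.congr_fderiv ?_
  ext v
  simp only [smul_apply, ContinuousLinearMap.comp_apply, ContinuousLinearMap.prod_apply,
    fderivInnerCLM_apply, innerSL_apply_apply, real_inner_smul_left, smul_eq_mul,
    ContinuousLinearMap.id_apply, id]
  rw [inner_diagMul_comm _ v z, real_inner_comm]
  ring

lemma contDiff_ellipsoidEnergy : ContDiff ℝ 2 (ellipsoidEnergy n k) :=
  contDiff_const.mul ((diagMul (ellipsoidWeight n k)).contDiff.inner ℝ contDiff_id)

lemma convex_ellipsoid (c : ℝ) : Convex ℝ {z : E | ellipsoidEnergy n k z < c} := by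
  have h : ConvexOn ℝ univ (ellipsoidEnergy n k) := by
    have h1 : ∀ i : Fin n, ConvexOn ℝ univ
        fun z : E => (π * ellipsoidWeight n k i) • ‖z i‖ ^ 2 := by
      intro i
      have h2 : ConvexOn ℝ univ fun z : E => ‖z i‖ :=
        (convexOn_norm convex_univ).comp_linearMap
          (PiLp.proj (𝕜 := ℝ) 2 (fun _ : Fin n => ℂ) i : E →ₗ[ℝ] ℂ)
      exact (h2.pow (fun _ _ => norm_nonneg _) 2).smul
        (mul_nonneg Real.pi_pos.le (ellipsoidWeight_nonneg i))
    have h3 : ellipsoidEnergy n k =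
        ∑ i, fun z : E => (π * ellipsoidWeight n k i) • ‖z i‖ ^ 2 := by
      ext z
      rw [ellipsoidEnergy_eq_sum, Finset.mul_sum, Finset.sum_apply]
      exact Finset.sum_congr rfl fun i _ => by rw [smul_eq_mul, mul_assoc]
    rw [h3]
    exact Finset.sum_induction _ (ConvexOn ℝ univ) (fun _ _ => ConvexOn.add)
      (convexOn_const 0 convex_univ) fun i _ => h1 i
  simpa using h.convex_lt c

lemma isCompact_ellipsoid (hk : 0 < k) (c : ℝ) :
    IsCompact {z : E | ellipsoidEnergy n k z ≤ c} := by
  refine Metric.isCompact_of_isClosed_isBounded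
    (isClosed_le contDiff_ellipsoidEnergy.continuous continuous_const) ?_
  refine (Metric.isBounded_closedBall (x := (0 : E)) (r := √(k * c / π))).subset fun z hz => ?_
  rw [mem_closedBall_zero_iff]
  refine Real.le_sqrt_of_sq_le ?_
  have h1 : ellipsoidEnergy n k z ≤ c := hz
  rw [le_div_iff₀ Real.pi_pos, EuclideanSpace.norm_sq_eq]
  refine le_trans ?_ (mul_le_mul_of_nonneg_left h1 (Nat.cast_nonneg k))
  rw [ellipsoidEnergy_eq_sum, mul_comm, mul_left_comm]
  refine mul_le_mul_of_nonneg_left ?_ Real.pi_pos.le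
  rw [Finset.mul_sum]
  refine Finset.sum_le_sum fun i _ => ?_
  rw [← mul_assoc]
  exact le_mul_of_one_le_left (by positivity) (one_le_mul_ellipsoidWeight hk i)

lemma eq_exp_mul_of_hasDerivAt {ζ : ℝ → ℂ} {c : ℝ}
    (h : ∀ t, HasDerivAt ζ (2 * π * c * Complex.I * ζ t) t) (t : ℝ) :
    ζ t = Complex.exp (2 * π * c * t * Complex.I) * ζ 0 := by
  have h1 : ∀ t : ℝ, HasDerivAt (fun t : ℝ => Complex.exp (-(2 * π * c * t * Complex.I)) * ζ t)
      0 t := by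
    intro t
    have h2 : HasDerivAt (fun t : ℝ => -(2 * π * c * (t : ℂ) * Complex.I))
        (-(2 * π * c * 1 * Complex.I)) t :=
      (((Complex.ofRealCLM.hasDerivAt (x := t)).const_mul (2 * π * c : ℂ)).mul_const
        Complex.I).neg
    refine (h2.cexp.mul (h t)).congr_deriv ?_
    ring
  have h3 := is_const_of_deriv_eq_zero (fun t => (h1 t).differentiableAt)
    (fun t => (h1 t).deriv) t 0
  simp only [Complex.ofReal_zero, mul_zero, zero_mul, neg_zero, Complex.exp_zero, one_mul] at h3
  rw [← h3, ← mul_assoc, ← Complex.exp_add, add_neg_cancel, Complex.exp_zero, one_mul]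

lemma exists_int_of_periodic {ζ : ℝ → ℂ} {c : ℝ}
    (h : ∀ t, HasDerivAt ζ (2 * π * c * Complex.I * ζ t) t) (hp : ζ 1 = ζ 0) (h0 : ζ 0 ≠ 0) :
    ∃ j : ℤ, c = j := by
  have h1 := eq_exp_mul_of_hasDerivAt h 1
  rw [hp] at h1
  have h2 := (mul_eq_right₀ h0).1 h1.symm
  obtain ⟨j, hj⟩ := Complex.exp_eq_one_iff.1 h2
  refine ⟨j, ?_⟩
  have h3 : (c : ℂ) = j := by
    have : (2 * π * Complex.I : ℂ) ≠ 0 := Complex.two_pi_I_ne_zero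
    apply mul_left_cancel₀ this
    rw [Complex.ofReal_one] at hj
    linear_combination hj
  exact_mod_cast h3

/-- A trajectory of a radial Hamiltonian on the ellipsoid stays on an energy level and rotates
its coordinates uniformly. -/
lemma ellipsoid_trajectory {g : ℝ → ℝ} {z : ℝ → E}
    (hz : ∀ t, HasDerivAt z (Complex.I • (g (ellipsoidEnergy n k (z t)) •
      ((2 * π) • diagMul (ellipsoidWeight n k) (z t)))) t) :
    (∀ t, ellipsoidEnergy n k (z t) = ellipsoidEnergy n k (z 0)) ∧
      ∀ i t, HasDerivAt (fun t => z t i)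
        (2 * π * (g (ellipsoidEnergy n k (z 0)) * ellipsoidWeight n k i : ℝ) *
          Complex.I * z t i) t := by
  have h1 : ∀ t, ellipsoidEnergy n k (z t) = ellipsoidEnergy n k (z 0) := by
    have h2 : ∀ t, HasDerivAt (fun t => ellipsoidEnergy n k (z t)) 0 t := by
      intro t
      refine ((hasFDerivAt_ellipsoidEnergy (z t)).comp_hasDerivAt t (hz t)).congr_deriv ?_
      rw [innerSL_apply_apply, smul_comm, real_inner_smul_right,
        real_inner_I_smul_self_euclidean, mul_zero]
    exact fun t => is_const_of_deriv_eq_zero (fun t => (h2 t).differentiableAt)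
      (fun t => (h2 t).deriv) t 0
  refine ⟨h1, fun i t => ?_⟩
  have h3 := ((PiLp.proj (𝕜 := ℝ) 2 (fun _ : Fin n => ℂ) i).hasFDerivAt
    (x := z t)).comp_hasDerivAt t (hz t)
  refine h3.congr_deriv ?_
  rw [h1 t]
  simp
  ring

end Ellipsoid

section Obstruction

variable {n : ℕ}

local notation "E" => EuclideanSpace ℂ (Fin n)

/-- The action of a transported trajectory of a radial Hamiltonian on the ellipsoid. -/
lemma transported_action {k : ℕ} (e : OpenPartialHomeomorph E E)
    (hsource : e.source = {z | ellipsoidEnergy n k z < 1})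
    (heΦ : ∀ z ∈ e.source, ContDiffAt ℝ 2 e z)
    (hsymp : ∀ z ∈ e.source, ∀ v w, symplecticForm n (fderiv ℝ e z v) (fderiv ℝ e z w) =
      symplecticForm n v w) {f g : ℝ → ℝ} {m : ℝ} {ψ : E → ℝ} {Ψ : E → E}
    (hψ : ∀ x, HasFDerivAt ψ (innerSL ℝ (Ψ x)) x) (hΨ : Continuous Ψ)
    (hψe : ∀ z, ellipsoidEnergy n k z < 1 → ψ (e z) = m - f (ellipsoidEnergy n k z))
    {F z : ℝ → E} (hF : ∀ t, HasDerivAt F (-(Complex.I • Ψ (F t))) t)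
    (hz : ∀ t, z t ∈ e.source) (hFz : ∀ t, F t = e (z t)) (hz1 : z 1 = z 0)
    (hz' : ∀ t, HasDerivAt z (Complex.I • (g (ellipsoidEnergy n k (z t)) •
      ((2 * π) • diagMul (ellipsoidWeight n k) (z t)))) t) :
    ∫ t in (0:ℝ)..1, (1/2 * inner ℝ (-Ψ (F t)) (F t) - (m - ψ (F t))) =
      g (ellipsoidEnergy n k (z 0)) * ellipsoidEnergy n k (z 0) -
        f (ellipsoidEnergy n k (z 0)) := by
  have hconst := (ellipsoid_trajectory hz').1
  generalize ellipsoidEnergy n k (z 0) = s at hconst ⊢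
  obtain ⟨G, G', hG⟩ := exists_primitive_of_symplectic e.open_source
    (hsource ▸ convex_ellipsoid 1) heΦ hsymp
  have hFc : Continuous F := continuous_iff_continuousAt.2 fun t => (hF t).continuousAt
  have hψc : Continuous ψ := continuous_iff_continuousAt.2 fun t => (hψ t).continuousAt
  have hderiv : ∀ t, HasDerivAt (fun t => 1/2 * G (z t) + (g s * s - f s) * t)
      (1/2 * inner ℝ (-Ψ (F t)) (F t) - (m - ψ (F t))) t := by
    intro t
    have h1 : HasDerivAt F (fderiv ℝ e (z t) (Complex.I • (g (ellipsoidEnergy n k (z t)) •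
        ((2 * π) • diagMul (ellipsoidWeight n k) (z t))))) t :=
      ((((heΦ _ (hz t)).differentiableAt (by norm_num)).hasFDerivAt).comp_hasDerivAt t
        (hz' t)).congr_of_eventuallyEq (Filter.Eventually.of_forall hFz)
    have h2 := h1.unique (hF t)
    have h3 := (hG _ (hz t)).1.comp_hasDerivAt t (hz' t)
    refine ((h3.const_mul (1/2)).add ((hasDerivAt_id t).const_mul (g s * s - f s))).congr_deriv ?_
    have hmem : ellipsoidEnergy n k (z t) < 1 := by
      have := hz t
      rw [hsource] at this
      exact this
    have h4 : ψ (F t) = m - f s := by rw [hFz, hψe _ hmem, hconst]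
    rw [(hG _ (hz t)).2, h2, ← hFz, symplecticForm_apply, symplecticForm_apply,
      real_inner_I_smul_I_smul, inner_neg_right, real_inner_I_smul_I_smul, h4, hconst,
      inner_neg_left, real_inner_comm, real_inner_smul_right, real_inner_smul_right,
      real_inner_comm]
    have h5 : π * inner ℝ (diagMul (ellipsoidWeight n k) (z t)) (z t) = s := hconst t
    rw [real_inner_comm] at h5
    linear_combination -(g s) * h5
  rw [intervalIntegral.integral_eq_sub_of_hasDerivAt (fun t _ => hderiv t)
    (Continuous.intervalIntegrable (by fun_prop) 0 1), hz1]
  ring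

/-- Periodic trajectories of slope less than `k` on the ellipsoid lie in the short axis. -/
lemma periodic_ellipsoid_trajectory {k : ℕ} (h0 : 0 < n) {g : ℝ → ℝ} {z : ℝ → E}
    (hz' : ∀ t, HasDerivAt z (Complex.I • (g (ellipsoidEnergy n k (z t)) •
      ((2 * π) • diagMul (ellipsoidWeight n k) (z t)))) t) (hz1 : z 1 = z 0)
    (hg0 : 0 < g (ellipsoidEnergy n k (z 0))) (hgk : g (ellipsoidEnergy n k (z 0)) < k)
    (hs : ellipsoidEnergy n k (z 0) ≠ 0) :
    ∃ j : ℕ, 0 < j ∧ j < k ∧ g (ellipsoidEnergy n k (z 0)) = j ∧ ∃ ζ : ℂ,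
      ellipsoidEnergy n k (z 0) = π * ‖ζ‖ ^ 2 ∧
      ∀ t : ℝ, z t =
        EuclideanSpace.single ⟨0, h0⟩ (Complex.exp (2 * π * j * t * Complex.I) * ζ) := by
  obtain ⟨-, hrot⟩ := ellipsoid_trajectory hz'
  have hE := ellipsoidEnergy_eq_sum (k := k) (z 0)
  generalize ellipsoidEnergy n k (z 0) = s at hg0 hgk hs hrot hE ⊢
  have hkpos : (0 : ℝ) < k := hg0.trans hgk
  have hlong : ∀ i : Fin n, i ≠ ⟨0, h0⟩ → z 0 i = 0 := by
    intro i hi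
    by_contra hne
    obtain ⟨j, hj⟩ := exists_int_of_periodic (hrot i) (by rw [hz1]) hne
    have hi' : (i : ℕ) ≠ 0 := fun h => hi (Fin.ext h)
    have h1 : g s * ellipsoidWeight n k i = g s / k := by
      rw [ellipsoidWeight, if_neg hi', mul_one_div]
    rw [h1] at hj
    have h2 : 0 < g s / k := div_pos hg0 hkpos
    have h3 : g s / k < 1 := (div_lt_one hkpos).2 hgk
    rw [hj] at h2 h3
    have h4 : 0 < j := by exact_mod_cast h2
    have h5 : j < 1 := by exact_mod_cast h3
    omega
  have hw : ellipsoidWeight n k ⟨0, h0⟩ = 1 := if_pos rfl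
  have hsζ : s = π * ‖z 0 ⟨0, h0⟩‖ ^ 2 := by
    rw [hE, Finset.sum_eq_single ⟨0, h0⟩ (fun i _ hi => by rw [hlong i hi]; simp)
      (fun h => absurd (Finset.mem_univ _) h), hw, one_mul]
  have hζ : z 0 ⟨0, h0⟩ ≠ 0 := by
    intro h
    rw [h] at hsζ
    exact hs (by simpa using hsζ)
  obtain ⟨j, hj⟩ := exists_int_of_periodic (hrot ⟨0, h0⟩) (by rw [hz1]) hζ
  rw [hw, mul_one] at hj
  have hj0 : 0 < j := by rw [hj] at hg0; exact_mod_cast hg0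
  have hjk : j < k := by rw [hj] at hgk; exact_mod_cast hgk
  lift j to ℕ using hj0.le
  refine ⟨j, by exact_mod_cast hj0, by exact_mod_cast hjk, by exact_mod_cast hj,
    z 0 ⟨0, h0⟩, hsζ, fun t => ?_⟩
  ext i
  rw [eq_exp_mul_of_hasDerivAt (hrot i) t]
  by_cases hi : i = ⟨0, h0⟩
  · subst hi
    rw [hw, mul_one, hj]
    simp
  · rw [hlong i hi]
    simp [hi]

/-- An explicit rotating loop in the short axis, transported by `Φ`. -/
def IsAxisLoop (Φ : E → E) (h0 : 0 < n) (j : ℕ) (ζ : ℂ) (F : ContLoop n) : Prop :=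
  ∀ t : ℝ, F t = Φ (EuclideanSpace.single ⟨0, h0⟩ (Complex.exp (2 * π * j * t * Complex.I) * ζ))

lemma IsAxisLoop.exists_shift {Φ : E → E} {h0 : 0 < n} {j : ℕ} (hj : 0 < j) {ζ ζ' : ℂ}
    {F F' : ContLoop n} (h : IsAxisLoop Φ h0 j ζ F) (h' : IsAxisLoop Φ h0 j ζ' F')
    (hζ : ‖ζ‖ = ‖ζ'‖) : ∃ s : AddCircle (1 : ℝ), ∀ t, F t = F' (t + s) := by
  have hjr : (j : ℂ) ≠ 0 := by exact_mod_cast hj.ne'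
  have hπ : (π : ℂ) ≠ 0 := by exact_mod_cast Real.pi_ne_zero
  let s : ℝ := (ζ.arg - ζ'.arg) / (2 * π * j)
  refine ⟨(s : AddCircle (1 : ℝ)), fun t => ?_⟩
  induction t using QuotientAddGroup.induction_on with
  | H t =>
    rw [← AddCircle.coe_add, h' (t + s), h t]
    congr 2
    have hexp : Complex.exp (2 * π * j * t * Complex.I) * Complex.exp (ζ.arg * Complex.I) =
        Complex.exp (2 * π * j * (t + s : ℝ) * Complex.I) * Complex.exp (ζ'.arg * Complex.I) := by
      rw [← Complex.exp_add, ← Complex.exp_add]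
      congr 1
      simp only [s]
      push_cast
      field_simp
      ring
    rw [← Complex.norm_mul_exp_arg_mul_I ζ, ← Complex.norm_mul_exp_arg_mul_I ζ', hζ]
    linear_combination (‖ζ'‖ : ℂ) * hexp

theorem euclidean_obstruction {k : ℕ} (h0 : 0 < n) (hk : 0 < k) (hkn : k + 1 ≤ n) {r : ℝ}
    {Φ : E → E}
    {U O : Set E} (hU : U = {z : E | π * ‖z ⟨0, h0⟩‖ ^ 2 ≤ 1}) (hO : IsOpen O) (hUO : U ⊆ O)
    (hΦ : ContDiffOn ℝ 2 Φ O) (hinj : InjOn Φ U)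
    (hsymp : ∀ z ∈ U, ∀ v w, symplecticForm n (fderiv ℝ Φ z v) (fderiv ℝ Φ z w) =
      symplecticForm n v w)
    (hmap : ∀ z ∈ U, π * ‖diagMul (firstWeight n k) (Φ z)‖ ^ 2 < r) : (k : ℝ) < r := by
  by_contra hrk
  push Not at hrk
  let K : Set E := {z | ellipsoidEnergy n k z ≤ 1}
  have hKU : K ⊆ U := by
    intro z hz
    rw [hU]
    exact (pi_mul_norm_sq_le_ellipsoidEnergy z h0).trans hz
  have hE0 : ellipsoidEnergy n k (0 : E) = 0 := by simp [ellipsoidEnergy]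
  have hK0 : (0 : E) ∈ K := by
    show ellipsoidEnergy n k (0 : E) ≤ 1
    rw [hE0]; exact zero_le_one
  have hKc : IsCompact K := isCompact_ellipsoid hk 1
  have hΦat : ∀ z ∈ U, ContDiffAt ℝ 2 Φ z := fun z hz => hΦ.contDiffAt (hO.mem_nhds (hUO hz))
  have hΦK : ContinuousOn Φ K := fun z hz => (hΦat z (hKU hz)).continuousAt.continuousWithinAt
  obtain ⟨z₁, hz₁, hmax₁⟩ := hKc.exists_isMaxOn ⟨0, hK0⟩
    (f := fun z => π * ‖diagMul (firstWeight n k) (Φ z)‖ ^ 2)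
    (continuousOn_const.mul (((diagMul (firstWeight n k)).continuous.comp_continuousOn hΦK).norm.pow
      2))
  obtain ⟨z₂, hz₂, hmax₂⟩ := hKc.exists_isMaxOn ⟨0, hK0⟩
    (f := fun z => ‖diagMul (lastWeight n k) (Φ z)‖ ^ 2)
    (((diagMul (lastWeight n k)).continuous.comp_continuousOn hΦK).norm.pow 2)
  let ρ : ℝ := π * ‖diagMul (firstWeight n k) (Φ z₁)‖ ^ 2
  have hρr : ρ < r := hmap z₁ (hKU hz₁)
  have hρ0 : 0 ≤ ρ := by positivity
  let ν : ℝ := max ρ (k - 1)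
  have hν0 : 0 ≤ ν := hρ0.trans (le_max_left _ _)
  have hνk : ν < k := max_lt (hρr.trans_le hrk) (by linarith)
  obtain ⟨η, m, f, g, hη, hη2, hνm, hg, hfg, hg0, hgk, hf0, hfm, hlow, hhigh, hinjg, hup⟩ :=
    exists_profile hν0 hνk
  let V : Set E := {z | ellipsoidEnergy n k z < 1}
  have hVU : V ⊆ U := fun z hz => hKU (LT.lt.le (a := ellipsoidEnergy n k z) hz)
  have hVo : IsOpen V := isOpen_lt contDiff_ellipsoidEnergy.continuous continuous_const
  obtain ⟨e, hsource, heq, hesymm⟩ := exists_openPartialHomeomorph hVo (hinj.mono hVU)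
    (fun z hz => hΦat z (hVU hz)) fun z hz => hsymp z (hVU hz)
  have heΦ : (e : E → E) = Φ := funext heq
  obtain ⟨ψ, Ψ, hψ, hΨ, hΨc, hψe, hψ0⟩ := exists_bump e contDiff_ellipsoidEnergy hsource hesymm
    hg hfg hη hhigh (isCompact_ellipsoid hk (1 - η))
  have htarget : ∀ x ∈ e.target, ∃ z ∈ V, x = e z := fun x hx =>
    ⟨e.symm x, hsource ▸ e.map_target hx, (e.right_inv hx).symm⟩
  have hm0 : 0 ≤ m := hν0.trans hνm.le
  have hψnonneg : ∀ x, 0 ≤ ψ x := by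
    intro x
    by_cases hx : x ∈ e.target
    · obtain ⟨z, hz, rfl⟩ := htarget x hx
      rw [hψe z hz, sub_nonneg]
      exact hfm _
    · rw [hψ0 x hx]
  have hψle : ∀ x, ψ x ≤ m := by
    intro x
    by_cases hx : x ∈ e.target
    · obtain ⟨z, hz, rfl⟩ := htarget x hx
      rw [hψe z hz]
      linarith [hf0 (ellipsoidEnergy n k z)]
    · rwa [hψ0 x hx]
  have hV0 : (0 : E) ∈ V := by
    show ellipsoidEnergy n k (0 : E) < 1
    rw [hE0]; exact zero_lt_one
  have hs0 : (0 : E) ∈ e.source := by rw [hsource]; exact hV0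
  have hp : ∀ᶠ x in nhds (e 0), ψ x = m := by
    have h1 : ContinuousAt (fun x => ellipsoidEnergy n k (e.symm x)) (e 0) :=
      contDiff_ellipsoidEnergy.continuous.continuousAt.comp
        (e.continuousAt_symm (e.map_source hs0))
    have h2 : ellipsoidEnergy n k (e.symm (e 0)) < η := by rwa [e.left_inv hs0, hE0]
    filter_upwards [h1.eventually_lt_const h2, e.open_target.mem_nhds (e.map_source hs0)]
      with x hx hxt
    rw [← e.right_inv hxt, hψe _ (by linarith), (hlow _ hx.le).1, sub_zero]
  obtain ⟨k, rfl⟩ : ∃ k', k = k' + 1 := ⟨k - 1, by omega⟩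
  classical
  let Good : ℕ → ContLoop n → Prop := fun j F => ∃ ζ : ℂ, IsAxisLoop Φ h0 j ζ F ∧
    π * ‖ζ‖ ^ 2 ≤ 1 / 2 ∧ 0 < g (π * ‖ζ‖ ^ 2) ∧ g (π * ‖ζ‖ ^ 2) = j
  let Y : Fin k → ContLoop n := fun j =>
    if h : ∃ F, Good (j + 1) F then h.choose else 0
  obtain ⟨F, hFψ, hF, hact, hFY⟩ := exists_solution_of_bump (by omega) hψ hΨ hΨc hψnonneg hψle
    (a := ρ / π) (b := ‖diagMul (lastWeight n (k + 1)) (Φ z₂)‖ ^ 2) (by positivity) (by positivity)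
    (by rw [mul_div_cancel₀ _ Real.pi_ne_zero]; exact (le_max_left _ _).trans_lt hνm)
    (by
      intro x hx
      have hxt : x ∈ e.target := by
        by_contra h
        exact hx (hψ0 x h)
      obtain ⟨z, hz, rfl⟩ := htarget x hxt
      rw [heq, le_div_iff₀' Real.pi_pos]
      have hzK : z ∈ K := LT.lt.le (a := ellipsoidEnergy n (k + 1) z) hz
      exact ⟨hmax₁ hzK, hmax₂ hzK⟩) hp Y
  have hin : ∀ t, F t ∈ e.target := fun t => by
    by_contra h
    exact hFψ t (hψ0 _ h)
  let z : ℝ → E := fun t => e.symm (F t)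
  have hzs : ∀ t, z t ∈ e.source := fun t => e.map_target (hin t)
  have hFz : ∀ t : ℝ, F t = e (z t) := fun t => (e.right_inv (hin t)).symm
  have hz1 : z 1 = z 0 := by
    show e.symm (F ((1 : ℝ) : AddCircle (1 : ℝ))) = e.symm (F ((0 : ℝ) : AddCircle (1 : ℝ)))
    rw [AddCircle.coe_period, AddCircle.coe_zero]
  have heΦat : ∀ z ∈ e.source, ContDiffAt ℝ 2 e z := fun z hz => by
    rw [heΦ]
    exact hΦat z (hVU (hsource ▸ hz))
  have hesymp : ∀ z ∈ e.source, ∀ v w,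
      symplecticForm n (fderiv ℝ e z v) (fderiv ℝ e z w) = symplecticForm n v w := by
    intro z hz
    rw [heΦ]
    exact hsymp z (hVU (hsource ▸ hz))
  have hz' := transported_trajectory e hasFDerivAt_ellipsoidEnergy hsource hesymm heΦat hesymp hfg
    hψ hψe hF fun t => hin t
  rw [transported_action e hsource heΦat hesymp hψ hΨ.continuous hψe hF hzs hFz hz1 hz'] at hact
  have hs1 : ellipsoidEnergy n (k + 1) (z 0) < 1 := by
    have := hzs 0
    rw [hsource] at this
    exact this
  have hgpos : 0 < g (ellipsoidEnergy n (k + 1) (z 0)) := by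
    refine (hg0 _).lt_of_ne' fun h => ?_
    rw [h, zero_mul] at hact
    linarith [hf0 (ellipsoidEnergy n (k + 1) (z 0))]
  have hs0' : ellipsoidEnergy n (k + 1) (z 0) ≠ 0 := fun h => by
    rw [h, (hlow 0 hη.le).2] at hgpos
    exact lt_irrefl _ hgpos
  obtain ⟨j, hj0, hjk, hgj, ζ, hsζ, hzt⟩ :=
    periodic_ellipsoid_trajectory h0 hz' hz1 hgpos (hgk _) hs0'
  have hjν : (j : ℝ) ≤ ν := by
    refine le_trans ?_ (le_max_right _ _)
    have : (j : ℝ) + 1 ≤ (k + 1 : ℕ) := by exact_mod_cast hjk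
    linarith
  rcases lt_or_ge (1 / 2) (ellipsoidEnergy n (k + 1) (z 0)) with hhalf | hhalf
  · have h1 := hup _ hhalf (hgj.trans_le hjν)
    rw [hgj] at hact
    have h2 : (j : ℝ) * ellipsoidEnergy n (k + 1) (z 0) ≤ j :=
      mul_le_of_le_one_right (Nat.cast_nonneg j) hs1.le
    linarith
  · rw [hsζ] at hhalf hgpos hgj
    have hloop : IsAxisLoop Φ h0 j ζ F := fun t => by
      rw [hFz, heq]
      exact congrArg Φ (hzt t)
    obtain ⟨j, rfl⟩ : ∃ j', j = j' + 1 := ⟨j - 1, by omega⟩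
    have hex : ∃ F, Good (j + 1) F := ⟨F, ζ, hloop, hhalf, hgpos, hgj⟩
    have hY : Y ⟨j, by omega⟩ = hex.choose := dif_pos hex
    obtain ⟨ζ', hloop', hhalf', hgpos', hgj'⟩ := hex.choose_spec
    rw [← hY] at hloop'
    have h3 := hinjg _ hhalf _ hhalf' hgpos (hgj.trans_le hjν) (hgj.trans hgj'.symm)
    have h4 : ‖ζ‖ = ‖ζ'‖ := by
      have h5 := mul_left_cancel₀ Real.pi_ne_zero h3
      exact (sq_eq_sq₀ (norm_nonneg _) (norm_nonneg _)).1 h5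
    obtain ⟨s, hs⟩ := hloop.exists_shift hj0 hloop' h4
    obtain ⟨t, ht⟩ := hFY ⟨j, by omega⟩ s
    exact ht (hs t)

end Obstruction

end Helpers

lemma symplecticForm_eq_omegaStd (n : ℕ) (v w : EuclideanSpace ℂ (Fin n)) :
    symplecticForm n v w = omegaStd n v.ofLp w.ofLp := by
  rw [symplecticForm_apply, PiLp.inner_apply, omegaStd]
  refine Finset.sum_congr rfl fun i _ => ?_
  simp [Complex.inner]
  ring

/-- **Theorem.** Let `n, k` be positive integers with `n - k ≥ 1`. If
`B̄²(1) × ℂ^{n-1} = {z : π|z₁|² ≤ 1}` embeds symplectically into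
`B^{2k}(r) × ℂ^{n-k}` for some `r > 0`, then `r > k`. -/
theorem cylinder_embedding_obstruction (n k : ℕ) (hk : 0 < k) (hkn : k + 1 ≤ n)
    (r : ℝ) (hr : 0 < r)
    (h : ∃ Φ, IsSymplecticEmbedding n
      {z : Fin n → ℂ | Real.pi * ‖z ⟨0, by omega⟩‖ ^ 2 ≤ 1} (ballCyl n k r) Φ) :
    (k : ℝ) < r := by
  obtain ⟨Φ, hinj, hmap, O, hO, hUO, hΦ, hsymp⟩ := h
  let L := PiLp.continuousLinearEquiv 2 ℝ fun _ : Fin n => ℂ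
  refine euclidean_obstruction (by omega) hk hkn (Φ := fun z => L.symm (Φ (L z))) (O := L ⁻¹' O) rfl
    (hO.preimage L.continuous) (fun z hz => hUO hz) ?_ ?_ ?_ ?_
  · exact L.symm.contDiff.comp_contDiffOn
      ((hΦ.of_le (WithTop.coe_le_coe.2 (le_top : (2 : ℕ∞) ≤ ⊤))).comp L.contDiff.contDiffOn
        fun z hz => hz)
  · intro z hz w hw hzw
    exact L.injective (hinj hz hw (L.symm.injective hzw))
  · intro z hz v w
    have h1 : HasFDerivAt Φ (fderiv ℝ Φ (L z)) (L z) :=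
      ((hΦ.contDiffAt (hO.mem_nhds (hUO hz))).differentiableAt (by simp)).hasFDerivAt
    have h2 := L.symm.hasFDerivAt.comp z (h1.comp z L.hasFDerivAt)
    have h3 : HasFDerivAt (fun z => L.symm (Φ (L z))) _ z := h2
    rw [h3.fderiv, symplecticForm_eq_omegaStd, symplecticForm_eq_omegaStd]
    exact hsymp (L z) hz (L v) (L w)
  · intro z hz
    rw [norm_diagMul_sq (firstWeight_mul_self n k)]
    have h1 : Real.pi * ∑ i : Fin n, (if (i : ℕ) < k then ‖Φ (L z) i‖ ^ 2 else 0) < r :=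
      hmap hz
    convert h1 using 3 with i
    rw [firstWeight, ite_mul, one_mul, zero_mul]
    rfl
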